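/- Let σ∈(0,1) and 0<ν≤N. There exists ε>0 depending only on ν, N, σ such that: if h satisfies the uniform ellipticity bounds with constants ν, N and the asymptotic flatness bounds with parameters σ, C_I ≤ ε, C_h ≤ ε, then there is a constant C = C(ν,N,σ) > 0 such that for every m ≥ 0, every continuous φ:[0,∞)→(0,∞), every operator H as in the context, and every smooth solution u of iφ(t)∂ₜu = Hu on [0,∞)×ℝ³ (Schwartz in x at each time) with u(0,·)=u₀, one has sup_{R>0} ⟨R⟩^{-2} ∫_{S_R} ( ∫₀^∞ φ(t)^{-1}|u(t,x)|² dt ) √(det h(x)) dS(x) + sup_{R>0} ⟨R⟩^{-1} ∫_{B_R} ( ∫₀^∞ φ(t)^{-1}|∇ₓu(t,x)|² dt ) √(det h(x)) dx ≤ C ‖Hu₀‖²_{L²(M_h)}, where S_R={|x|=R} with surface measure dS and B_R={|x|<R}. -/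

import Mathlib

noncomputable section
open MeasureTheory Real Set

abbrev Eu (n : ℕ) : Type := EuclideanSpace ℝ (Fin n)

def pd {n : ℕ} {F : Type*} [NormedAddCommGroup F] [NormedSpace ℝ F]
    (j : Fin n) (f : Eu n → F) (x : Eu n) : F :=
  fderiv ℝ f x (EuclideanSpace.single j 1)

def Chr {n : ℕ} (h : Eu n → Matrix (Fin n) (Fin n) ℝ) (i j k : Fin n) (x : Eu n) : ℝ :=
  (1/2) * ∑ l, (h x)⁻¹ i l *
    (pd j (fun y => h y l k) x + pd k (fun y => h y j l) x - pd l (fun y => h y j k) x)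

def Rscal {n : ℕ} (h : Eu n → Matrix (Fin n) (Fin n) ℝ) (x : Eu n) : ℝ :=
  ∑ j, ∑ k, (h x)⁻¹ j k *
    ((∑ i, pd i (fun y => Chr h i j k y) x) - (∑ i, pd k (fun y => Chr h i j i y) x)
      + (∑ i, ∑ l, Chr h l j k x * Chr h i i l x) - (∑ i, ∑ l, Chr h l j i x * Chr h i k l x))

def sdet {n : ℕ} (h : Eu n → Matrix (Fin n) (Fin n) ℝ) (x : Eu n) : ℝ := Real.sqrt (h x).det

def lapR {n : ℕ} (h : Eu n → Matrix (Fin n) (Fin n) ℝ) (f : Eu n → ℝ) (x : Eu n) : ℝ :=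
  (sdet h x)⁻¹ * ∑ j, pd j (fun y => sdet h y * ∑ k, (h y)⁻¹ j k * pd k f y) x

def lapC {n : ℕ} (h : Eu n → Matrix (Fin n) (Fin n) ℝ) (f : Eu n → ℂ) (x : Eu n) : ℂ :=
  ((sdet h x : ℝ) : ℂ)⁻¹ *
    ∑ j, pd j (fun y => ((sdet h y : ℝ) : ℂ) * ∑ k, (((h y)⁻¹ j k : ℝ) : ℂ) * pd k f y) x

def jap {n : ℕ} (x : Eu n) : ℝ := Real.sqrt (1 + ‖x‖ ^ 2)

def Hop (A : Fin 3 → Eu 3 → Fin 4 → Fin 4 → ℂ) (B : Eu 3 → Fin 4 → Fin 4 → ℂ)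
    (f : Eu 3 → Fin 4 → ℂ) (x : Eu 3) : Fin 4 → ℂ :=
  fun i => (∑ j, ∑ k, A j x i k * pd j f x k) + ∑ k, B x i k * f x k

def Elliptic (h : Eu 3 → Matrix (Fin 3) (Fin 3) ℝ) (ν N : ℝ) : Prop :=
  ∀ x : Eu 3, ∀ ξ : Fin 3 → ℝ,
    ν * (∑ j, ξ j ^ 2) ≤ (∑ j, ∑ k, (h x)⁻¹ j k * ξ j * ξ k) ∧
      (∑ j, ∑ k, (h x)⁻¹ j k * ξ j * ξ k) ≤ N * (∑ j, ξ j ^ 2)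

def opNorm {n : ℕ} (A : Matrix (Fin n) (Fin n) ℝ) : ℝ :=
  ‖LinearMap.toContinuousLinearMap (Matrix.toEuclideanLin A)‖

def pdM {n : ℕ} (j : Fin n) (H : Eu n → Matrix (Fin n) (Fin n) ℝ) (x : Eu n) :
    Matrix (Fin n) (Fin n) ℝ :=
  Matrix.of fun a b => pd j (fun y => H y a b) x

def AFlat (h : Eu 3 → Matrix (Fin 3) (Fin 3) ℝ) (σ CI Ch : ℝ) : Prop :=
  (∀ x : Eu 3, opNorm ((h x)⁻¹ - 1) ≤ CI * jap x ^ (-σ)) ∧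
  (∀ x : Eu 3,
    (∑ j, opNorm (pdM j (fun y => (h y)⁻¹) x))
      + ‖x‖ * (∑ j, ∑ k, opNorm (pdM j (pdM k (fun y => (h y)⁻¹)) x))
      + ‖x‖ ^ 2 * (∑ j, ∑ k, ∑ l, opNorm (pdM j (pdM k (pdM l (fun y => (h y)⁻¹))) x))
    ≤ Ch * jap x ^ (-(1 + σ)))

def sphInt (f : Eu 3 → ℝ) (R : ℝ) : ℝ :=
  R ^ 2 * ∫ ω : Metric.sphere (0 : Eu 3) 1, f (R • (ω : Eu 3)) ∂(volume.toSphere)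

def innC4 (h : Eu 3 → Matrix (Fin 3) (Fin 3) ℝ) (f g : Eu 3 → Fin 4 → ℂ) : ℂ :=
  ∫ x : Eu 3, (∑ i, (starRingEnd ℂ) (f x i) * g x i) * ((sdet h x : ℝ) : ℂ)

open scoped ContDiff Topology
open Filter

section PartialDerivatives
variable {n : ℕ} {F : Type*} [NormedAddCommGroup F] [NormedSpace ℝ F]

theorem HasFDerivAt.pd_eq {f : Eu n → F} {f' : Eu n →L[ℝ] F} {x : Eu n} (hf : HasFDerivAt f f' x)
    (j : Fin n) : pd j f x = f' (EuclideanSpace.single j 1) := by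
  rw [pd, hf.fderiv]

theorem pd_add {f g : Eu n → F} {x : Eu n} (hf : DifferentiableAt ℝ f x)
    (hg : DifferentiableAt ℝ g x) (j : Fin n) :
    pd j (fun y => f y + g y) x = pd j f x + pd j g x := by
  simp [pd, fderiv_fun_add hf hg]

theorem pd_sub {f g : Eu n → F} {x : Eu n} (hf : DifferentiableAt ℝ f x)
    (hg : DifferentiableAt ℝ g x) (j : Fin n) :
    pd j (fun y => f y - g y) x = pd j f x - pd j g x := by
  simp [pd, fderiv_fun_sub hf hg]

@[simp] theorem pd_const (c : F) (j : Fin n) (x : Eu n) : pd j (fun _ => c) x = 0 := by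
  simp [pd]

theorem pd_sum {ι : Type*} {s : Finset ι} {f : ι → Eu n → F} {x : Eu n}
    (hf : ∀ i ∈ s, DifferentiableAt ℝ (f i) x) (j : Fin n) :
    pd j (fun y => ∑ i ∈ s, f i y) x = ∑ i ∈ s, pd j (f i) x := by
  simp [pd, fderiv_fun_sum hf]

theorem pd_smul {f : Eu n → F} {c : Eu n → ℝ} {x : Eu n} (hc : DifferentiableAt ℝ c x)
    (hf : DifferentiableAt ℝ f x) (j : Fin n) :
    pd j (fun y => c y • f y) x = pd j c x • f x + c x • pd j f x := by
  simp [pd, fderiv_fun_smul hc hf, add_comm]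

theorem pd_mul {A : Type*} [NormedCommRing A] [NormedAlgebra ℝ A] {f g : Eu n → A} {x : Eu n}
    (hf : DifferentiableAt ℝ f x) (hg : DifferentiableAt ℝ g x) (j : Fin n) :
    pd j (fun y => f y * g y) x = pd j f x * g x + f x * pd j g x := by
  simp [pd, fderiv_fun_mul hf hg, add_comm, mul_comm]

theorem pd_const_mul {A : Type*} [NormedCommRing A] [NormedAlgebra ℝ A] {f : Eu n → A} {x : Eu n}
    (hf : DifferentiableAt ℝ f x) (c : A) (j : Fin n) :
    pd j (fun y => c * f y) x = c * pd j f x := by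
  rw [pd_mul (by fun_prop) hf]; simp

theorem pd_sq {f : Eu n → ℝ} {x : Eu n} (hf : DifferentiableAt ℝ f x) (j : Fin n) :
    pd j (fun y => f y ^ 2) x = 2 * f x * pd j f x := by
  simp_rw [pow_two]; rw [pd_mul hf hf]; ring

theorem pd_clm {G : Type*} [NormedAddCommGroup G] [NormedSpace ℝ G] (L : F →L[ℝ] G)
    {f : Eu n → F} {x : Eu n} (hf : DifferentiableAt ℝ f x) (j : Fin n) :
    pd j (fun y => L (f y)) x = L (pd j f x) := by
  exact ((L.hasFDerivAt).comp x hf.hasFDerivAt).pd_eq j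

theorem pd_apply {m : ℕ} {G : Type*} [NormedAddCommGroup G] [NormedSpace ℝ G]
    {f : Eu n → Fin m → G} {x : Eu n} (hf : DifferentiableAt ℝ f x)
    (j : Fin n) (k : Fin m) : pd j f x k = pd j (fun y => f y k) x :=
  (pd_clm (ContinuousLinearMap.proj (R := ℝ) (φ := fun _ : Fin m => G) k) hf j).symm

theorem pd_comp_real {f : Eu n → ℝ} {g : ℝ → ℝ} {x : Eu n} {g' : ℝ} (hg : HasDerivAt g g' (f x))
    (hf : DifferentiableAt ℝ f x) (j : Fin n) :
    pd j (fun y => g (f y)) x = g' * pd j f x := by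
  exact (hg.comp_hasFDerivAt x hf.hasFDerivAt).pd_eq j

theorem pd_coord (j k : Fin n) (x : Eu n) : pd j (fun y : Eu n => y k) x = if k = j then 1 else 0 := by
  refine (((EuclideanSpace.proj k : Eu n →L[ℝ] ℝ).hasFDerivAt (x := x)).pd_eq j).trans ?_
  simp

theorem pd_norm_sq (j : Fin n) (x : Eu n) : pd j (fun y : Eu n => ‖y‖ ^ 2) x = 2 * x j := by
  rw [((hasStrictFDerivAt_norm_sq x).hasFDerivAt).pd_eq]
  simp [EuclideanSpace.inner_single_right]

theorem ContDiff.pd {f : Eu n → F} (hf : ContDiff ℝ ∞ f) (j : Fin n) : ContDiff ℝ ∞ (pd j f) :=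
  (hf.fderiv_right (m := ∞) (by simp)).clm_apply contDiff_const

theorem ContDiff.continuous_pd {f : Eu n → F} (hf : ContDiff ℝ 1 f) (j : Fin n) :
    Continuous (_root_.pd j f) :=
  (hf.continuous_fderiv (by simp)).clm_apply continuous_const

theorem ContDiff.diffAt {f : Eu n → F} (hf : ContDiff ℝ ∞ f) (x : Eu n) : DifferentiableAt ℝ f x :=
  hf.differentiable (by simp) x

theorem pd_comm {f : Eu n → F} (hf : ContDiff ℝ ∞ f) (j k : Fin n) (x : Eu n) :
    pd j (pd k f) x = pd k (pd j f) x := by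
  have hd : DifferentiableAt ℝ (fderiv ℝ f) x :=
    ((hf.fderiv_right (m := ∞) (by simp)).differentiable (by simp)) x
  have key : ∀ a b : Fin n, pd a (pd b f) x =
      fderiv ℝ (fderiv ℝ f) x (EuclideanSpace.single a 1) (EuclideanSpace.single b 1) := fun a b =>
    pd_clm (ContinuousLinearMap.apply ℝ F (EuclideanSpace.single b (1 : ℝ))) hd a
  rw [key, key]
  exact (hf.contDiffAt.isSymmSndFDerivAt (by simpa using WithTop.coe_le_coe.2 (le_top : (2 : ℕ∞) ≤ ⊤))) _ _

theorem pd_congr {f g : Eu n → F} {x : Eu n} (h : f =ᶠ[𝓝 x] g) (j : Fin n) : pd j f x = pd j g x := by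
  rw [pd, pd, h.fderiv_eq]

theorem HasCompactSupport.pd {f : Eu n → F} (hf : HasCompactSupport f) (j : Fin n) :
    HasCompactSupport (pd j f) :=
  hf.fderiv_apply (𝕜 := ℝ) _

theorem integral_pd_of_integrable {f : Eu n → ℝ} (hf : Differentiable ℝ f) (j : Fin n)
    (h1 : Integrable f) (h2 : Integrable (pd j f)) : ∫ x, pd j f x = 0 := by
  have := integral_mul_fderiv_eq_neg_fderiv_mul_of_integrable (μ := (volume : Measure (Eu n)))
    (f := fun _ => (1 : ℝ)) (g := f) (v := EuclideanSpace.single j 1) (by simp)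
    (by simp only [one_mul]; exact h2) (by simpa using h1) (fun _ _ => by fun_prop) (fun x _ => hf x)
  simpa [_root_.pd] using this

theorem integral_pd_of_compact {f : Eu n → ℝ} (hf : ContDiff ℝ 1 f) (j : Fin n)
    (hc : HasCompactSupport f) : ∫ x, pd j f x = 0 :=
  integral_pd_of_integrable (hf.differentiable (by simp)) j
    (hf.continuous.integrable_of_hasCompactSupport hc)
    ((hf.continuous_pd j).integrable_of_hasCompactSupport (hc.pd j))

end PartialDerivatives

/-- The squared Euclidean norm of the gradient. -/
def gradSq {n : ℕ} (f : Eu n → ℝ) (x : Eu n) : ℝ := ∑ j, pd j f x ^ 2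

theorem gradSq_nonneg {n : ℕ} (f : Eu n → ℝ) (x : Eu n) : 0 ≤ gradSq f x := by
  unfold gradSq; positivity

theorem continuous_gradSq {n : ℕ} {f : Eu n → ℝ} (hf : ContDiff ℝ 1 f) : Continuous (gradSq f) :=
  continuous_finsetSum _ fun j _ => (hf.continuous_pd j).pow 2

theorem Eu.norm_sq_eq {n : ℕ} (x : Eu n) : ‖x‖ ^ 2 = ∑ j, x j ^ 2 := EuclideanSpace.real_norm_sq_eq x

theorem Eu.abs_apply_le {n : ℕ} (x : Eu n) (j : Fin n) : |x j| ≤ ‖x‖ := PiLp.norm_apply_le x j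

theorem integrable_and_integral_le_of_tendsto {α : Type*} [MeasurableSpace α] {μ : Measure α}
    {F : ℕ → α → ℝ} {g : α → ℝ} {B : ℕ → ℝ} {b : ℝ} (hF : ∀ n, Integrable (F n) μ)
    (h0 : ∀ n x, 0 ≤ F n x) (hlim : ∀ᵐ x ∂μ, Tendsto (fun n => F n x) atTop (𝓝 (g x)))
    (hB : ∀ n, ∫ x, F n x ∂μ ≤ B n) (hb : Tendsto B atTop (𝓝 b)) :
    Integrable g μ ∧ ∫ x, g x ∂μ ≤ b := by
  have hg : AEStronglyMeasurable g μ :=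
    aestronglyMeasurable_of_tendsto_ae _ (fun n => (hF n).aestronglyMeasurable) hlim
  have hg0 : 0 ≤ᵐ[μ] g := by
    filter_upwards [hlim] with x hx using ge_of_tendsto' hx fun n => h0 n x
  have hb0 : 0 ≤ b := ge_of_tendsto' hb fun n => (integral_nonneg (h0 n)).trans (hB n)
  have key : ∫⁻ x, ENNReal.ofReal (g x) ∂μ ≤ ENNReal.ofReal b := by
    calc ∫⁻ x, ENNReal.ofReal (g x) ∂μ
        = ∫⁻ x, liminf (fun n => ENNReal.ofReal (F n x)) atTop ∂μ := by
          refine lintegral_congr_ae ?_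
          filter_upwards [hlim] with x hx
          exact ((ENNReal.tendsto_ofReal hx).liminf_eq).symm
      _ ≤ liminf (fun n => ∫⁻ x, ENNReal.ofReal (F n x) ∂μ) atTop :=
          lintegral_liminf_le' fun n => (hF n).aestronglyMeasurable.aemeasurable.ennreal_ofReal
      _ ≤ liminf (fun n => ENNReal.ofReal (B n)) atTop := by
          refine liminf_le_liminf (Eventually.of_forall fun n => ?_)
          rw [← ofReal_integral_eq_lintegral_ofReal (hF n) (ae_of_all _ (h0 n))]
          exact ENNReal.ofReal_le_ofReal (hB n)
      _ = ENNReal.ofReal b := (ENNReal.tendsto_ofReal hb).liminf_eq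
  have hi : Integrable g μ :=
    (lintegral_ofReal_ne_top_iff_integrable hg hg0).1 (key.trans_lt ENNReal.ofReal_lt_top).ne
  refine ⟨hi, ?_⟩
  rw [← ofReal_integral_eq_lintegral_ofReal hi hg0] at key
  exact (ENNReal.ofReal_le_ofReal_iff hb0).1 key

/-- The weight `(S² + |x|²)^b`. -/
def pw (S b : ℝ) (x : Eu 3) : ℝ := (S ^ 2 + ‖x‖ ^ 2) ^ b

section Weights
variable {S : ℝ}

theorem pw_base_pos (hS : 0 < S) (x : Eu 3) : 0 < S ^ 2 + ‖x‖ ^ 2 := by positivity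

theorem pw_pos (hS : 0 < S) (b : ℝ) (x : Eu 3) : 0 < pw S b x := rpow_pos_of_pos (pw_base_pos hS x) b

theorem pw_add (hS : 0 < S) (b c : ℝ) (x : Eu 3) : pw S (b + c) x = pw S b x * pw S c x :=
  rpow_add (pw_base_pos hS x) b c

theorem pw_one (x : Eu 3) : pw S 1 x = S ^ 2 + ‖x‖ ^ 2 := rpow_one _

theorem pw_zero (x : Eu 3) : pw S 0 x = 1 := rpow_zero _

theorem contDiff_pw (hS : 0 < S) (b : ℝ) : ContDiff ℝ ∞ (pw S b) :=
  (contDiff_const.add (contDiff_norm_sq ℝ)).rpow_const_of_ne fun x => (pw_base_pos hS x).ne'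

theorem pd_pw (hS : 0 < S) (b : ℝ) (j : Fin 3) (x : Eu 3) :
    pd j (pw S b) x = x j * (2 * b * pw S (b - 1) x) := by
  have h1 : DifferentiableAt ℝ (fun y : Eu 3 => S ^ 2 + ‖y‖ ^ 2) x :=
    (differentiableAt_const _).add ((contDiff_norm_sq ℝ (n := 1)).differentiable (by simp) x)
  have := pd_comp_real (g := fun s => s ^ b) (f := fun y : Eu 3 => S ^ 2 + ‖y‖ ^ 2) (x := x)
    (Real.hasDerivAt_rpow_const (p := b) (Or.inl (pw_base_pos hS x).ne')) h1 j
  change pd j (pw S b) x = _ at this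
  rw [this, pd_add (differentiableAt_const _)
    ((contDiff_norm_sq ℝ (n := 1)).differentiable (by simp) x), pd_const, pd_norm_sq]
  simp only [pw]; ring

/-- Monotonicity of the weights in the exponent, for bases at least one. -/
theorem pw_mono (hS : 1 ≤ S) {b c : ℝ} (h : b ≤ c) (x : Eu 3) : pw S b x ≤ pw S c x :=
  rpow_le_rpow_of_exponent_le (by nlinarith [sq_nonneg ‖x‖]) h

theorem pw_le_pw_one (hS : 1 ≤ S) {b : ℝ} (hb : b ≤ 0) (x : Eu 3) : pw S b x ≤ pw 1 b x :=
  rpow_le_rpow_of_nonpos (by positivity) (by nlinarith [sq_nonneg ‖x‖]) hb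

theorem pw_sq (hS : 0 < S) (b : ℝ) (x : Eu 3) : pw S b x ^ 2 = pw S (2 * b) x := by
  rw [pow_two, ← pw_add hS]; ring_nf

theorem norm_le_pw_half (x : Eu 3) : ‖x‖ ≤ pw S (1 / 2) x := by
  rw [pw, ← Real.sqrt_eq_rpow]
  exact Real.le_sqrt_of_sq_le (by nlinarith)

theorem norm_mul_pw_le (hS : 0 < S) (b : ℝ) (x : Eu 3) : ‖x‖ * pw S b x ≤ pw S (b + 1 / 2) x := by
  rw [pw_add hS, mul_comm]
  exact mul_le_mul_of_nonneg_left (norm_le_pw_half x) (pw_pos hS b x).le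

theorem norm_sq_mul_pw_le (hS : 0 < S) (b : ℝ) (x : Eu 3) : ‖x‖ ^ 2 * pw S b x ≤ pw S (b + 1) x := by
  rw [pw_add hS, mul_comm, pw_one]
  exact mul_le_mul_of_nonneg_left (by nlinarith) (pw_pos hS b x).le

theorem norm_sq_mul_pw_eq (hS : 0 < S) (b : ℝ) (x : Eu 3) :
    ‖x‖ ^ 2 * pw S (b - 1) x = pw S b x - S ^ 2 * pw S (b - 1) x := by
  have : pw S b x = pw S (b - 1) x * pw S 1 x := by rw [← pw_add hS]; ring_nf
  rw [this, pw_one]; ring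

end Weights

theorem integrable_of_bound {f g : Eu 3 → ℝ} (hf : Continuous f) (hg : Integrable g)
    (h : ∀ x, |f x| ≤ g x) : Integrable f :=
  hg.mono' hf.aestronglyMeasurable (ae_of_all _ h)

theorem ae_ne_zero : ∀ᵐ x : Eu 3, x ≠ 0 := by
  simp [ae_iff]

/-- A regularized Hardy inequality in dimension three. -/
theorem hardy_regularized {f : Eu 3 → ℝ} (hf : ContDiff ℝ 1 f) (h0 : Integrable fun x => f x ^ 2)
    (h1 : Integrable (gradSq f)) {δ : ℝ} (hδ : 0 < δ) :
    Integrable (fun x => pw δ (-1) x * f x ^ 2) ∧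
      ∫ x, pw δ (-1) x * f x ^ 2 ≤ 4 * ∫ x, gradSq f x := by
  have hp : ContDiff ℝ 1 (pw δ (-1)) := (contDiff_pw hδ _).of_le (by simp)
  have hfc := hf.continuous
  have hpc := hp.continuous
  have hbd : ∀ x, pw δ (-1) x ≤ δ⁻¹ ^ 2 := fun x => by
    rw [pw, rpow_neg_one, inv_pow]
    exact inv_anti₀ (by positivity) (by nlinarith [sq_nonneg ‖x‖])
  have hr1 : ∀ x, ‖x‖ * pw δ (-1) x ≤ δ⁻¹ := fun x => by
    rw [pw, rpow_neg_one, ← div_eq_mul_inv, div_le_iff₀ (pw_base_pos hδ x)]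
    have : ‖x‖ * δ ≤ δ ^ 2 + ‖x‖ ^ 2 := by nlinarith [sq_nonneg (‖x‖ - δ), norm_nonneg x]
    calc ‖x‖ = δ⁻¹ * (‖x‖ * δ) := by field_simp
      _ ≤ _ := by gcongr
  have hr2 : ∀ x, ‖x‖ ^ 2 * pw δ (-1) x ≤ 1 := fun x => by
    simpa [pw_zero] using norm_sq_mul_pw_le hδ (-1) x
  have hi : Integrable (fun x => pw δ (-1) x * f x ^ 2) :=
    integrable_of_bound (by fun_prop) (h0.const_mul (δ⁻¹ ^ 2)) fun x => by
      rw [abs_of_nonneg (mul_nonneg (pw_pos hδ _ x).le (sq_nonneg _))]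
      exact mul_le_mul_of_nonneg_right (hbd x) (sq_nonneg _)
  refine ⟨hi, ?_⟩
  set G : Fin 3 → Eu 3 → ℝ := fun j x => x j * (pw δ (-1) x * f x ^ 2) with hG
  have hGd : ∀ j, ContDiff ℝ 1 (G j) := fun j => by fun_prop
  have hpdG : ∀ j x, pd j (G j) x = pw δ (-1) x * f x ^ 2
      + x j * (x j * (-2 * pw δ (-2) x) * f x ^ 2 + pw δ (-1) x * (2 * f x * pd j f x)) := by
    intro j x
    have d1 : DifferentiableAt ℝ f x := hf.differentiable (by simp) x
    have d2 : DifferentiableAt ℝ (pw δ (-1)) x := hp.differentiable (by simp) x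
    rw [hG]
    dsimp only
    rw [pd_mul (by fun_prop) (by fun_prop), pd_mul d2 (by fun_prop), pd_sq d1, pd_coord,
      pd_pw hδ]
    norm_num
  have hx : ∀ (x : Eu 3) j, x j ^ 2 ≤ ‖x‖ ^ 2 := fun x j => by
    rw [← sq_abs]; exact pow_le_pow_left₀ (abs_nonneg _) (Eu.abs_apply_le x j) 2
  have hGi : ∀ j, Integrable (G j) := fun j =>
    integrable_of_bound (hGd j).continuous (h0.const_mul δ⁻¹) fun x => by
      rw [hG, abs_mul, abs_of_nonneg (mul_nonneg (pw_pos hδ _ x).le (sq_nonneg _)), ← mul_assoc]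
      refine mul_le_mul_of_nonneg_right (le_trans ?_ (hr1 x)) (sq_nonneg _)
      exact mul_le_mul_of_nonneg_right (Eu.abs_apply_le x j) (pw_pos hδ _ x).le
  have h22 : ∀ x, ‖x‖ ^ 2 * pw δ (-2) x ≤ pw δ (-1) x := fun x => by
    have := norm_sq_mul_pw_le hδ (-2) x; norm_num at this; exact this
  have hcs : ∀ x, (∑ j, x j * pd j f x) ^ 2 ≤ ‖x‖ ^ 2 * gradSq f x := fun x => by
    rw [Eu.norm_sq_eq]; exact Finset.sum_mul_sq_le_sq_mul_sq _ _ _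
  have hpdi : ∀ j, Integrable (pd j (G j)) := fun j =>
    integrable_of_bound ((hGd j).continuous_pd j)
      ((hi.const_mul 4).add h1) fun x => by
      rw [hpdG]
      have e1 : 0 ≤ x j ^ 2 * pw δ (-2) x := mul_nonneg (sq_nonneg _) (pw_pos hδ _ x).le
      have e2 : x j ^ 2 * pw δ (-2) x ≤ pw δ (-1) x :=
        le_trans (mul_le_mul_of_nonneg_right (hx x j) (pw_pos hδ _ x).le) (h22 x)
      have e3 := pw_pos hδ (-1) x
      have e4 : x j ^ 2 * pw δ (-1) x ≤ 1 :=
        le_trans (mul_le_mul_of_nonneg_right (hx x j) (pw_pos hδ _ x).le) (hr2 x)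
      have e5 : pd j f x ^ 2 ≤ gradSq f x :=
        Finset.single_le_sum (f := fun j => pd j f x ^ 2) (fun _ _ => sq_nonneg _)
          (Finset.mem_univ j)
      have e6 : |x j * (pw δ (-1) x * (2 * f x * pd j f x))| ≤
          pw δ (-1) x * f x ^ 2 + gradSq f x := by
        have : x j ^ 2 * pw δ (-1) x * pd j f x ^ 2 ≤ gradSq f x := by
          nlinarith [sq_nonneg (pd j f x)]
        rw [abs_le]
        constructor <;> nlinarith [mul_nonneg e3.le (sq_nonneg (f x - x j * pd j f x)),
          mul_nonneg e3.le (sq_nonneg (f x + x j * pd j f x))]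
      have e7 : |x j * (x j * (-2 * pw δ (-2) x) * f x ^ 2)| ≤ 2 * (pw δ (-1) x * f x ^ 2) := by
        rw [abs_le]
        constructor <;> nlinarith [sq_nonneg (f x), mul_nonneg e1 (sq_nonneg (f x)),
          mul_nonneg (sub_nonneg.2 e2) (sq_nonneg (f x))]
      have e8 : 0 ≤ pw δ (-1) x * f x ^ 2 := by positivity
      rw [mul_add]
      refine (abs_add_le _ _).trans ?_
      rw [abs_of_nonneg e8]
      have := abs_add_le (x j * (x j * (-2 * pw δ (-2) x) * f x ^ 2))
        (x j * (pw δ (-1) x * (2 * f x * pd j f x)))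
      simp only [Pi.add_apply]
      linarith
  have hz : ∫ x, ∑ j, pd j (G j) x = 0 := by
    rw [integral_finsetSum _ fun j _ => hpdi j]
    exact Finset.sum_eq_zero fun j _ =>
      integral_pd_of_integrable ((hGd j).differentiable (by simp)) j (hGi j) (hpdi j)
  have hpt : ∀ x, pw δ (-1) x * f x ^ 2 ≤ 2 * ∑ j, pd j (G j) x + 4 * gradSq f x := by
    intro x
    have hs : ∑ j, pd j (G j) x = 3 * (pw δ (-1) x * f x ^ 2)
        - 2 * (‖x‖ ^ 2 * pw δ (-2) x * f x ^ 2)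
        + 2 * (pw δ (-1) x * f x * ∑ j, x j * pd j f x) := by
      simp only [hpdG, Eu.norm_sq_eq, Fin.sum_univ_three]; ring
    rw [hs]
    have e1 := mul_le_mul_of_nonneg_right (h22 x) (sq_nonneg (f x))
    have e3 := pw_pos hδ (-1) x
    have e4 : pw δ (-1) x * (∑ j, x j * pd j f x) ^ 2 ≤ gradSq f x := by
      calc _ ≤ pw δ (-1) x * (‖x‖ ^ 2 * gradSq f x) := by gcongr; exact hcs x
        _ = (‖x‖ ^ 2 * pw δ (-1) x) * gradSq f x := by ring
        _ ≤ 1 * gradSq f x := mul_le_mul_of_nonneg_right (hr2 x) (gradSq_nonneg f x)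
        _ = _ := one_mul _
    nlinarith [mul_nonneg e3.le (sq_nonneg (f x + 2 * ∑ j, x j * pd j f x)),
      mul_nonneg e3.le (sq_nonneg (f x))]
  have hsi : Integrable fun x => ∑ j, pd j (G j) x := integrable_finsetSum _ fun j _ => hpdi j
  calc ∫ x, pw δ (-1) x * f x ^ 2 ≤ ∫ x, (2 * ∑ j, pd j (G j) x + 4 * gradSq f x) :=
        integral_mono hi ((hsi.const_mul 2).add (h1.const_mul 4)) hpt
    _ = 4 * ∫ x, gradSq f x := by
        rw [integral_add (hsi.const_mul 2) (h1.const_mul 4), integral_const_mul,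
          integral_const_mul, hz]; ring

/-- **Hardy's inequality** in dimension three. -/
theorem hardy {f : Eu 3 → ℝ} (hf : ContDiff ℝ 1 f) (h0 : Integrable fun x => f x ^ 2)
    (h1 : Integrable (gradSq f)) :
    Integrable (fun x => f x ^ 2 / ‖x‖ ^ 2) ∧ ∫ x, f x ^ 2 / ‖x‖ ^ 2 ≤ 4 * ∫ x, gradSq f x := by
  have hδ : ∀ n : ℕ, (0 : ℝ) < 1 / ((n : ℝ) + 1) := fun n => by positivity
  refine integrable_and_integral_le_of_tendsto
    (F := fun n x => pw (1 / ((n : ℝ) + 1)) (-1) x * f x ^ 2)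
    (fun n => (hardy_regularized hf h0 h1 (hδ n)).1)
    (fun n x => mul_nonneg (pw_pos (hδ n) _ x).le (sq_nonneg _)) ?_
    (fun n => (hardy_regularized hf h0 h1 (hδ n)).2) tendsto_const_nhds
  filter_upwards [ae_ne_zero] with x hx
  have h2 : Tendsto (fun n : ℕ => (1 / ((n : ℝ) + 1)) ^ 2 + ‖x‖ ^ 2) atTop (𝓝 (‖x‖ ^ 2)) := by
    simpa using ((tendsto_one_div_add_atTop_nhds_zero_nat (𝕜 := ℝ)).pow 2).add_const (‖x‖ ^ 2)
  have h3 := (h2.inv₀ (by positivity)).mul_const (f x ^ 2)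
  rw [div_eq_inv_mul]
  refine h3.congr fun n => ?_
  rw [pw, rpow_neg_one]

/-- The Euclidean divergence of a vector field. -/
def vdiv (Y : Fin 3 → Eu 3 → ℝ) (x : Eu 3) : ℝ := ∑ l, pd l (Y l) x

/-- The radial vector field `x (S² + |x|²)^b`. -/
def radialField (S b : ℝ) (l : Fin 3) (x : Eu 3) : ℝ := x l * pw S b x

section RadialField
variable {S : ℝ}

theorem contDiff_radialField (hS : 0 < S) (b : ℝ) (l : Fin 3) : ContDiff ℝ ∞ (radialField S b l) := by
  have := contDiff_pw hS b
  unfold radialField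
  fun_prop

theorem pd_radialField (hS : 0 < S) (b : ℝ) (j l : Fin 3) (x : Eu 3) :
    pd j (radialField S b l) x
      = (if l = j then 1 else 0) * pw S b x + 2 * b * (x j * x l) * pw S (b - 1) x := by
  have d2 : DifferentiableAt ℝ (pw S b) x := (contDiff_pw hS b).diffAt x
  unfold radialField
  rw [pd_mul (by fun_prop) d2, pd_coord, pd_pw hS]
  ring

theorem vdiv_radialField (hS : 0 < S) (b : ℝ) (x : Eu 3) :
    vdiv (radialField S b) x = (3 + 2 * b) * pw S b x - 2 * b * S ^ 2 * pw S (b - 1) x := by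
  have h := norm_sq_mul_pw_eq hS b x
  rw [Eu.norm_sq_eq] at h
  simp only [vdiv, pd_radialField hS, Fin.sum_univ_three] at *
  simp only [if_true]
  linear_combination 2 * b * h

theorem vdiv_radialField_eq (hS : 0 < S) (b : ℝ) :
    vdiv (radialField S b)
      = fun x => (3 + 2 * b) * pw S b x - 2 * b * S ^ 2 * pw S (b - 1) x :=
  funext (vdiv_radialField hS b)

theorem pd_vdiv_radialField (hS : 0 < S) (b : ℝ) (j : Fin 3) (x : Eu 3) :
    pd j (vdiv (radialField S b)) x = (3 + 2 * b) * (2 * b) * radialField S (b - 1) j x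
      - 4 * b * (b - 1) * S ^ 2 * radialField S (b - 2) j x := by
  have d1 : DifferentiableAt ℝ (pw S b) x := (contDiff_pw hS b).diffAt x
  have d2 : DifferentiableAt ℝ (pw S (b - 1)) x := (contDiff_pw hS _).diffAt x
  rw [vdiv_radialField_eq hS, pd_sub (by fun_prop) (by fun_prop), pd_const_mul d1, pd_const_mul d2,
    pd_pw hS, pd_pw hS, show b - 1 - 1 = b - 2 by ring]
  simp only [radialField]
  ring

theorem laplacian_vdiv_radialField (hS : 0 < S) (b : ℝ) (x : Eu 3) :
    ∑ j, pd j (pd j (vdiv (radialField S b))) x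
      = (3 + 2 * b) * (2 * b) * ((1 + 2 * b) * pw S (b - 1) x
          - 2 * (b - 1) * S ^ 2 * pw S (b - 2) x)
        - 4 * b * (b - 1) * S ^ 2 * ((2 * b - 1) * pw S (b - 2) x
          - 2 * (b - 2) * S ^ 2 * pw S (b - 3) x) := by
  have h : ∀ j, pd j (pd j (vdiv (radialField S b))) x
      = (3 + 2 * b) * (2 * b) * pd j (radialField S (b - 1) j) x
      - 4 * b * (b - 1) * S ^ 2 * pd j (radialField S (b - 2) j) x := fun j => by
    have d1 : DifferentiableAt ℝ (radialField S (b - 1) j) x := (contDiff_radialField hS _ _).diffAt x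
    have d2 : DifferentiableAt ℝ (radialField S (b - 2) j) x := (contDiff_radialField hS _ _).diffAt x
    rw [show pd j (vdiv (radialField S b)) = fun y => _ from funext (pd_vdiv_radialField hS b j),
      pd_sub (by fun_prop) (by fun_prop), pd_const_mul d1, pd_const_mul d2]
  simp only [h, Finset.sum_sub_distrib, ← Finset.mul_sum]
  have h1 := vdiv_radialField hS (b - 1) x
  have h2 := vdiv_radialField hS (b - 2) x
  rw [vdiv] at h1 h2
  rw [h1, h2, show b - 1 - 1 = b - 2 by ring, show b - 2 - 1 = b - 3 by ring]
  ring

theorem abs_radialField_le (hS : 0 < S) (b : ℝ) (l : Fin 3) (x : Eu 3) :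
    |radialField S b l x| ≤ pw S (b + 1 / 2) x := by
  rw [radialField, abs_mul, abs_of_pos (pw_pos hS b x)]
  exact (mul_le_mul_of_nonneg_right (Eu.abs_apply_le x l) (pw_pos hS b x).le).trans
    (norm_mul_pw_le hS b x)

theorem abs_mul_apply_le (x : Eu 3) (j l : Fin 3) : |x j * x l| ≤ ‖x‖ ^ 2 := by
  rw [abs_mul, pow_two]
  exact mul_le_mul (Eu.abs_apply_le x j) (Eu.abs_apply_le x l) (abs_nonneg _) (norm_nonneg _)

theorem abs_pd_radialField_le (hS : 1 ≤ S) {b : ℝ} (hb : b ≤ -1 / 2) (hb' : -1 ≤ b) (j l : Fin 3)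
    (x : Eu 3) : |pd j (radialField S b l) x| ≤ 3 * pw 1 (-1 / 2) x := by
  have hS0 : 0 < S := by linarith
  have h1 : pw S b x ≤ pw 1 (-1 / 2) x :=
    (pw_le_pw_one hS (by linarith) x).trans (pw_mono le_rfl hb x)
  have h2 := norm_sq_mul_pw_le hS0 (b - 1) x
  rw [sub_add_cancel] at h2
  have h3 : |x j * x l| * pw S (b - 1) x ≤ pw S b x :=
    (mul_le_mul_of_nonneg_right (abs_mul_apply_le x j l) (pw_pos hS0 _ x).le).trans h2
  have h4 := pw_pos hS0 b x
  rw [pd_radialField hS0]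
  refine (abs_add_le _ _).trans ?_
  have e1 : |(if l = j then (1 : ℝ) else 0) * pw S b x| ≤ pw S b x := by
    rw [abs_mul, abs_of_pos h4]
    split_ifs <;> simp [h4.le]
  have e2 : |2 * b * (x j * x l) * pw S (b - 1) x| ≤ 2 * pw S b x := by
    have : 0 ≤ |x j * x l| * pw S (b - 1) x := mul_nonneg (abs_nonneg _) (pw_pos hS0 _ x).le
    rw [mul_assoc, abs_mul, abs_mul (x j * x l), abs_of_pos (pw_pos hS0 _ x),
      abs_of_nonpos (show 2 * b ≤ 0 by linarith)]
    nlinarith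
  linarith

theorem abs_pd_vdiv_radialField_le (hS : 1 ≤ S) {b : ℝ} (hb : b ≤ -1 / 2) (hb' : -1 ≤ b)
    (j : Fin 3) (x : Eu 3) : |pd j (vdiv (radialField S b)) x| ≤ 12 * pw 1 (-1) x := by
  have hS0 : 0 < S := by linarith
  have h1 : |radialField S (b - 1) j x| ≤ pw 1 (-1) x :=
    (abs_radialField_le hS0 _ j x).trans ((pw_le_pw_one hS (by linarith) x).trans
      (pw_mono le_rfl (by linarith) x))
  have h2 : S ^ 2 * |radialField S (b - 2) j x| ≤ pw 1 (-1) x := by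
    have e : S ^ 2 * pw S (b - 2 + 1 / 2) x ≤ pw S (b - 1 / 2) x := by
      have := norm_sq_mul_pw_eq hS0 (b - 1 / 2) x
      rw [show b - 1 / 2 - 1 = b - 2 + 1 / 2 by ring] at this
      have := mul_nonneg (sq_nonneg ‖x‖) (pw_pos hS0 (b - 2 + 1 / 2) x).le
      linarith
    exact (mul_le_mul_of_nonneg_left (abs_radialField_le hS0 _ j x) (sq_nonneg S)).trans
      (e.trans ((pw_le_pw_one hS (by linarith) x).trans (pw_mono le_rfl (by linarith) x)))
  rw [pd_vdiv_radialField hS0]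
  refine (abs_sub _ _).trans ?_
  have c1 : |(3 + 2 * b) * (2 * b)| ≤ 4 := by rw [abs_le]; constructor <;> nlinarith
  have c2 : |4 * b * (b - 1)| ≤ 8 := by rw [abs_le]; constructor <;> nlinarith
  have e1 : |(3 + 2 * b) * (2 * b) * radialField S (b - 1) j x| ≤ 4 * pw 1 (-1) x := by
    rw [abs_mul]
    exact mul_le_mul c1 h1 (abs_nonneg _) (by norm_num)
  have e2 : |4 * b * (b - 1) * S ^ 2 * radialField S (b - 2) j x| ≤ 8 * pw 1 (-1) x := by
    rw [mul_assoc, abs_mul, abs_mul (S ^ 2), abs_of_nonneg (sq_nonneg S)]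
    exact mul_le_mul c2 h2 (by positivity) (by norm_num)
  linarith

theorem quadForm_radialField (hS : 0 < S) (b : ℝ) (x : Eu 3) (p : Fin 3 → ℝ) :
    ∑ j, ∑ l, pd j (radialField S b l) x * p j * p l
      = pw S b x * (∑ j, p j ^ 2) + 2 * b * pw S (b - 1) x * (∑ j, x j * p j) ^ 2 := by
  simp only [pd_radialField hS, Fin.sum_univ_three]
  simp
  ring

end RadialField

/-- Quantitative properties of the vector fields used as Morawetz multipliers. -/
structure IsMultiplier (σ S : ℝ) (Y : Fin 3 → Eu 3 → ℝ) : Prop where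
  smooth : ∀ l, ContDiff ℝ ∞ (Y l)
  abs_le : ∀ l x, |Y l x| ≤ 6
  abs_pd_le : ∀ j l x, |pd j (Y l) x| ≤ 18 * pw 1 (-1 / 2) x
  abs_pd_vdiv_le : ∀ j x, |pd j (vdiv Y) x| ≤ 72 * pw 1 (-1) x
  le_quadForm : ∀ x (p : Fin 3 → ℝ),
    (σ * pw 1 (-(1 + σ) / 2) x + S ^ 2 * pw S (-3 / 2) x) * (∑ j, p j ^ 2)
      ≤ ∑ j, ∑ l, pd j (Y l) x * p j * p l
  laplacian_le : ∀ x, ∑ j, pd j (pd j (vdiv Y)) x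
    ≤ -(σ * pw 1 (-(3 + σ) / 2) x + 15 * S ^ 4 * pw S (-7 / 2) x)

theorem IsMultiplier.abs_vdiv_le {σ S : ℝ} {Y : Fin 3 → Eu 3 → ℝ} (h : IsMultiplier σ S Y)
    (x : Eu 3) : |vdiv Y x| ≤ 54 * pw 1 (-1 / 2) x := by
  rw [vdiv]
  refine (Finset.abs_sum_le_sum_abs _ _).trans ?_
  rw [Fin.sum_univ_three]
  linarith [h.abs_pd_le 0 0 x, h.abs_pd_le 1 1 x, h.abs_pd_le 2 2 x]

theorem IsMultiplier.contDiff_vdiv {σ S : ℝ} {Y : Fin 3 → Eu 3 → ℝ} (h : IsMultiplier σ S Y) :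
    ContDiff ℝ ∞ (vdiv Y) := by
  unfold vdiv
  exact ContDiff.sum fun l _ => (h.smooth l).pd l

/-- The Morawetz multiplier at scale `S`. -/
def morawetz (σ S : ℝ) (l : Fin 3) (x : Eu 3) : ℝ :=
  radialField S (-1 / 2) l x + 4 * radialField 1 (-1 / 2) l x - radialField 1 (-(1 + σ) / 2) l x

theorem pd_combination {a b c : Eu 3 → ℝ} (ha : ContDiff ℝ ∞ a) (hb : ContDiff ℝ ∞ b)
    (hc : ContDiff ℝ ∞ c) (j : Fin 3) (x : Eu 3) :
    pd j (fun y => a y + 4 * b y - c y) x = pd j a x + 4 * pd j b x - pd j c x := by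
  have h1 := ha.diffAt x
  have h2 := hb.diffAt x
  have h3 := hc.diffAt x
  rw [pd_sub (by fun_prop) h3, pd_add h1 (by fun_prop), pd_const_mul h2]

theorem contDiff_vdiv_radialField {S : ℝ} (hS : 0 < S) (b : ℝ) :
    ContDiff ℝ ∞ (vdiv (radialField S b)) :=
  ContDiff.sum fun l _ => (contDiff_radialField hS b l).pd l

theorem isMultiplier_morawetz {σ S : ℝ} (hσ : σ ∈ Ioo (0 : ℝ) 1) (hS : 1 ≤ S) :
    IsMultiplier σ S (morawetz σ S) := by
  obtain ⟨hσ0, hσ1⟩ := hσ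
  have hS0 : 0 < S := by linarith
  have h1 : (0 : ℝ) < 1 := one_pos
  have s1 := fun l => contDiff_radialField hS0 (-1 / 2) l
  have s2 := fun l => contDiff_radialField h1 (-1 / 2) l
  have s3 := fun l => contDiff_radialField h1 (-(1 + σ) / 2) l
  have hpd : ∀ j l x, pd j (morawetz σ S l) x = pd j (radialField S (-1 / 2) l) x
      + 4 * pd j (radialField 1 (-1 / 2) l) x - pd j (radialField 1 (-(1 + σ) / 2) l) x :=
    fun j l x => pd_combination (s1 l) (s2 l) (s3 l) j x
  have hdiv : vdiv (morawetz σ S) = fun x => vdiv (radialField S (-1 / 2)) x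
      + 4 * vdiv (radialField 1 (-1 / 2)) x - vdiv (radialField 1 (-(1 + σ) / 2)) x := by
    funext x
    simp only [vdiv, hpd, Finset.sum_sub_distrib, Finset.sum_add_distrib, Finset.mul_sum]
  have t1 := contDiff_vdiv_radialField hS0 (-1 / 2)
  have t2 := contDiff_vdiv_radialField h1 (-1 / 2)
  have t3 := contDiff_vdiv_radialField h1 (-(1 + σ) / 2)
  have hpdd : ∀ j x, pd j (vdiv (morawetz σ S)) x = pd j (vdiv (radialField S (-1 / 2))) x
      + 4 * pd j (vdiv (radialField 1 (-1 / 2))) x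
      - pd j (vdiv (radialField 1 (-(1 + σ) / 2))) x := fun j x => by
    rw [hdiv]; exact pd_combination t1 t2 t3 j x
  refine ⟨fun l => ?_, fun l x => ?_, fun j l x => ?_, fun j x => ?_, fun x p => ?_, fun x => ?_⟩
  · have a1 := s1 l
    have a2 := s2 l
    have a3 := s3 l
    unfold morawetz
    fun_prop
  · have a : ∀ S', 1 ≤ S' → ∀ b ≤ (-1 / 2 : ℝ), |radialField S' b l x| ≤ 1 := fun S' hS' b hb =>
      (abs_radialField_le (by linarith) b l x).trans
        ((pw_mono hS' (show b + 1 / 2 ≤ 0 by linarith) x).trans (pw_zero x).le)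
    have a1 := abs_le.1 (a S hS (-1 / 2) le_rfl)
    have a2 := abs_le.1 (a 1 le_rfl (-1 / 2) le_rfl)
    have a3 := abs_le.1 (a 1 le_rfl (-(1 + σ) / 2) (by linarith))
    rw [morawetz, abs_le]
    constructor <;> linarith [a1.1, a1.2, a2.1, a2.2, a3.1, a3.2]
  · have a1 := abs_le.1 (abs_pd_radialField_le hS (le_refl (-1 / 2)) (by norm_num) j l x)
    have a2 := abs_le.1 (abs_pd_radialField_le le_rfl (le_refl (-1 / 2)) (by norm_num) j l x)
    have a3 := abs_le.1 (abs_pd_radialField_le le_rfl (b := -(1 + σ) / 2) (by linarith)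
      (by linarith) j l x)
    rw [hpd, abs_le]
    constructor <;> linarith [a1.1, a1.2, a2.1, a2.2, a3.1, a3.2]
  · have a1 := abs_le.1 (abs_pd_vdiv_radialField_le hS (le_refl (-1 / 2)) (by norm_num) j x)
    have a2 := abs_le.1 (abs_pd_vdiv_radialField_le le_rfl (le_refl (-1 / 2)) (by norm_num) j x)
    have a3 := abs_le.1 (abs_pd_vdiv_radialField_le le_rfl (b := -(1 + σ) / 2) (by linarith)
      (by linarith) j x)
    rw [hpdd, abs_le]
    constructor <;> linarith [a1.1, a1.2, a2.1, a2.2, a3.1, a3.2]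
  · have hq : ∑ j, ∑ l, pd j (morawetz σ S l) x * p j * p l
        = ∑ j, ∑ l, pd j (radialField S (-1 / 2) l) x * p j * p l
          + 4 * ∑ j, ∑ l, pd j (radialField 1 (-1 / 2) l) x * p j * p l
          - ∑ j, ∑ l, pd j (radialField 1 (-(1 + σ) / 2) l) x * p j * p l := by
      simp only [hpd, Finset.mul_sum, ← Finset.sum_add_distrib, ← Finset.sum_sub_distrib]
      exact Finset.sum_congr rfl fun j _ => Finset.sum_congr rfl fun l _ => by ring
    rw [hq, quadForm_radialField hS0, quadForm_radialField h1, quadForm_radialField h1]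
    set P := ∑ j, p j ^ 2
    set q := (∑ j, x j * p j) ^ 2
    have hP : 0 ≤ P := by positivity
    have hqP : q ≤ ‖x‖ ^ 2 * P := by
      rw [Eu.norm_sq_eq]; exact Finset.sum_mul_sq_le_sq_mul_sq _ _ _
    have n1 := norm_sq_mul_pw_eq hS0 (-1 / 2) x
    have n2 := norm_sq_mul_pw_eq h1 (-1 / 2) x
    have n3 := norm_sq_mul_pw_eq h1 (-(1 + σ) / 2) x
    have m1 := pw_pos hS0 (-1 / 2 - 1) x
    have m2 := pw_pos h1 (-1 / 2 - 1) x
    have m3 := pw_pos h1 (-(1 + σ) / 2 - 1) x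
    have mm : pw 1 (-(1 + σ) / 2 - 1) x ≤ pw 1 (-1 / 2 - 1) x := pw_mono le_rfl (by linarith) x
    rw [show (-3 / 2 : ℝ) = -1 / 2 - 1 by norm_num]
    set a1 := pw S (-1 / 2 - 1) x
    set a2 := pw 1 (-1 / 2 - 1) x
    set a3 := pw 1 (-(1 + σ) / 2 - 1) x
    have k1 : (pw S (-1 / 2) x - S ^ 2 * a1) * P - a1 * q ≥ 0 := by
      rw [← n1]; nlinarith
    have hB : 0 ≤ 4 * a2 - (1 + σ) * a3 := by nlinarith
    have k2 := mul_le_mul_of_nonneg_left hqP hB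
    have k3 : (4 * a2 - (1 + σ) * a3) * (‖x‖ ^ 2 * P)
        = (4 * (pw 1 (-1 / 2) x - a2) - (1 + σ) * (pw 1 (-(1 + σ) / 2) x - a3)) * P := by
      linear_combination 4 * P * n2 - (1 + σ) * P * n3
    have k4 : 0 ≤ (4 * a2 - (1 + σ) * a3) * P := mul_nonneg hB hP
    nlinarith
  · have hl : ∑ j, pd j (pd j (vdiv (morawetz σ S))) x
        = ∑ j, pd j (pd j (vdiv (radialField S (-1 / 2)))) x
          + 4 * ∑ j, pd j (pd j (vdiv (radialField 1 (-1 / 2)))) x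
          - ∑ j, pd j (pd j (vdiv (radialField 1 (-(1 + σ) / 2)))) x := by
      simp only [Finset.mul_sum, ← Finset.sum_add_distrib, ← Finset.sum_sub_distrib]
      refine Finset.sum_congr rfl fun j _ => ?_
      rw [show pd j (vdiv (morawetz σ S)) = fun y => _ from funext (hpdd j)]
      exact pd_combination (t1.pd j) (t2.pd j) (t3.pd j) j x
    rw [hl, laplacian_vdiv_radialField hS0, laplacian_vdiv_radialField h1,
      laplacian_vdiv_radialField h1]
    have mm : pw 1 (-(1 + σ) / 2 - 3) x ≤ pw 1 (-1 / 2 - 3) x := pw_mono le_rfl (by linarith) x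
    have m3 := pw_pos h1 (-(1 + σ) / 2 - 3) x
    have m2 := pw_pos h1 (-(1 + σ) / 2 - 2) x
    have m1 := pw_pos h1 (-(1 + σ) / 2 - 1) x
    rw [show (-7 / 2 : ℝ) = -1 / 2 - 3 by norm_num, show -(3 + σ) / 2 = -(1 + σ) / 2 - 1 by ring]
    set b1 := pw 1 (-(1 + σ) / 2 - 1) x
    set b2 := pw 1 (-(1 + σ) / 2 - 2) x
    set b3 := pw 1 (-(1 + σ) / 2 - 3) x
    have c1 : σ * b1 ≤ σ * (1 + σ) * (2 - σ) * b1 := by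
      refine mul_le_mul_of_nonneg_right ?_ m1.le
      nlinarith [mul_pos hσ0 hσ0, mul_pos (mul_pos hσ0 hσ0) (sub_pos.2 hσ1)]
    have c2 : 0 ≤ 2 * σ * (1 + σ) * (3 + σ) * b2 := by positivity
    have c3 : (1 + σ) * (3 + σ) * (5 + σ) * b3 ≤ 48 * b3 := by
      refine mul_le_mul_of_nonneg_right ?_ m3.le
      have : (1 + σ) * (3 + σ) ≤ 8 := by nlinarith
      nlinarith
    nlinarith

section Cutoff

theorem exists_bound_deriv_smoothTransition :
    ∃ K > 0, ∀ t, |deriv Real.smoothTransition t| ≤ K := by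
  have hc : Continuous (deriv Real.smoothTransition) :=
    (Real.smoothTransition.contDiff (n := 1)).continuous_deriv (by simp)
  obtain ⟨K, hK⟩ := (isCompact_Icc (a := (0 : ℝ)) (b := 1)).exists_bound_of_continuousOn
    hc.continuousOn
  have h0 : ∀ t ∉ Icc (0 : ℝ) 1, deriv Real.smoothTransition t = 0 := by
    intro t ht
    rw [mem_Icc, not_and_or, not_le, not_le] at ht
    rcases ht with ht | ht
    · have : Real.smoothTransition =ᶠ[𝓝 t] fun _ => 0 := by
        filter_upwards [Iio_mem_nhds ht] with s hs
        exact Real.smoothTransition.zero_of_nonpos (le_of_lt hs)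
      rw [this.deriv_eq]; simp
    · have : Real.smoothTransition =ᶠ[𝓝 t] fun _ => 1 := by
        filter_upwards [Ioi_mem_nhds ht] with s hs
        exact Real.smoothTransition.one_of_one_le (le_of_lt hs)
      rw [this.deriv_eq]; simp
  refine ⟨max K 1, lt_max_of_lt_right one_pos, fun t => ?_⟩
  by_cases ht : t ∈ Icc (0 : ℝ) 1
  · exact (hK t ht).trans (le_max_left _ _)
  · rw [h0 t ht, abs_zero]
    exact le_max_of_le_right zero_le_one

/-- A bound for the derivative of the smooth transition function. -/
def transBd : ℝ := exists_bound_deriv_smoothTransition.choose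

theorem transBd_pos : 0 < transBd := exists_bound_deriv_smoothTransition.choose_spec.1

theorem abs_deriv_trans_le (t : ℝ) : |deriv Real.smoothTransition t| ≤ transBd :=
  exists_bound_deriv_smoothTransition.choose_spec.2 t

theorem monotone_smoothTransition : Monotone Real.smoothTransition := by
  intro a b hab
  have hd := fun t => Real.smoothTransition.pos_denom t
  simp only [Real.smoothTransition]
  rw [div_le_div_iff₀ (hd a) (hd b)]
  have h1 : expNegInvGlue a ≤ expNegInvGlue b := expNegInvGlue.monotone hab
  have h2 : expNegInvGlue (1 - b) ≤ expNegInvGlue (1 - a) := expNegInvGlue.monotone (by linarith)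
  have := mul_le_mul h1 h2 (expNegInvGlue.nonneg _) (expNegInvGlue.nonneg _)
  nlinarith

theorem deriv_trans_nonneg (t : ℝ) : 0 ≤ deriv Real.smoothTransition t :=
  monotone_smoothTransition.deriv_nonneg

theorem deriv_trans_of_neg {t : ℝ} (ht : t < 0) : deriv Real.smoothTransition t = 0 := by
  have : Real.smoothTransition =ᶠ[𝓝 t] fun _ => 0 := by
    filter_upwards [Iio_mem_nhds ht] with s hs
    exact Real.smoothTransition.zero_of_nonpos (le_of_lt hs)
  rw [this.deriv_eq]; simp

theorem hasDerivAt_trans (t : ℝ) :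
    HasDerivAt Real.smoothTransition (deriv Real.smoothTransition t) t :=
  ((Real.smoothTransition.contDiff (n := 1)).differentiable (by simp) t).hasDerivAt

/-- A smooth cutoff to the region `⟨x⟩ + c ≲ k`. -/
def cut (k c : ℝ) (x : Eu 3) : ℝ := Real.smoothTransition (2 - (pw 1 (1 / 2) x + c) / k)

/-- The slope of the cutoff profile. -/
def cutSlope (k c : ℝ) (x : Eu 3) : ℝ :=
  deriv Real.smoothTransition (2 - (pw 1 (1 / 2) x + c) / k) / k

variable {k c : ℝ}

theorem cut_nonneg (x : Eu 3) : 0 ≤ cut k c x := Real.smoothTransition.nonneg _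

theorem cut_le_one (x : Eu 3) : cut k c x ≤ 1 := Real.smoothTransition.le_one _

theorem contDiff_cut : ContDiff ℝ ∞ (cut k c) := by
  have := contDiff_pw one_pos (1 / 2)
  exact Real.smoothTransition.contDiff.comp (by fun_prop)

theorem cutSlope_nonneg (hk : 0 < k) (x : Eu 3) : 0 ≤ cutSlope k c x :=
  div_nonneg (deriv_trans_nonneg _) hk.le

theorem cutSlope_le (hk : 0 < k) (x : Eu 3) : cutSlope k c x ≤ transBd / k :=
  div_le_div_of_nonneg_right ((le_abs_self _).trans (abs_deriv_trans_le _)) hk.le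

theorem cutSlope_eq_zero (hk : 0 < k) {x : Eu 3} (hx : 2 * k < pw 1 (1 / 2) x + c) :
    cutSlope k c x = 0 := by
  rw [cutSlope, deriv_trans_of_neg, zero_div]
  rw [sub_neg, lt_div_iff₀ hk]; exact hx

theorem continuous_cutSlope : Continuous (cutSlope k c) := by
  have := (contDiff_pw one_pos (1 / 2)).continuous
  have h2 : Continuous (deriv Real.smoothTransition) :=
    (Real.smoothTransition.contDiff (n := 1)).continuous_deriv (by simp)
  unfold cutSlope
  fun_prop

theorem pd_cut (j : Fin 3) (x : Eu 3) :
    pd j (cut k c) x = -cutSlope k c x * (x j * pw 1 (-1 / 2) x) := by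
  have h1 : DifferentiableAt ℝ (pw 1 (1 / 2)) x := (contDiff_pw one_pos _).diffAt x
  have := pd_comp_real (f := pw 1 (1 / 2)) (x := x)
    (g := fun s => Real.smoothTransition (2 - (s + c) / k))
    (g' := deriv Real.smoothTransition (2 - (pw 1 (1 / 2) x + c) / k) * (-(1 / k)))
    ((hasDerivAt_trans _).comp _ ((((hasDerivAt_id _).add_const c).div_const k).const_sub 2)) h1 j
  change pd j (cut k c) x = _ at this
  rw [this, pd_pw one_pos, cutSlope, show (1 / 2 - 1 : ℝ) = -1 / 2 by norm_num]
  ring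

theorem hasDerivAt_cut (x : Eu 3) : HasDerivAt (fun c => cut k c x) (-cutSlope k c x) c := by
  have := (hasDerivAt_trans (2 - (pw 1 (1 / 2) x + c) / k)).comp c
    ((((hasDerivAt_id c).const_add (pw 1 (1 / 2) x)).div_const k).const_sub 2)
  refine this.congr_deriv ?_
  rw [cutSlope]; ring_nf

theorem gradSq_cut_le (x : Eu 3) : gradSq (cut k c) x ≤ cutSlope k c x ^ 2 := by
  have h : gradSq (cut k c) x = cutSlope k c x ^ 2 * (‖x‖ ^ 2 * pw 1 (-1) x) := by
    have := pw_sq one_pos (-1 / 2) x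
    norm_num at this
    simp only [gradSq, pd_cut, Eu.norm_sq_eq, Fin.sum_univ_three, ← this]
    ring_nf
  rw [h]
  have := norm_sq_mul_pw_le one_pos (-1) x
  norm_num [pw_zero] at this
  exact mul_le_of_le_one_right (sq_nonneg _) this

theorem abs_pd_cut_le (hk : 0 < k) (j : Fin 3) (x : Eu 3) : |pd j (cut k c) x| ≤ transBd / k := by
  refine le_trans (abs_le_of_sq_le_sq ?_ (cutSlope_nonneg hk x)) (cutSlope_le (c := c) hk x)
  exact le_trans (Finset.single_le_sum (f := fun j => pd j (cut k c) x ^ 2)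
    (fun _ _ => sq_nonneg _) (Finset.mem_univ j)) (gradSq_cut_le x)

theorem cut_eq_one (hk : 0 < k) {x : Eu 3} (hx : pw 1 (1 / 2) x + c ≤ k) : cut k c x = 1 := by
  refine Real.smoothTransition.one_of_one_le ?_
  have : (pw 1 (1 / 2) x + c) / k ≤ 1 := (div_le_one hk).2 hx
  linarith

theorem cut_eq_zero (hk : 0 < k) {x : Eu 3} (hx : 2 * k ≤ pw 1 (1 / 2) x + c) :
    cut k c x = 0 := by
  refine Real.smoothTransition.zero_of_nonpos ?_
  rw [sub_nonpos, le_div_iff₀ hk]; exact hx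

theorem cut_eq_zero_of_norm (hk : 0 < k) (hc : 0 ≤ c) {x : Eu 3} (hx : 2 * k ≤ ‖x‖) :
    cut k c x = 0 :=
  cut_eq_zero hk (by linarith [norm_le_pw_half (S := 1) x])

theorem hasCompactSupport_cut (hk : 0 < k) (hc : 0 ≤ c) : HasCompactSupport (cut k c) :=
  HasCompactSupport.intro (isCompact_closedBall (0 : Eu 3) (2 * k)) fun x hx =>
    cut_eq_zero_of_norm hk hc (by
      rw [mem_closedBall_zero_iff, not_le] at hx; exact hx.le)

theorem eventually_cut_eq_one (c : ℝ) (x : Eu 3) : ∀ᶠ k in atTop, cut k c x = 1 := by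
  filter_upwards [eventually_ge_atTop (pw 1 (1 / 2) x + c), eventually_gt_atTop 0] with k h1 h2
  exact cut_eq_one h2 h1

theorem exists_cut_eventually_eq_one {F : Type*} [Zero F] {g : Eu 3 → F}
    (hg : HasCompactSupport g) :
    ∃ k > 0, ∀ x ∈ tsupport g, ∀ᶠ y in 𝓝 x, cut k 0 y = 1 := by
  have hp := (contDiff_pw one_pos (1 / 2)).continuous
  obtain ⟨K, hK⟩ := hg.isCompact.exists_bound_of_continuousOn hp.continuousOn
  refine ⟨max K 0 + 1, by positivity, fun x hx => ?_⟩
  have h1 : pw 1 (1 / 2) x < max K 0 + 1 :=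
    ((le_abs_self _).trans ((hK x hx).trans (le_max_left _ _))).trans_lt (lt_add_one _)
  filter_upwards [(hp.tendsto x).eventually (gt_mem_nhds h1)] with y hy
  exact cut_eq_one (by positivity) (by rw [add_zero]; exact hy.le)

end Cutoff

/-- Quantitative closeness of an inverse metric `a`, a volume density `s` and a scalar curvature `R`
to the Euclidean ones. -/
structure NearFlat (σ ε : ℝ) (a : Fin 3 → Fin 3 → Eu 3 → ℝ) (s R : Eu 3 → ℝ) : Prop where
  smooth_inv : ∀ j k, ContDiff ℝ ∞ (a j k)
  smooth_density : ContDiff ℝ ∞ s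
  continuous_curv : Continuous R
  symm : ∀ j k x, a j k x = a k j x
  abs_inv_sub_le : ∀ j k x, |a j k x - if j = k then 1 else 0| ≤ ε * pw 1 (-σ / 2) x
  abs_pd_inv_le : ∀ i j k x, |pd i (a j k) x| ≤ ε * pw 1 (-(1 + σ) / 2) x
  half_le_density : ∀ x, 1 / 2 ≤ s x
  density_le : ∀ x, s x ≤ 2
  abs_pd_density_le : ∀ i x, |pd i s x| ≤ ε * pw 1 (-(1 + σ) / 2) x
  abs_curv_le : ∀ x, ‖x‖ * |R x| ≤ ε * pw 1 (-(1 + σ) / 2) x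

section Geometry

theorem abs_entry_le_opNorm {n : ℕ} (A : Matrix (Fin n) (Fin n) ℝ) (i j : Fin n) :
    |A i j| ≤ opNorm A := by
  have h1 := (LinearMap.toContinuousLinearMap (Matrix.toEuclideanLin A)).le_opNorm
    (EuclideanSpace.single j (1 : ℝ))
  have h2 := Eu.abs_apply_le (LinearMap.toContinuousLinearMap (Matrix.toEuclideanLin A)
    (EuclideanSpace.single j (1 : ℝ))) i
  have h3 : (LinearMap.toContinuousLinearMap (Matrix.toEuclideanLin A)
    (EuclideanSpace.single j (1 : ℝ))) i = A i j := by
    simp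
  rw [h3] at h2
  simpa [opNorm] using h2.trans h1

theorem opNorm_nonneg {n : ℕ} (A : Matrix (Fin n) (Fin n) ℝ) : 0 ≤ opNorm A := norm_nonneg _

theorem jap_rpow (c : ℝ) (x : Eu 3) : jap x ^ (-c) = pw 1 (-c / 2) x := by
  rw [jap, pw, Real.sqrt_eq_rpow, ← Real.rpow_mul (by positivity), one_pow]
  ring_nf

variable {h : Eu 3 → Matrix (Fin 3) (Fin 3) ℝ}

theorem contDiff_det (hs : ∀ j k : Fin 3, ContDiff ℝ ∞ fun x => h x j k) :
    ContDiff ℝ ∞ fun x => (h x).det := by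
  simp only [Matrix.det_fin_three]
  fun_prop

theorem contDiff_inv_entry (hs : ∀ j k : Fin 3, ContDiff ℝ ∞ fun x => h x j k)
    (hp : ∀ x, (h x).PosDef) (j k : Fin 3) : ContDiff ℝ ∞ fun x => (h x)⁻¹ j k := by
  have h1 : ∀ x, (h x)⁻¹ j k = ((h x).det)⁻¹ * (h x).adjugate j k := fun x => by
    simp [Matrix.inv_def]
  simp only [h1]
  refine ((contDiff_det hs).inv fun x => (hp x).det_pos.ne').mul ?_
  fin_cases j <;> fin_cases k <;> simp [Matrix.adjugate_fin_three] <;> fun_prop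

theorem contDiff_sdet (hs : ∀ j k : Fin 3, ContDiff ℝ ∞ fun x => h x j k)
    (hp : ∀ x, (h x).PosDef) : ContDiff ℝ ∞ (sdet h) :=
  (contDiff_det hs).sqrt fun x => (hp x).det_pos.ne'

theorem sum_abs_le_of_inverse {H A : Matrix (Fin 3) (Fin 3) ℝ} (hHA : H * A = 1) {ε : ℝ}
    (hε : ε ≤ 1 / 100) (hA : ∀ i j, |A i j - if i = j then 1 else 0| ≤ ε) (i j : Fin 3) :
    |H i j| ≤ 2 := by
  have hε0 : 0 ≤ ε := (abs_nonneg _).trans (hA 0 0)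
  have h1 : ∀ j, |H i j| ≤ (if i = j then 1 else 0) + ε * ∑ k, |H i k| := by
    intro j
    have e : H i j = (if i = j then 1 else 0) - ∑ k, H i k * (A k j - if k = j then 1 else 0) := by
      have := congrFun (congrFun hHA i) j
      rw [Matrix.mul_apply, Matrix.one_apply] at this
      rw [← this]
      simp [mul_sub]
    rw [e]
    refine (abs_sub _ _).trans (add_le_add ?_ ?_)
    · split_ifs <;> simp
    · refine (Finset.abs_sum_le_sum_abs _ _).trans ?_
      rw [Finset.mul_sum]
      refine Finset.sum_le_sum fun k _ => ?_
      rw [abs_mul, mul_comm]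
      exact mul_le_mul_of_nonneg_right (hA k j) (abs_nonneg _)
  have h2 : ∑ j, |H i j| ≤ 1 + 3 * (ε * ∑ k, |H i k|) := by
    refine (Finset.sum_le_sum fun j _ => h1 j).trans ?_
    rw [Finset.sum_add_distrib]
    simp
  have h3 : |H i j| ≤ ∑ j, |H i j| :=
    Finset.single_le_sum (f := fun j => |H i j|) (fun _ _ => abs_nonneg _) (Finset.mem_univ j)
  have h4 : 0 ≤ ∑ j, |H i j| := (abs_nonneg _).trans h3
  nlinarith

theorem abs_mul_mul_le {a b c A B C : ℝ} (ha : |a| ≤ A) (hb : |b| ≤ B) (hc : |c| ≤ C) :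
    |a * b * c| ≤ A * B * C := by
  have hA := (abs_nonneg a).trans ha
  have hB := (abs_nonneg b).trans hb
  rw [abs_mul, abs_mul]
  exact mul_le_mul (mul_le_mul ha hb (abs_nonneg _) hA) hc (abs_nonneg _) (mul_nonneg hA hB)

theorem abs_sum_fin3_le {f : Fin 3 → ℝ} {C : ℝ} (hf : ∀ i, |f i| ≤ C) : |∑ i, f i| ≤ 3 * C := by
  refine (Finset.abs_sum_le_sum_abs _ _).trans ?_
  refine (Finset.sum_le_sum fun i _ => hf i).trans ?_
  simp

theorem mul_inv_metric (hp : ∀ x, (h x).PosDef) (x : Eu 3) : h x * (h x)⁻¹ = 1 :=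
  Matrix.mul_nonsing_inv _ (hp x).det_pos.ne'.isUnit

theorem inv_mul_metric (hp : ∀ x, (h x).PosDef) (x : Eu 3) : (h x)⁻¹ * h x = 1 :=
  Matrix.nonsing_inv_mul _ (hp x).det_pos.ne'.isUnit

variable (hs : ∀ j k : Fin 3, ContDiff ℝ ∞ fun x => h x j k) (hp : ∀ x, (h x).PosDef)
include hs hp

theorem pd_metric (p i j : Fin 3) :
    pd p (fun y => h y i j)
      = fun x => -∑ k, ∑ l, h x i k * pd p (fun y => (h y)⁻¹ k l) x * h x l j := by
  funext x
  have ha := contDiff_inv_entry hs hp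
  have e : ∀ l, ∑ k, (pd p (fun y => h y i k) x * (h x)⁻¹ k l
      + h x i k * pd p (fun y => (h y)⁻¹ k l) x) = 0 := by
    intro l
    have h1 : (fun y => ∑ k, h y i k * (h y)⁻¹ k l) = fun _ => (1 : Matrix (Fin 3) (Fin 3) ℝ) i l := by
      funext y
      rw [← mul_inv_metric hp y, Matrix.mul_apply]
    have h2 := congrArg (fun f => pd p f x) h1
    simp only [pd_const] at h2
    rw [pd_sum fun k _ => ((hs i k).mul (ha k l)).diffAt x] at h2
    rw [← h2]
    exact Finset.sum_congr rfl fun k _ => (pd_mul ((hs i k).diffAt x) ((ha k l).diffAt x) p).symm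
  have h3 : pd p (fun y => h y i j) x
      = ∑ l, (∑ k, pd p (fun y => h y i k) x * (h x)⁻¹ k l) * h x l j := by
    have : ∀ k, ∑ l, (h x)⁻¹ k l * h x l j = if k = j then 1 else 0 := fun k => by
      rw [← Matrix.mul_apply, inv_mul_metric hp, Matrix.one_apply]
    simp only [Finset.sum_mul]
    rw [Finset.sum_comm]
    simp only [mul_assoc, ← Finset.mul_sum, this]
    simp
  rw [h3, Finset.sum_comm (f := fun k l => h x i k * pd p (fun y => (h y)⁻¹ k l) x * h x l j),
    ← Finset.sum_neg_distrib]
  refine Finset.sum_congr rfl fun l _ => ?_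
  rw [← Finset.sum_mul, ← neg_mul]
  congr 1
  have := e l
  rw [Finset.sum_add_distrib] at this
  linarith

theorem contDiff_Chr (i j k : Fin 3) : ContDiff ℝ ∞ (Chr h i j k) := by
  have ha := contDiff_inv_entry hs hp
  have hd : ∀ p i j, ContDiff ℝ ∞ (pd p fun y => h y i j) := fun p i j => (hs i j).pd p
  unfold Chr
  exact contDiff_const.mul (ContDiff.sum fun l _ =>
    (ha i l).mul (((hd j l k).add (hd k j l)).sub (hd l j k)))

theorem continuous_Rscal : Continuous (Rscal h) := by
  have ha := fun j k => (contDiff_inv_entry hs hp j k).continuous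
  have hC := fun i j k => (contDiff_Chr hs hp i j k).continuous
  have hdC : ∀ p i j k, Continuous (pd p (Chr h i j k)) := fun p i j k =>
    ((contDiff_Chr hs hp i j k).pd p).continuous
  unfold Rscal
  refine continuous_finsetSum _ fun j _ => continuous_finsetSum _ fun k _ => (ha j k).mul ?_
  refine Continuous.sub (Continuous.add (Continuous.sub ?_ ?_) ?_) ?_
  · exact continuous_finsetSum _ fun i _ => hdC i i j k
  · exact continuous_finsetSum _ fun i _ => hdC k i j i
  · exact continuous_finsetSum _ fun i _ => continuous_finsetSum _ fun l _ =>
      (hC l j k).mul (hC i i l)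
  · exact continuous_finsetSum _ fun i _ => continuous_finsetSum _ fun l _ =>
      (hC l j i).mul (hC i k l)

end Geometry

/-- Pointwise bounds for the entries of the inverse metric and their derivatives. -/
structure InvBounds (σ ε : ℝ) (h : Eu 3 → Matrix (Fin 3) (Fin 3) ℝ) : Prop where
  smooth : ∀ j k : Fin 3, ContDiff ℝ ∞ fun x => h x j k
  symm : ∀ x, (h x).IsSymm
  posDef : ∀ x, (h x).PosDef
  pos : 0 < σ
  sub_le : ∀ j k x, |(h x)⁻¹ j k - if j = k then 1 else 0| ≤ ε * pw 1 (-σ / 2) x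
  pd_le : ∀ p j k x, |pd p (fun y => (h y)⁻¹ j k) x| ≤ ε * pw 1 (-(1 + σ) / 2) x
  pd_pd_le : ∀ q p j k x, ‖x‖ * |pd q (pd p fun y => (h y)⁻¹ j k) x| ≤ ε * pw 1 (-(1 + σ) / 2) x

section Bounds

theorem AFlat.invBounds {h : Eu 3 → Matrix (Fin 3) (Fin 3) ℝ} {σ CI Ch ε : ℝ} (hσ : σ ∈ Ioo (0 : ℝ) 1)
    (hs : ∀ j k : Fin 3, ContDiff ℝ ∞ fun x => h x j k) (hsymm : ∀ x, (h x).IsSymm)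
    (hp : ∀ x, (h x).PosDef) (hCI : CI ≤ ε) (hCh : Ch ≤ ε)
    (hh : AFlat h σ CI Ch) : InvBounds σ ε h := by
  obtain ⟨h0, h1⟩ := hh
  have hm : ∀ (x : Eu 3) (f : Fin 3 → ℝ), (∀ j, 0 ≤ f j) → ∀ j, f j ≤ ∑ j, f j := fun x f hf j =>
    Finset.single_le_sum (fun i _ => hf i) (Finset.mem_univ j)
  have hn : ∀ x, Ch * jap x ^ (-(1 + σ)) ≤ ε * pw 1 (-(1 + σ) / 2) x := fun x => by
    rw [jap_rpow]
    exact mul_le_mul_of_nonneg_right hCh (pw_pos one_pos _ x).le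
  have n1 : ∀ x, 0 ≤ ∑ j, opNorm (pdM j (fun y => (h y)⁻¹) x) := fun x =>
    Finset.sum_nonneg fun _ _ => opNorm_nonneg _
  have n2 : ∀ x : Eu 3, 0 ≤ ‖x‖ * (∑ j, ∑ k, opNorm (pdM j (pdM k (fun y => (h y)⁻¹)) x)) := fun x =>
    mul_nonneg (norm_nonneg _) (Finset.sum_nonneg fun _ _ => Finset.sum_nonneg fun _ _ =>
      opNorm_nonneg _)
  have n3 : ∀ x : Eu 3, 0 ≤ ‖x‖ ^ 2 *
      (∑ j, ∑ k, ∑ l, opNorm (pdM j (pdM k (pdM l (fun y => (h y)⁻¹))) x)) := fun x =>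
    mul_nonneg (sq_nonneg _) (Finset.sum_nonneg fun _ _ => Finset.sum_nonneg fun _ _ =>
      Finset.sum_nonneg fun _ _ => opNorm_nonneg _)
  refine ⟨hs, hsymm, hp, hσ.1, fun j k x => ?_, fun p j k x => ?_, fun q p j k x => ?_⟩
  · have e := abs_entry_le_opNorm ((h x)⁻¹ - 1) j k
    rw [Matrix.sub_apply, Matrix.one_apply] at e
    refine e.trans ((h0 x).trans ?_)
    rw [jap_rpow]
    exact mul_le_mul_of_nonneg_right hCI (pw_pos one_pos _ x).le
  · have e := abs_entry_le_opNorm (pdM p (fun y => (h y)⁻¹) x) j k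
    have e2 := hm x (fun p => opNorm (pdM p (fun y => (h y)⁻¹) x)) (fun _ => opNorm_nonneg _) p
    refine e.trans (e2.trans ?_)
    linarith [h1 x, hn x, n2 x, n3 x]
  · have e := abs_entry_le_opNorm (pdM q (pdM p (fun y => (h y)⁻¹)) x) j k
    have e2 := hm x (fun p => opNorm (pdM q (pdM p (fun y => (h y)⁻¹)) x))
      (fun _ => opNorm_nonneg _) p
    have e3 := hm x (fun q => ∑ p, opNorm (pdM q (pdM p (fun y => (h y)⁻¹)) x))
      (fun _ => Finset.sum_nonneg fun _ _ => opNorm_nonneg _) q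
    refine (mul_le_mul_of_nonneg_left (e.trans (e2.trans e3)) (norm_nonneg x)).trans ?_
    linarith [h1 x, hn x, n1 x, n3 x]

variable {h : Eu 3 → Matrix (Fin 3) (Fin 3) ℝ} {σ ε : ℝ}

namespace InvBounds

theorem nonneg (H : InvBounds σ ε h) : 0 ≤ ε :=
  nonneg_of_mul_nonneg_left ((abs_nonneg _).trans (H.sub_le 0 0 0)) (pw_pos one_pos _ 0)

theorem sub_le_const (H : InvBounds σ ε h) (j k : Fin 3) (x : Eu 3) :
    |(h x)⁻¹ j k - if j = k then 1 else 0| ≤ ε := by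
  refine (H.sub_le j k x).trans (mul_le_of_le_one_right H.nonneg ?_)
  exact (pw_mono le_rfl (by linarith [H.pos]) x).trans (pw_zero x).le

theorem inv_le (H : InvBounds σ ε h) (hε : ε ≤ 1 / 100) (j k : Fin 3) (x : Eu 3) :
    |(h x)⁻¹ j k| ≤ 101 / 100 := by
  have h1 := abs_le.1 ((H.sub_le_const j k x).trans hε)
  rw [abs_le]
  split_ifs at h1 <;> constructor <;> linarith [h1.1, h1.2]

theorem metric_le (H : InvBounds σ ε h) (hε : ε ≤ 1 / 100) (i j : Fin 3) (x : Eu 3) :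
    |h x i j| ≤ 2 :=
  sum_abs_le_of_inverse (mul_inv_metric H.posDef x) hε (fun i j => H.sub_le_const i j x) i j

theorem norm_mul_weight_le (hσ : 0 < σ) (x : Eu 3) : ‖x‖ * pw 1 (-(1 + σ) / 2) x ≤ 1 :=
  (norm_mul_pw_le one_pos _ x).trans
    ((pw_mono le_rfl (show -(1 + σ) / 2 + 1 / 2 ≤ 0 by linarith) x).trans (pw_zero x).le)

theorem pd_metric_le (H : InvBounds σ ε h) (hε : ε ≤ 1 / 100) (p i j : Fin 3) (x : Eu 3) :
    |pd p (fun y => h y i j) x| ≤ 36 * (ε * pw 1 (-(1 + σ) / 2) x) := by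
  rw [pd_metric H.smooth H.posDef, abs_neg]
  have := abs_sum_fin3_le fun k => abs_sum_fin3_le fun l =>
    abs_mul_mul_le (H.metric_le hε i k x) (H.pd_le p k l x) (H.metric_le hε l j x)
  exact this.trans (by linarith)

theorem pd_pd_metric_le (H : InvBounds σ ε h) (hσ : 0 < σ) (hε : ε ≤ 1 / 100) (q p i j : Fin 3)
    (x : Eu 3) :
    ‖x‖ * |pd q (pd p fun y => h y i j) x| ≤ 60 * (ε * pw 1 (-(1 + σ) / 2) x) := by
  have ha := contDiff_inv_entry H.smooth H.posDef
  have d1 := fun k => (H.smooth i k).diffAt x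
  have d2 := fun k l => ((ha k l).pd p).diffAt x
  have d3 := fun l => (H.smooth l j).diffAt x
  have e : pd q (pd p fun y => h y i j) x = -∑ k, ∑ l,
      ((pd q (fun y => h y i k) x * pd p (fun y => (h y)⁻¹ k l) x * h x l j
        + h x i k * pd q (pd p fun y => (h y)⁻¹ k l) x * h x l j)
        + h x i k * pd p (fun y => (h y)⁻¹ k l) x * pd q (fun y => h y l j) x) := by
    have e1 : ∀ k l, pd q (fun y => h y i k * pd p (fun y => (h y)⁻¹ k l) y * h y l j) x
        = (pd q (fun y => h y i k) x * pd p (fun y => (h y)⁻¹ k l) x * h x l j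
        + h x i k * pd q (pd p fun y => (h y)⁻¹ k l) x * h x l j)
        + h x i k * pd p (fun y => (h y)⁻¹ k l) x * pd q (fun y => h y l j) x := fun k l => by
      rw [pd_mul ((d1 k).fun_mul (d2 k l)) (d3 l), pd_mul (d1 k) (d2 k l)]
      ring
    rw [pd_metric H.smooth H.posDef]
    simp only [← neg_one_mul (∑ k, _ : ℝ)]
    rw [pd_const_mul (DifferentiableAt.fun_sum fun k _ => DifferentiableAt.fun_sum fun l _ =>
        ((d1 k).fun_mul (d2 k l)).fun_mul (d3 l)),
      pd_sum fun k _ => DifferentiableAt.fun_sum fun l _ => ((d1 k).fun_mul (d2 k l)).fun_mul (d3 l)]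
    congr 1
    refine Finset.sum_congr rfl fun k _ => ?_
    rw [pd_sum fun l _ => ((d1 k).fun_mul (d2 k l)).fun_mul (d3 l)]
    exact Finset.sum_congr rfl fun l _ => e1 k l
  set W := ε * pw 1 (-(1 + σ) / 2) x with hW
  have hε0 := H.nonneg
  have hw0 := pw_pos one_pos (-(1 + σ) / 2) x
  have hW0 : 0 ≤ W := mul_nonneg hε0 hw0.le
  have hxW : ‖x‖ * W ≤ 1 / 100 := by
    have := norm_mul_weight_le hσ x
    calc ‖x‖ * W = ε * (‖x‖ * pw 1 (-(1 + σ) / 2) x) := by rw [hW]; ring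
      _ ≤ ε * 1 := by gcongr
      _ ≤ _ := by linarith
  rw [e, abs_neg, ← abs_of_nonneg (norm_nonneg x), ← abs_mul, Finset.mul_sum]
  simp only [Finset.mul_sum]
  have key : ∀ k l, |‖x‖ * ((pd q (fun y => h y i k) x * pd p (fun y => (h y)⁻¹ k l) x * h x l j
        + h x i k * pd q (pd p fun y => (h y)⁻¹ k l) x * h x l j)
        + h x i k * pd p (fun y => (h y)⁻¹ k l) x * pd q (fun y => h y l j) x)| ≤ 6 * W := by
    intro k l
    have t1 := abs_mul_mul_le (H.pd_metric_le hε q i k x) (H.pd_le p k l x) (H.metric_le hε l j x)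
    have t2 := abs_mul_mul_le (H.metric_le hε i k x)
      (le_refl |pd q (pd p fun y => (h y)⁻¹ k l) x|) (H.metric_le hε l j x)
    have t3 := abs_mul_mul_le (H.metric_le hε i k x) (H.pd_le p k l x) (H.pd_metric_le hε q l j x)
    rw [← hW] at t1 t3
    rw [abs_mul, abs_of_nonneg (norm_nonneg x)]
    refine (mul_le_mul_of_nonneg_left ((abs_add_le _ _).trans (add_le_add ((abs_add_le _ _).trans
      (add_le_add t1 t2)) t3)) (norm_nonneg x)).trans ?_
    have t4 := H.pd_pd_le q p k l x
    rw [← hW] at t4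
    nlinarith
  have := abs_sum_fin3_le fun k => abs_sum_fin3_le fun l => key k l
  exact this.trans (by linarith)

theorem Chr_le (H : InvBounds σ ε h) (hε : ε ≤ 1 / 100) (i j k : Fin 3) (x : Eu 3) :
    |Chr h i j k x| ≤ 200 * (ε * pw 1 (-(1 + σ) / 2) x) := by
  set W := ε * pw 1 (-(1 + σ) / 2) x with hW
  have key : ∀ l, |(h x)⁻¹ i l * (pd j (fun y => h y l k) x + pd k (fun y => h y j l) x
      - pd l (fun y => h y j k) x)| ≤ 101 / 100 * (108 * W) := by
    intro l
    rw [abs_mul]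
    refine mul_le_mul (H.inv_le hε i l x) ?_ (abs_nonneg _) (by norm_num)
    have e1 := abs_le.1 (H.pd_metric_le hε j l k x)
    have e2 := abs_le.1 (H.pd_metric_le hε k j l x)
    have e3 := abs_le.1 (H.pd_metric_le hε l j k x)
    rw [abs_le]
    constructor <;> linarith [e1.1, e1.2, e2.1, e2.2, e3.1, e3.2]
  have hW0 : 0 ≤ W := mul_nonneg H.nonneg (pw_pos one_pos _ x).le
  rw [Chr, abs_mul, abs_of_pos (by norm_num : (0 : ℝ) < 1 / 2)]
  have := abs_sum_fin3_le key
  linarith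

theorem pd_Chr_le (H : InvBounds σ ε h) (hσ : 0 < σ) (hε : ε ≤ 1 / 100) (p i j k : Fin 3)
    (x : Eu 3) : ‖x‖ * |pd p (Chr h i j k) x| ≤ 300 * (ε * pw 1 (-(1 + σ) / 2) x) := by
  have ha := contDiff_inv_entry H.smooth H.posDef
  have d0 := fun l => (ha i l).diffAt x
  have dh := fun a b c => ((H.smooth b c).pd a).diffAt x
  have ds := fun l => ((dh j l k).fun_add (dh k j l)).fun_sub (dh l j k)
  have e : pd p (Chr h i j k) x = 1 / 2 * ∑ l,
      (pd p (fun y => (h y)⁻¹ i l) x * (pd j (fun y => h y l k) x + pd k (fun y => h y j l) x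
        - pd l (fun y => h y j k) x)
      + (h x)⁻¹ i l * (pd p (pd j fun y => h y l k) x + pd p (pd k fun y => h y j l) x
        - pd p (pd l fun y => h y j k) x)) := by
    have e0 : Chr h i j k = fun x => (1 / 2) * ∑ l, (h x)⁻¹ i l *
      (pd j (fun y => h y l k) x + pd k (fun y => h y j l) x - pd l (fun y => h y j k) x) := rfl
    rw [e0, pd_const_mul (DifferentiableAt.fun_sum fun l _ => (d0 l).fun_mul (ds l)),
      pd_sum fun l _ => (d0 l).fun_mul (ds l)]
    congr 1
    refine Finset.sum_congr rfl fun l _ => ?_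
    rw [pd_mul (d0 l) (ds l), pd_sub ((dh j l k).fun_add (dh k j l)) (dh l j k),
      pd_add (dh j l k) (dh k j l)]
  set W := ε * pw 1 (-(1 + σ) / 2) x with hW
  have hε0 := H.nonneg
  have hw0 := pw_pos one_pos (-(1 + σ) / 2) x
  have hW0 : 0 ≤ W := mul_nonneg hε0 hw0.le
  have hxW : ‖x‖ * W ≤ 1 / 100 := by
    have := norm_mul_weight_le hσ x
    calc ‖x‖ * W = ε * (‖x‖ * pw 1 (-(1 + σ) / 2) x) := by rw [hW]; ring
      _ ≤ ε * 1 := by gcongr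
      _ ≤ _ := by linarith
  have key : ∀ l, |‖x‖ * (pd p (fun y => (h y)⁻¹ i l) x * (pd j (fun y => h y l k) x
        + pd k (fun y => h y j l) x - pd l (fun y => h y j k) x)
      + (h x)⁻¹ i l * (pd p (pd j fun y => h y l k) x + pd p (pd k fun y => h y j l) x
        - pd p (pd l fun y => h y j k) x))| ≤ 200 * W := by
    intro l
    have e1 := abs_le.1 (H.pd_metric_le hε j l k x)
    have e2 := abs_le.1 (H.pd_metric_le hε k j l x)
    have e3 := abs_le.1 (H.pd_metric_le hε l j k x)
    have f1 := H.pd_pd_metric_le hσ hε p j l k x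
    have f2 := H.pd_pd_metric_le hσ hε p k j l x
    have f3 := H.pd_pd_metric_le hσ hε p l j k x
    rw [← hW] at e1 e2 e3 f1 f2 f3
    have g1 : |pd j (fun y => h y l k) x + pd k (fun y => h y j l) x
        - pd l (fun y => h y j k) x| ≤ 108 * W := by
      rw [abs_le]
      constructor <;> linarith [e1.1, e1.2, e2.1, e2.2, e3.1, e3.2]
    have g2 : |pd p (pd j fun y => h y l k) x + pd p (pd k fun y => h y j l) x
        - pd p (pd l fun y => h y j k) x| ≤ |pd p (pd j fun y => h y l k) x|
          + |pd p (pd k fun y => h y j l) x| + |pd p (pd l fun y => h y j k) x| :=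
      (abs_sub _ _).trans (by gcongr; exact abs_add_le _ _)
    have h1 := H.pd_le p i l x
    have h2 := H.inv_le hε i l x
    rw [← hW] at h1
    rw [abs_mul, abs_of_nonneg (norm_nonneg x)]
    calc _ ≤ ‖x‖ * (W * (108 * W) + 101 / 100 * (|pd p (pd j fun y => h y l k) x|
          + |pd p (pd k fun y => h y j l) x| + |pd p (pd l fun y => h y j k) x|)) := by
          gcongr
          refine (abs_add_le _ _).trans ?_
          rw [abs_mul, abs_mul]
          exact add_le_add (mul_le_mul h1 g1 (abs_nonneg _) hW0)
            (mul_le_mul h2 g2 (abs_nonneg _) (by norm_num))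
      _ ≤ 200 * W := by nlinarith
  rw [e, abs_mul, abs_of_pos (by norm_num : (0 : ℝ) < 1 / 2), mul_left_comm,
    ← abs_of_nonneg (norm_nonneg x), ← abs_mul, Finset.mul_sum]
  have := abs_sum_fin3_le key
  linarith

theorem Rscal_le (H : InvBounds σ ε h) (hσ : 0 < σ) (hε : ε ≤ 1 / 100) (x : Eu 3) :
    ‖x‖ * |Rscal h x| ≤ 100000 * (ε * pw 1 (-(1 + σ) / 2) x) := by
  set W := ε * pw 1 (-(1 + σ) / 2) x with hW
  have hε0 := H.nonneg
  have hw0 := pw_pos one_pos (-(1 + σ) / 2) x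
  have hW0 : 0 ≤ W := mul_nonneg hε0 hw0.le
  have hxW : ‖x‖ * W ≤ 1 / 100 := by
    have := norm_mul_weight_le hσ x
    calc ‖x‖ * W = ε * (‖x‖ * pw 1 (-(1 + σ) / 2) x) := by rw [hW]; ring
      _ ≤ ε * 1 := by gcongr
      _ ≤ _ := by linarith
  have hx0 := norm_nonneg x
  have nm : ∀ y : ℝ, ‖x‖ * |y| = |‖x‖ * y| := fun y => by rw [abs_mul, abs_of_nonneg hx0]
  have q : ∀ a b c d e f : Fin 3, |‖x‖ * (Chr h a b c x * Chr h d e f x)| ≤ 400 * W := by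
    intro a b c d e f
    have e1 := H.Chr_le hε a b c x
    have e2 := H.Chr_le hε d e f x
    rw [← hW] at e1 e2
    rw [← nm, abs_mul]
    have := mul_le_mul e1 e2 (abs_nonneg _) (by positivity)
    calc _ ≤ ‖x‖ * (200 * W * (200 * W)) := by gcongr
      _ = 40000 * (‖x‖ * W) * W := by ring
      _ ≤ _ := by nlinarith
  have l : ∀ a b c d : Fin 3, |‖x‖ * pd a (Chr h b c d) x| ≤ 300 * W := fun a b c d => by
    rw [← nm]; exact H.pd_Chr_le hσ hε a b c d x
  rw [nm, Rscal, Finset.mul_sum]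
  simp only [Finset.mul_sum (a := ‖x‖)]
  have key : ∀ j k, |‖x‖ * ((h x)⁻¹ j k *
    ((∑ i, pd i (fun y => Chr h i j k y) x) - (∑ i, pd k (fun y => Chr h i j i y) x)
      + (∑ i, ∑ l, Chr h l j k x * Chr h i i l x) - (∑ i, ∑ l, Chr h l j i x * Chr h i k l x)))|
      ≤ 101 / 100 * (10000 * W) := by
    intro j k
    rw [mul_left_comm, abs_mul]
    refine mul_le_mul (H.inv_le hε j k x) ?_ (abs_nonneg _) (by norm_num)
    rw [mul_sub, mul_add, mul_sub]
    simp only [Finset.mul_sum]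
    have t1 := abs_le.1 (abs_sum_fin3_le fun i => l i i j k)
    have t2 := abs_le.1 (abs_sum_fin3_le fun i => l k i j i)
    have t3 := abs_le.1 (abs_sum_fin3_le fun i => abs_sum_fin3_le fun l => q l j k i i l)
    have t4 := abs_le.1 (abs_sum_fin3_le fun i => abs_sum_fin3_le fun l => q l j i i k l)
    rw [abs_le]
    constructor <;> linarith [t1.1, t1.2, t2.1, t2.2, t3.1, t3.2, t4.1, t4.2]
  have := abs_sum_fin3_le fun j => abs_sum_fin3_le fun k => key j k
  linarith

end InvBounds
end Bounds

theorem pd_alternating_sum {a b c d e f : Eu 3 → ℝ} {x : Eu 3} (ha : DifferentiableAt ℝ a x)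
    (hb : DifferentiableAt ℝ b x) (hc : DifferentiableAt ℝ c x) (hd : DifferentiableAt ℝ d x)
    (he : DifferentiableAt ℝ e x) (hf : DifferentiableAt ℝ f x) (i : Fin 3) :
    pd i (fun y => a y - b y - c y + d y + e y - f y) x
      = pd i a x - pd i b x - pd i c x + pd i d x + pd i e x - pd i f x := by
  rw [pd_sub (by fun_prop) hf, pd_add (by fun_prop) he, pd_add (by fun_prop) hd,
    pd_sub (by fun_prop) hc, pd_sub ha hb]

namespace InvBounds
variable {h : Eu 3 → Matrix (Fin 3) (Fin 3) ℝ} {σ ε : ℝ}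

theorem det_inv_mem (H : InvBounds σ ε h) (hε : ε ≤ 1 / 100) (x : Eu 3) :
    ((h x)⁻¹).det ∈ Icc (1 / 2 : ℝ) 2 := by
  have hd : ∀ i, (h x)⁻¹ i i ∈ Icc (99 / 100 : ℝ) (101 / 100) := fun i => by
    have := abs_le.1 ((H.sub_le_const i i x).trans hε)
    rw [if_pos rfl] at this
    constructor <;> linarith [this.1, this.2]
  have ho : ∀ i j, i ≠ j → |(h x)⁻¹ i j| ≤ 1 / 100 := fun i j hij => by
    have := (H.sub_le_const i j x).trans hε
    rwa [if_neg hij, sub_zero] at this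
  have hl := fun i j => H.inv_le hε i j x
  have m1 : (99 / 100 : ℝ) * (99 / 100) ≤ (h x)⁻¹ 0 0 * (h x)⁻¹ 1 1 :=
    mul_le_mul (hd 0).1 (hd 1).1 (by norm_num) (by linarith [(hd 0).1])
  have m2 : (h x)⁻¹ 0 0 * (h x)⁻¹ 1 1 ≤ (101 / 100 : ℝ) * (101 / 100) :=
    mul_le_mul (hd 0).2 (hd 1).2 (by linarith [(hd 1).1]) (by norm_num)
  have m3 : (99 / 100 : ℝ) * (99 / 100) * (99 / 100) ≤ (h x)⁻¹ 0 0 * (h x)⁻¹ 1 1 * (h x)⁻¹ 2 2 :=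
    mul_le_mul m1 (hd 2).1 (by norm_num) (by linarith)
  have m4 : (h x)⁻¹ 0 0 * (h x)⁻¹ 1 1 * (h x)⁻¹ 2 2 ≤ (101 / 100 : ℝ) * (101 / 100) * (101 / 100) :=
    mul_le_mul m2 (hd 2).2 (by linarith [(hd 2).1]) (by norm_num)
  have t1 := abs_le.1 (abs_mul_mul_le (hl 0 0) (ho 1 2 (by decide)) (ho 2 1 (by decide)))
  have t2 := abs_le.1 (abs_mul_mul_le (ho 0 1 (by decide)) (ho 1 0 (by decide)) (hl 2 2))
  have t3 := abs_le.1 (abs_mul_mul_le (ho 0 1 (by decide)) (ho 1 2 (by decide)) (hl 2 0))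
  have t4 := abs_le.1 (abs_mul_mul_le (ho 0 2 (by decide)) (ho 1 0 (by decide)) (hl 2 1))
  have t5 := abs_le.1 (abs_mul_mul_le (ho 0 2 (by decide)) (hl 1 1) (ho 2 0 (by decide)))
  rw [Matrix.det_fin_three]
  norm_num at t1 t2 t3 t4 t5 m3 m4
  constructor <;> linarith [t1.1, t1.2, t2.1, t2.2, t3.1, t3.2, t4.1, t4.2, t5.1, t5.2]

theorem sdet_sq_mul_det_inv (H : InvBounds σ ε h) (x : Eu 3) :
    sdet h x ^ 2 * ((h x)⁻¹).det = 1 := by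
  rw [sdet, Real.sq_sqrt (H.posDef x).det_pos.le, ← Matrix.det_mul, mul_inv_metric H.posDef,
    Matrix.det_one]

theorem sdet_mem (H : InvBounds σ ε h) (hε : ε ≤ 1 / 100) (x : Eu 3) :
    sdet h x ∈ Icc (1 / 2 : ℝ) 2 := by
  have h1 := H.sdet_sq_mul_det_inv x
  have h2 := H.det_inv_mem hε x
  have h0 : 0 ≤ sdet h x := Real.sqrt_nonneg _
  constructor
  · by_contra hc
    rw [not_le] at hc
    nlinarith [h2.1, h2.2, sq_nonneg (sdet h x)]
  · by_contra hc
    rw [not_le] at hc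
    nlinarith [h2.1, h2.2, sq_nonneg (sdet h x)]

theorem pd_det_inv_le (H : InvBounds σ ε h) (hε : ε ≤ 1 / 100) (i : Fin 3) (x : Eu 3) :
    |pd i (fun y => ((h y)⁻¹).det) x| ≤ 20 * (ε * pw 1 (-(1 + σ) / 2) x) := by
  have da := fun j k => (contDiff_inv_entry H.smooth H.posDef j k).diffAt x
  set W := ε * pw 1 (-(1 + σ) / 2) x with hW
  have hW0 : 0 ≤ W := mul_nonneg H.nonneg (pw_pos one_pos _ x).le
  have key : ∀ a b c d e f : Fin 3,
      |pd i (fun y => (h y)⁻¹ a b * (h y)⁻¹ c d * (h y)⁻¹ e f) x| ≤ 10 / 3 * W := by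
    intro a b c d e f
    rw [pd_mul ((da a b).fun_mul (da c d)) (da e f), pd_mul (da a b) (da c d), add_mul]
    have t1 := abs_mul_mul_le (H.pd_le i a b x) (H.inv_le hε c d x) (H.inv_le hε e f x)
    have t2 := abs_mul_mul_le (H.inv_le hε a b x) (H.pd_le i c d x) (H.inv_le hε e f x)
    have t3 := abs_mul_mul_le (H.inv_le hε a b x) (H.inv_le hε c d x) (H.pd_le i e f x)
    rw [← hW] at t1 t2 t3
    refine (abs_add_le _ _).trans ((add_le_add ((abs_add_le _ _).trans (add_le_add t1 t2)) t3).trans ?_)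
    linarith
  have dd := fun a b c d e f => ((da a b).fun_mul (da c d)).fun_mul (da e f)
  simp only [Matrix.det_fin_three]
  rw [pd_alternating_sum (dd 0 0 1 1 2 2) (dd 0 0 1 2 2 1) (dd 0 1 1 0 2 2) (dd 0 1 1 2 2 0)
    (dd 0 2 1 0 2 1) (dd 0 2 1 1 2 0)]
  have k1 := abs_le.1 (key 0 0 1 1 2 2)
  have k2 := abs_le.1 (key 0 0 1 2 2 1)
  have k3 := abs_le.1 (key 0 1 1 0 2 2)
  have k4 := abs_le.1 (key 0 1 1 2 2 0)
  have k5 := abs_le.1 (key 0 2 1 0 2 1)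
  have k6 := abs_le.1 (key 0 2 1 1 2 0)
  rw [abs_le]
  constructor <;>
    linarith [k1.1, k1.2, k2.1, k2.2, k3.1, k3.2, k4.1, k4.2, k5.1, k5.2, k6.1, k6.2]

theorem pd_sdet_le (H : InvBounds σ ε h) (hε : ε ≤ 1 / 100) (i : Fin 3) (x : Eu 3) :
    |pd i (sdet h) x| ≤ 40 * (ε * pw 1 (-(1 + σ) / 2) x) := by
  have ds := (contDiff_sdet H.smooth H.posDef).diffAt x
  have dd : DifferentiableAt ℝ (fun y => ((h y)⁻¹).det) x :=
    (contDiff_det (h := fun y => (h y)⁻¹) (contDiff_inv_entry H.smooth H.posDef)).diffAt x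
  have h1 : (fun y => sdet h y ^ 2 * ((h y)⁻¹).det) = fun _ => 1 := funext H.sdet_sq_mul_det_inv
  have h2 := congrArg (fun f => pd i f x) h1
  simp only [pd_const] at h2
  rw [pd_mul (by fun_prop) dd, pd_sq ds] at h2
  have h3 := H.pd_det_inv_le hε i x
  have h4 := H.sdet_mem hε x
  have h5 := H.det_inv_mem hε x
  set D := pd i (fun y => ((h y)⁻¹).det) x
  have h6 : 2 * pd i (sdet h) x * ((h x)⁻¹).det = -(sdet h x * D) := by
    have : sdet h x * (2 * pd i (sdet h) x * ((h x)⁻¹).det + sdet h x * D) = 0 := by linarith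
    rcases mul_eq_zero.1 this with h | h
    · linarith [h4.1]
    · linarith
  have h7 : |2 * pd i (sdet h) x * ((h x)⁻¹).det| = 2 * |pd i (sdet h) x| * ((h x)⁻¹).det := by
    rw [abs_mul, abs_mul, abs_of_pos (by norm_num : (0 : ℝ) < 2),
      abs_of_nonneg (show 0 ≤ ((h x)⁻¹).det by linarith [h5.1])]
  have h8 : |-(sdet h x * D)| ≤ 2 * |D| := by
    rw [abs_neg, abs_mul, abs_of_nonneg (show 0 ≤ sdet h x by linarith [h4.1])]
    exact mul_le_mul_of_nonneg_right h4.2 (abs_nonneg _)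
  rw [← h6, h7] at h8
  nlinarith [h5.1, abs_nonneg (pd i (sdet h) x)]

theorem nearFlat (H : InvBounds σ ε h) (hε : ε ≤ 1 / 100) :
    NearFlat σ (100000 * ε) (fun j k x => (h x)⁻¹ j k) (sdet h) (Rscal h) := by
  have h0 := H.nonneg
  have hW : ∀ x, 0 ≤ ε * pw 1 (-(1 + σ) / 2) x := fun x => mul_nonneg h0 (pw_pos one_pos _ x).le
  refine ⟨contDiff_inv_entry H.smooth H.posDef, contDiff_sdet H.smooth H.posDef,
    continuous_Rscal H.smooth H.posDef, fun j k x => ?_, fun j k x => ?_, fun i j k x => ?_,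
    fun x => (H.sdet_mem hε x).1, fun x => (H.sdet_mem hε x).2, fun i x => ?_, fun x => ?_⟩
  · have : ((h x)⁻¹).IsSymm := by
      rw [Matrix.IsSymm, Matrix.transpose_nonsing_inv, (H.symm x).eq]
    exact this.apply k j
  · have := mul_nonneg h0 (pw_pos one_pos (-σ / 2) x).le
    linarith [H.sub_le j k x]
  · linarith [H.pd_le i j k x, hW x]
  · linarith [H.pd_sdet_le hε i x, hW x]
  · linarith [H.Rscal_le H.pos hε x]

end InvBounds

section Morawetz

/-- The gradient of `α` with its index raised by `a`. -/
def flow (a : Fin 3 → Fin 3 → Eu 3 → ℝ) (α : Eu 3 → ℝ) (j : Fin 3) (x : Eu 3) : ℝ :=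
  ∑ k, a j k x * pd k α x

/-- The Laplace operator `s⁻¹ ∂_j (s a^{jk} ∂_k)`. -/
def lapS (a : Fin 3 → Fin 3 → Eu 3 → ℝ) (s : Eu 3 → ℝ) (α : Eu 3 → ℝ) (x : Eu 3) : ℝ :=
  (s x)⁻¹ * ∑ j, pd j (fun y => s y * flow a α j y) x

/-- The first-order multiplier `2 Y · ∂ + div Y`. -/
def mult (Y : Fin 3 → Eu 3 → ℝ) (α : Eu 3 → ℝ) (x : Eu 3) : ℝ :=
  2 * (∑ l, Y l x * pd l α x) + vdiv Y x * α x

/-- The quadratic form `a(∂α, ∂α)`. -/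
def quad (a : Fin 3 → Fin 3 → Eu 3 → ℝ) (α : Eu 3 → ℝ) (x : Eu 3) : ℝ :=
  ∑ j, flow a α j x * pd j α x

/-- The right-hand side of the Klein–Gordon equation. -/
def kgForce (a : Fin 3 → Fin 3 → Eu 3 → ℝ) (s R : Eu 3 → ℝ) (m : ℝ) (α : Eu 3 → ℝ) (x : Eu 3) : ℝ :=
  lapS a s α x - m ^ 2 * α x - R x / 4 * α x

/-- The momentum flux associated with the multiplier. -/
def morFlux (a : Fin 3 → Fin 3 → Eu 3 → ℝ) (Y : Fin 3 → Eu 3 → ℝ) (m : ℝ) (α β : Eu 3 → ℝ)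
    (j : Fin 3) (x : Eu 3) : ℝ :=
  Y j x * (β x ^ 2 - m ^ 2 * α x ^ 2 - quad a α x) + flow a α j x * mult Y α x
    - 1 / 2 * (pd j (vdiv Y) x * α x ^ 2)

/-- The bulk term of the Morawetz identity. -/
def morBulk (a : Fin 3 → Fin 3 → Eu 3 → ℝ) (s R : Eu 3 → ℝ) (Y : Fin 3 → Eu 3 → ℝ) (α : Eu 3 → ℝ)
    (x : Eu 3) : ℝ :=
  2 * (∑ j, flow a α j x * ∑ l, pd j (Y l) x * pd l α x)
    - (∑ l, Y l x * ∑ j, ∑ k, pd l (a j k) x * pd j α x * pd k α x)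
    + α x * (∑ j, (flow a α j x - pd j α x) * pd j (vdiv Y) x)
    - 1 / 2 * (∑ j, pd j (pd j (vdiv Y)) x) * α x ^ 2
    - (∑ j, pd j s x / s x * flow a α j x) * mult Y α x
    + R x / 4 * α x * mult Y α x

variable {a : Fin 3 → Fin 3 → Eu 3 → ℝ} {s R : Eu 3 → ℝ} {Y : Fin 3 → Eu 3 → ℝ} {m : ℝ}
  {α β : Eu 3 → ℝ}

theorem contDiff_flow (ha : ∀ j k, ContDiff ℝ ∞ (a j k)) (hα : ContDiff ℝ ∞ α) (j : Fin 3) :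
    ContDiff ℝ ∞ (flow a α j) :=
  ContDiff.sum fun k _ => (ha j k).mul (hα.pd k)

theorem contDiff_quad (ha : ∀ j k, ContDiff ℝ ∞ (a j k)) (hα : ContDiff ℝ ∞ α) :
    ContDiff ℝ ∞ (quad a α) :=
  ContDiff.sum fun j _ => (contDiff_flow ha hα j).mul (hα.pd j)

theorem contDiff_vdiv (hY : ∀ l, ContDiff ℝ ∞ (Y l)) : ContDiff ℝ ∞ (vdiv Y) :=
  ContDiff.sum fun l _ => (hY l).pd l

theorem contDiff_mult (hY : ∀ l, ContDiff ℝ ∞ (Y l)) (hα : ContDiff ℝ ∞ α) :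
    ContDiff ℝ ∞ (mult Y α) :=
  (contDiff_const.mul (ContDiff.sum fun l _ => (hY l).mul (hα.pd l))).add
    ((contDiff_vdiv hY).mul hα)

theorem contDiff_morFlux (ha : ∀ j k, ContDiff ℝ ∞ (a j k)) (hY : ∀ l, ContDiff ℝ ∞ (Y l))
    (hα : ContDiff ℝ ∞ α) (hβ : ContDiff ℝ ∞ β) (j : Fin 3) :
    ContDiff ℝ ∞ (morFlux a Y m α β j) := by
  have h1 := contDiff_quad ha hα
  have h2 := contDiff_flow ha hα j
  have h3 := contDiff_mult hY hα
  have h4 := (contDiff_vdiv hY).pd j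
  have h5 := hY j
  unfold morFlux
  fun_prop

theorem lapS_eq (ha : ∀ j k, ContDiff ℝ ∞ (a j k)) (hs : ContDiff ℝ ∞ s) (hs0 : ∀ x, s x ≠ 0)
    (hα : ContDiff ℝ ∞ α) (x : Eu 3) :
    lapS a s α x = ∑ j, pd j (flow a α j) x + ∑ j, pd j s x / s x * flow a α j x := by
  have h : ∀ j, pd j (fun y => s y * flow a α j y) x
      = pd j s x * flow a α j x + s x * pd j (flow a α j) x := fun j =>
    pd_mul (hs.diffAt x) ((contDiff_flow ha hα j).diffAt x) j
  simp only [lapS, h, Finset.mul_sum, ← Finset.sum_add_distrib]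
  refine Finset.sum_congr rfl fun j _ => ?_
  field_simp [hs0 x]
  ring

theorem pd_mult (hY : ∀ l, ContDiff ℝ ∞ (Y l)) (hα : ContDiff ℝ ∞ α) (j : Fin 3) (x : Eu 3) :
    pd j (mult Y α) x
      = 2 * (∑ l, pd j (Y l) x * pd l α x) + 2 * (∑ l, Y l x * pd l (pd j α) x)
        + pd j (vdiv Y) x * α x + vdiv Y x * pd j α x := by
  have d1 := fun l => (hY l).diffAt x
  have d2 := fun l => (hα.pd l).diffAt x
  have d3 := (contDiff_vdiv hY).diffAt x
  have d4 := hα.diffAt x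
  have d5 : DifferentiableAt ℝ (fun y => ∑ l, Y l y * pd l α y) x :=
    DifferentiableAt.fun_sum fun l _ => (d1 l).fun_mul (d2 l)
  unfold mult
  rw [pd_add (by fun_prop) (by fun_prop), pd_const_mul d5, pd_mul d3 d4,
    pd_sum fun l _ => (d1 l).fun_mul (d2 l)]
  simp only [fun l => pd_mul (d1 l) (d2 l) j, fun l => pd_comm hα j l x, Finset.sum_add_distrib]
  ring

theorem pd_quad (ha : ∀ j k, ContDiff ℝ ∞ (a j k)) (hsymm : ∀ j k x, a j k x = a k j x)
    (hα : ContDiff ℝ ∞ α) (l : Fin 3) (x : Eu 3) :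
    pd l (quad a α) x = (∑ j, ∑ k, pd l (a j k) x * pd j α x * pd k α x)
      + 2 * ∑ j, flow a α j x * pd l (pd j α) x := by
  have d1 := fun j k => (ha j k).diffAt x
  have d2 := fun l => (hα.pd l).diffAt x
  have d3 := fun j => (contDiff_flow ha hα j).diffAt x
  have e1 : ∀ j, pd l (flow a α j) x
      = ∑ k, (pd l (a j k) x * pd k α x + a j k x * pd l (pd k α) x) := fun j => by
    unfold flow
    rw [pd_sum fun k _ => (d1 j k).fun_mul (d2 k)]
    exact Finset.sum_congr rfl fun k _ => pd_mul (d1 j k) (d2 k) l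
  have e2 : ∑ j, (∑ k, a j k x * pd l (pd k α) x) * pd j α x
      = ∑ j, flow a α j x * pd l (pd j α) x := by
    simp only [flow, Finset.sum_mul]
    rw [Finset.sum_comm]
    refine Finset.sum_congr rfl fun j _ => Finset.sum_congr rfl fun k _ => ?_
    rw [hsymm k j]; ring
  unfold quad
  rw [pd_sum fun j _ => (d3 j).fun_mul (d2 j)]
  simp only [fun j => pd_mul (d3 j) (d2 j) l, e1, Finset.sum_add_distrib, add_mul, e2]
  rw [two_mul, ← add_assoc]
  congr 2
  simp only [Finset.sum_mul]
  exact Finset.sum_congr rfl fun j _ => Finset.sum_congr rfl fun k _ => by ring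

/-- The pointwise Morawetz identity for the Klein–Gordon equation. -/
theorem morawetz_identity (ha : ∀ j k, ContDiff ℝ ∞ (a j k)) (hsymm : ∀ j k x, a j k x = a k j x)
    (hs : ContDiff ℝ ∞ s) (hs0 : ∀ x, s x ≠ 0) (hY : ∀ l, ContDiff ℝ ∞ (Y l))
    (hα : ContDiff ℝ ∞ α) (hβ : ContDiff ℝ ∞ β) (x : Eu 3) :
    kgForce a s R m α x * mult Y α x + β x * mult Y β x
      = ∑ j, pd j (morFlux a Y m α β j) x - morBulk a s R Y α x := by
  have dα := hα.diffAt x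
  have dβ := hβ.diffAt x
  have dY := fun j => (hY j).diffAt x
  have dV := fun j => (contDiff_flow ha hα j).diffAt x
  have dQ := (contDiff_quad ha hα).diffAt x
  have dM := (contDiff_mult hY hα).diffAt x
  have dD := fun j => ((contDiff_vdiv hY).pd j).diffAt x
  have e : ∀ j, pd j (morFlux a Y m α β j) x
      = pd j (Y j) x * (β x ^ 2 - m ^ 2 * α x ^ 2 - quad a α x)
        + Y j x * (2 * β x * pd j β x - m ^ 2 * (2 * α x * pd j α x) - pd j (quad a α) x)
        + (pd j (flow a α j) x * mult Y α x + flow a α j x * pd j (mult Y α) x)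
        - 1 / 2 * (pd j (pd j (vdiv Y)) x * α x ^ 2
          + pd j (vdiv Y) x * (2 * α x * pd j α x)) := by
    intro j
    have dj := dY j
    have vj := dV j
    have Dj := dD j
    unfold morFlux
    rw [pd_sub (by fun_prop) (by fun_prop), pd_add (by fun_prop) (by fun_prop),
      pd_mul dj (by fun_prop), pd_sub (by fun_prop) dQ, pd_sub (by fun_prop) (by fun_prop),
      pd_sq dβ, pd_const_mul (by fun_prop), pd_sq dα, pd_mul vj dM, pd_const_mul (by fun_prop),
      pd_mul Dj (by fun_prop), pd_sq dα]
  have hV : ∑ j, flow a α j x * pd j α x = quad a α x := rfl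
  have hD : ∑ j, pd j (Y j) x = vdiv Y x := rfl
  have hS : ∑ j, flow a α j x * ∑ l, Y l x * pd l (pd j α) x
      = ∑ l, Y l x * ∑ j, flow a α j x * pd l (pd j α) x := by
    simp only [Finset.mul_sum]
    rw [Finset.sum_comm]
    exact Finset.sum_congr rfl fun j _ => Finset.sum_congr rfl fun k _ => by ring
  rw [kgForce, lapS_eq ha hs hs0 hα, morBulk]
  simp only [e, pd_mult hY hα, pd_quad ha hsymm hα]
  have hY' : ∑ l, Y l x * pd l β x = (mult Y β x - vdiv Y x * β x) / 2 := by rw [mult]; ring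
  have hYα : ∑ l, Y l x * pd l α x = (mult Y α x - vdiv Y x * α x) / 2 := by rw [mult]; ring
  rw [← hD] at hY' hYα ⊢
  rw [← hV]
  simp only [Fin.sum_univ_three] at *
  linear_combination (-2 * β x) * hY' + (2 * m ^ 2 * α x) * hYα - 2 * hS

end Morawetz

section Bulk

variable {a : Fin 3 → Fin 3 → Eu 3 → ℝ} {s R : Eu 3 → ℝ} {Y : Fin 3 → Eu 3 → ℝ} {m σ ε S : ℝ}
  {α β : Eu 3 → ℝ}

theorem abs_pd_le_sqrt_gradSq (α : Eu 3 → ℝ) (j : Fin 3) (x : Eu 3) :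
    |pd j α x| ≤ √(gradSq α x) := by
  refine Real.abs_le_sqrt ?_
  exact Finset.single_le_sum (f := fun j => pd j α x ^ 2) (fun _ _ => sq_nonneg _)
    (Finset.mem_univ j)

theorem pw_one_le_one {b : ℝ} (hb : b ≤ 0) (x : Eu 3) : pw 1 b x ≤ 1 :=
  (pw_mono le_rfl hb x).trans_eq (pw_zero x)

theorem NearFlat.abs_flow_sub_le (hN : NearFlat σ ε a s R) (j : Fin 3) (x : Eu 3) :
    |flow a α j x - pd j α x| ≤ 3 * (ε * pw 1 (-σ / 2) x * √(gradSq α x)) := by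
  have h : flow a α j x - pd j α x = ∑ k, (a j k x - if j = k then 1 else 0) * pd k α x := by
    simp [flow, sub_mul, Finset.sum_sub_distrib]
  rw [h]
  refine abs_sum_fin3_le fun k => ?_
  rw [abs_mul]
  exact mul_le_mul (hN.abs_inv_sub_le j k x) (abs_pd_le_sqrt_gradSq α k x) (abs_nonneg _)
    ((abs_nonneg _).trans (hN.abs_inv_sub_le j k x))

theorem NearFlat.abs_flow_le (hN : NearFlat σ ε a s R) (hσ : 0 ≤ σ) (hε : ε ≤ 1)
    (j : Fin 3) (x : Eu 3) : |flow a α j x| ≤ 4 * √(gradSq α x) := by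
  have h1 := hN.abs_flow_sub_le (α := α) j x
  have h2 := abs_pd_le_sqrt_gradSq α j x
  have h3 := pw_one_le_one (b := -σ / 2) (by linarith) x
  have h5 : ε * pw 1 (-σ / 2) x * √(gradSq α x) ≤ 1 * √(gradSq α x) :=
    mul_le_mul_of_nonneg_right (mul_le_one₀ hε (pw_pos one_pos _ _).le h3) (sqrt_nonneg _)
  have := abs_add_le (flow a α j x - pd j α x) (pd j α x)
  rw [sub_add_cancel] at this
  linarith

theorem NearFlat.abs_quad_le (hN : NearFlat σ ε a s R) (hσ : 0 ≤ σ) (hε : ε ≤ 1)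
    (x : Eu 3) : |quad a α x| ≤ 12 * gradSq α x := by
  have h : |quad a α x| ≤ 3 * (4 * √(gradSq α x) * √(gradSq α x)) := by
    refine abs_sum_fin3_le fun j => ?_
    rw [abs_mul]
    exact mul_le_mul (hN.abs_flow_le hσ hε j x) (abs_pd_le_sqrt_gradSq α j x) (abs_nonneg _)
      (by positivity)
  have := Real.mul_self_sqrt (gradSq_nonneg α x)
  linarith

theorem IsMultiplier.abs_mult_le (hY : IsMultiplier σ S Y) (α : Eu 3 → ℝ) (x : Eu 3) :
    |mult Y α x| ≤ 36 * √(gradSq α x) + 54 * (pw 1 (-1 / 2) x * |α x|) := by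
  have h1 : |∑ l, Y l x * pd l α x| ≤ 3 * (6 * √(gradSq α x)) := by
    refine abs_sum_fin3_le fun j => ?_
    rw [abs_mul]
    exact mul_le_mul (hY.abs_le j x) (abs_pd_le_sqrt_gradSq α j x) (abs_nonneg _) (by positivity)
  have h2 : |vdiv Y x * α x| ≤ 54 * pw 1 (-1 / 2) x * |α x| := by
    rw [abs_mul]; exact mul_le_mul_of_nonneg_right (hY.abs_vdiv_le x) (abs_nonneg _)
  have h3 : |2 * ∑ l, Y l x * pd l α x| = 2 * |∑ l, Y l x * pd l α x| := by
    rw [abs_mul, abs_two]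
  have := abs_add_le (2 * ∑ l, Y l x * pd l α x) (vdiv Y x * α x)
  rw [mult]
  linarith

theorem pw_mul_abs_le_div {x : Eu 3} (hx : x ≠ 0) (t : ℝ) :
    pw 1 (-1 / 2) x * |t| ≤ |t| / ‖x‖ := by
  have hn : 0 < ‖x‖ := norm_pos_iff.2 hx
  rw [le_div_iff₀ hn]
  have h := norm_mul_pw_le one_pos (-1 / 2) x
  norm_num [pw_zero] at h
  have h' : ‖x‖ * pw 1 (-1 / 2) x ≤ 1 := by convert h using 3; norm_num
  nlinarith [abs_nonneg t]

set_option maxHeartbeats 1000000 in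
/-- Lower bound for the bulk term away from the origin. -/
theorem NearFlat.le_morBulk (hN : NearFlat σ ε a s R) (hσ : 0 ≤ σ) (hε0 : 0 ≤ ε) (hε : ε ≤ 1)
    (hY : IsMultiplier σ S Y) {x : Eu 3} (hx : x ≠ 0) :
    2 * ((σ * pw 1 (-(1 + σ) / 2) x + S ^ 2 * pw S (-3 / 2) x) * gradSq α x)
      + 1 / 2 * ((σ * pw 1 (-(3 + σ) / 2) x + 15 * S ^ 4 * pw S (-7 / 2) x) * α x ^ 2)
      - 4000 * ε * (pw 1 (-(1 + σ) / 2) x * (gradSq α x + α x ^ 2 / ‖x‖ ^ 2))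
      ≤ morBulk a s R Y α x := by
  have hn : 0 < ‖x‖ := norm_pos_iff.2 hx
  set q := √(gradSq α x) with hq
  have hq0 : 0 ≤ q := sqrt_nonneg _
  have hqq : gradSq α x = q ^ 2 := (Real.sq_sqrt (gradSq_nonneg α x)).symm
  set z := |α x| / ‖x‖ with hz
  have hz0 : 0 ≤ z := by positivity
  have hzz : α x ^ 2 / ‖x‖ ^ 2 = z ^ 2 := by rw [hz, div_pow, sq_abs]
  set w := pw 1 (-(1 + σ) / 2) x with hw
  set e := pw 1 (-σ / 2) x with he
  set d := pw 1 (-1 / 2) x with hd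
  have hw0 : 0 < w := pw_pos one_pos _ _
  have he0 : 0 < e := pw_pos one_pos _ _
  have hd0 : 0 < d := pw_pos one_pos _ _
  have hed : e * d = w := by rw [he, hd, ← pw_add one_pos]; congr 1; ring
  have hdd : pw 1 (-1) x = d * d := by rw [hd, ← pw_add one_pos]; norm_num
  have hdz : d * |α x| ≤ z := pw_mul_abs_le_div hx _
  have hαz : |α x| = ‖x‖ * z := by rw [hz]; field_simp
  have hp : ∀ j, |pd j α x| ≤ q := fun j => abs_pd_le_sqrt_gradSq α j x
  have hmul : |mult Y α x| ≤ 36 * q + 54 * z := by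
    have h := hY.abs_mult_le α x
    rw [← hq, ← hd] at h
    linarith
  have t1 : |∑ j, (flow a α j x - pd j α x) * ∑ l, pd j (Y l) x * pd l α x|
      ≤ 3 * (3 * (ε * e * q) * (3 * (18 * d * q))) := by
    refine abs_sum_fin3_le fun j => ?_
    rw [abs_mul]
    refine mul_le_mul (hN.abs_flow_sub_le j x) (abs_sum_fin3_le fun l => ?_) (abs_nonneg _)
      (by positivity)
    rw [abs_mul]
    exact mul_le_mul (hY.abs_pd_le j l x) (hp l) (abs_nonneg _) (by positivity)
  have t1' : ∑ j, flow a α j x * ∑ l, pd j (Y l) x * pd l α x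
      = ∑ j, (flow a α j x - pd j α x) * ∑ l, pd j (Y l) x * pd l α x
        + ∑ j, ∑ l, pd j (Y l) x * pd j α x * pd l α x := by
    simp only [sub_mul, Finset.sum_sub_distrib, Finset.mul_sum]
    rw [sub_add_eq_add_sub, eq_comm, sub_eq_iff_eq_add, add_right_inj]
    exact Finset.sum_congr rfl fun j _ => Finset.sum_congr rfl fun k _ => by ring
  have t1'' := hY.le_quadForm x fun j => pd j α x
  have t2 : |∑ l, Y l x * ∑ j, ∑ k, pd l (a j k) x * pd j α x * pd k α x|
      ≤ 3 * (6 * (3 * (3 * (ε * w * q * q)))) := by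
    refine abs_sum_fin3_le fun l => ?_
    rw [abs_mul]
    refine mul_le_mul (hY.abs_le l x) (abs_sum_fin3_le fun j => abs_sum_fin3_le fun k => ?_)
      (abs_nonneg _) (by positivity)
    rw [abs_mul, abs_mul]
    have := hN.abs_pd_inv_le l j k x
    exact mul_le_mul (mul_le_mul this (hp j) (abs_nonneg _) (by positivity)) (hp k)
      (abs_nonneg _) (by positivity)
  have t3 : |∑ j, (flow a α j x - pd j α x) * pd j (vdiv Y) x|
      ≤ 3 * (3 * (ε * e * q) * (72 * (d * d))) := by
    refine abs_sum_fin3_le fun j => ?_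
    rw [abs_mul]
    refine mul_le_mul (hN.abs_flow_sub_le j x) ?_ (abs_nonneg _) (by positivity)
    rw [← hdd]; exact hY.abs_pd_vdiv_le j x
  have t3' : |α x * ∑ j, (flow a α j x - pd j α x) * pd j (vdiv Y) x| ≤ 648 * (ε * w * q * z) := by
    rw [abs_mul]
    calc |α x| * _ ≤ |α x| * (3 * (3 * (ε * e * q) * (72 * (d * d)))) :=
          mul_le_mul_of_nonneg_left t3 (abs_nonneg _)
      _ = 648 * (ε * (e * d) * q) * (d * |α x|) := by ring
      _ ≤ 648 * (ε * (e * d) * q) * z := mul_le_mul_of_nonneg_left hdz (by positivity)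
      _ = _ := by rw [hed]; ring
  have t5 : |∑ j, pd j s x / s x * flow a α j x| ≤ 3 * (2 * (ε * w) * (4 * q)) := by
    refine abs_sum_fin3_le fun j => ?_
    rw [abs_mul]
    refine mul_le_mul ?_ (hN.abs_flow_le hσ hε j x) (abs_nonneg _) (by positivity)
    have h1 := hN.half_le_density x
    have h2 := hN.abs_pd_density_le j x
    rw [abs_div, abs_of_pos (by linarith : 0 < s x), div_le_iff₀ (by linarith)]
    have : 0 ≤ ε * w := by positivity
    nlinarith
  have t5' : |(∑ j, pd j s x / s x * flow a α j x) * mult Y α x|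
      ≤ 24 * (ε * w * q) * (36 * q + 54 * z) := by
    rw [abs_mul]
    refine mul_le_mul (t5.trans_eq (by ring)) hmul (abs_nonneg _) (by positivity)
  have t6 : |R x / 4 * α x * mult Y α x| ≤ 1 / 4 * (ε * w) * z * (36 * q + 54 * z) := by
    rw [abs_mul]
    refine mul_le_mul ?_ hmul (abs_nonneg _) (by positivity)
    rw [abs_mul, hαz, abs_div, abs_of_pos (by norm_num : (0 : ℝ) < 4)]
    have := mul_le_mul_of_nonneg_right (hN.abs_curv_le x) hz0
    linarith
  have t4 := mul_le_mul_of_nonneg_right (hY.laplacian_le x) (sq_nonneg (α x))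
  have hG : gradSq α x = ∑ j, pd j α x ^ 2 := rfl
  rw [← hG] at t1''
  rw [morBulk, t1']
  have b1 := (abs_le.1 t1).1
  have b2 := (abs_le.1 t2).2
  have b3 := (abs_le.1 t3').1
  have b5 := (abs_le.1 t5').2
  have b6 := (abs_le.1 t6).1
  have c1 : 3 * (3 * (ε * e * q) * (3 * (18 * d * q))) = 486 * (ε * w * q ^ 2) := by
    rw [← hed]; ring
  have hεw : 0 ≤ ε * w := by positivity
  have c2 : ε * w * (2 * (q * z)) ≤ ε * w * (q ^ 2 + z ^ 2) :=
    mul_le_mul_of_nonneg_left (by nlinarith [sq_nonneg (q - z)]) hεw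
  have c3 : 0 ≤ ε * w * q ^ 2 := by positivity
  have c4 : 0 ≤ ε * w * z ^ 2 := by positivity
  rw [c1] at b1
  rw [hzz, hqq]
  rw [hqq] at t1''
  linarith

end Bulk

theorem integral_combination₃ {X : Type*} [MeasurableSpace X] {μ : Measure X} {f g h : X → ℝ}
    (hf : Integrable f μ) (hg : Integrable g μ) (hh : Integrable h μ) (a b c : ℝ) :
    Integrable (fun x => a * f x + b * g x + c * h x) μ ∧
      ∫ x, a * f x + b * g x + c * h x ∂μ
        = a * ∫ x, f x ∂μ + b * ∫ x, g x ∂μ + c * ∫ x, h x ∂μ := by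
  have i1 := hf.const_mul a
  have i2 := hg.const_mul b
  have i3 := hh.const_mul c
  refine ⟨(i1.add i2).add i3, ?_⟩
  have e := integral_add' (i1.add i2) i3
  rw [integral_add' i1 i2, integral_const_mul, integral_const_mul, integral_const_mul] at e
  exact e

theorem integral_combination₄ {X : Type*} [MeasurableSpace X] {μ : Measure X} {f g h l : X → ℝ}
    (hf : Integrable f μ) (hg : Integrable g μ) (hh : Integrable h μ) (hl : Integrable l μ)
    (a b c d : ℝ) :
    Integrable (fun x => a * f x + b * g x + c * h x + d * l x) μ ∧
      ∫ x, a * f x + b * g x + c * h x + d * l x ∂μ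
        = a * ∫ x, f x ∂μ + b * ∫ x, g x ∂μ + c * ∫ x, h x ∂μ + d * ∫ x, l x ∂μ := by
  obtain ⟨j, e⟩ := integral_combination₃ hf hg hh a b c
  have i := hl.const_mul d
  refine ⟨j.add i, ?_⟩
  have e' := integral_add' j i
  rw [e, integral_const_mul] at e'
  exact e'

section Static

variable {a : Fin 3 → Fin 3 → Eu 3 → ℝ} {s R : Eu 3 → ℝ} {Y : Fin 3 → Eu 3 → ℝ} {m σ ε S : ℝ}
  {α β : Eu 3 → ℝ} {k E : ℝ}

theorem NearFlat.abs_morFlux_le (hN : NearFlat σ ε a s R) (hσ : 0 ≤ σ) (hε : ε ≤ 1)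
    (hY : IsMultiplier σ S Y) (j : Fin 3) {x : Eu 3} (hx : x ≠ 0) :
    |morFlux a Y m α β j x|
      ≤ 6 * β x ^ 2 + 6 * (m ^ 2 * α x ^ 2) + 324 * gradSq α x + 144 * (α x ^ 2 / ‖x‖ ^ 2) := by
  set q := √(gradSq α x) with hq
  have hq0 : 0 ≤ q := sqrt_nonneg _
  have hqq : gradSq α x = q ^ 2 := (Real.sq_sqrt (gradSq_nonneg α x)).symm
  set z := |α x| / ‖x‖ with hz
  have hz0 : 0 ≤ z := by positivity
  have hzz : α x ^ 2 / ‖x‖ ^ 2 = z ^ 2 := by rw [hz, div_pow, sq_abs]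
  have hdz : pw 1 (-1 / 2) x * |α x| ≤ z := pw_mul_abs_le_div hx _
  have hmul : |mult Y α x| ≤ 36 * q + 54 * z := (hY.abs_mult_le α x).trans (by gcongr)
  have hquad := hN.abs_quad_le hσ hε (α := α) x
  rw [hqq] at hquad
  have h1 : |Y j x * (β x ^ 2 - m ^ 2 * α x ^ 2 - quad a α x)|
      ≤ 6 * (β x ^ 2 + m ^ 2 * α x ^ 2 + 12 * q ^ 2) := by
    rw [abs_mul]
    refine mul_le_mul (hY.abs_le j x) ?_ (abs_nonneg _) (by norm_num)
    have e1 : 0 ≤ m ^ 2 * α x ^ 2 := by positivity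
    have e2 := sq_nonneg (β x)
    rw [abs_le] at *
    constructor <;> linarith
  have h2 : |flow a α j x * mult Y α x| ≤ 4 * q * (36 * q + 54 * z) := by
    rw [abs_mul]
    exact mul_le_mul (hN.abs_flow_le hσ hε j x) hmul (abs_nonneg _) (by positivity)
  have h3 : |1 / 2 * (pd j (vdiv Y) x * α x ^ 2)| ≤ 36 * z ^ 2 := by
    have hd : pw 1 (-1) x = pw 1 (-1 / 2) x ^ 2 := by rw [pw_sq one_pos]; norm_num
    have e := mul_le_mul_of_nonneg_right (hY.abs_pd_vdiv_le j x) (sq_nonneg (α x))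
    have e' : (pw 1 (-1 / 2) x * |α x|) ^ 2 ≤ z ^ 2 :=
      pow_le_pow_left₀ (mul_nonneg (pw_pos one_pos _ _).le (abs_nonneg _)) hdz 2
    rw [mul_pow, sq_abs, ← hd] at e'
    rw [abs_mul, abs_mul, abs_of_nonneg (sq_nonneg (α x)), abs_of_pos (by norm_num : (0:ℝ) < 1 / 2)]
    linarith
  rw [hzz, hqq, morFlux]
  have := abs_sub (Y j x * (β x ^ 2 - m ^ 2 * α x ^ 2 - quad a α x) + flow a α j x * mult Y α x)
    (1 / 2 * (pd j (vdiv Y) x * α x ^ 2))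
  have := abs_add_le (Y j x * (β x ^ 2 - m ^ 2 * α x ^ 2 - quad a α x))
    (flow a α j x * mult Y α x)
  nlinarith [sq_nonneg (q - z)]

theorem IsMultiplier.abs_mul_mult_le (hY : IsMultiplier σ S Y) {x : Eu 3} (hx : x ≠ 0) :
    |β x * mult Y α x| ≤ 72 * β x ^ 2 + 18 * gradSq α x + 14 * (α x ^ 2 / ‖x‖ ^ 2) := by
  have hqq := Real.sq_sqrt (gradSq_nonneg α x)
  have hzz : α x ^ 2 / ‖x‖ ^ 2 = (|α x| / ‖x‖) ^ 2 := by rw [div_pow, sq_abs]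
  have hdz := pw_mul_abs_le_div hx (α x)
  have hmul : |mult Y α x| ≤ 36 * √(gradSq α x) + 54 * (|α x| / ‖x‖) :=
    (hY.abs_mult_le α x).trans (by gcongr)
  rw [abs_mul, hzz, ← sq_abs (β x)]
  have := mul_le_mul_of_nonneg_left hmul (abs_nonneg (β x))
  nlinarith [sq_nonneg (|β x| - √(gradSq α x)), sq_nonneg (2 * |β x| - |α x| / ‖x‖)]

/-- Smooth Cauchy data with energy at most `E`. -/
structure FiniteEnergy (m E : ℝ) (α β : Eu 3 → ℝ) : Prop where
  smooth : ContDiff ℝ ∞ α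
  smooth' : ContDiff ℝ ∞ β
  integrable_sq : Integrable fun x => α x ^ 2
  integrable_sq' : Integrable fun x => β x ^ 2
  integrable_gradSq : Integrable (gradSq α)
  mass_le : m ^ 2 * ∫ x, α x ^ 2 ≤ E
  integral_sq_le : ∫ x, β x ^ 2 ≤ E
  integral_gradSq_le : ∫ x, gradSq α x ≤ E

theorem FiniteEnergy.energy_nonneg (hE : FiniteEnergy m E α β) : 0 ≤ E :=
  (integral_nonneg fun x => sq_nonneg (β x)).trans hE.integral_sq_le

theorem FiniteEnergy.hardy (hE : FiniteEnergy m E α β) :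
    Integrable (fun x => α x ^ 2 / ‖x‖ ^ 2) ∧ ∫ x, α x ^ 2 / ‖x‖ ^ 2 ≤ 4 * E := by
  have h := _root_.hardy (hE.smooth.of_le (by simp)) hE.integrable_sq hE.integrable_gradSq
  exact ⟨h.1, h.2.trans (by linarith [hE.integral_gradSq_le])⟩

theorem contDiff_gradSq (hα : ContDiff ℝ ∞ α) : ContDiff ℝ ∞ (gradSq α) :=
  ContDiff.sum fun j _ => (hα.pd j).pow 2

/-- The localized momentum is controlled by the energy. -/
theorem FiniteEnergy.abs_momentum_le (hE : FiniteEnergy m E α β) (hY : IsMultiplier σ S Y) :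
    |∫ x, cut k 0 x ^ 2 * (β x * mult Y α x)| ≤ 200 * E := by
  have hz := hE.hardy
  obtain ⟨hi, he⟩ := integral_combination₃ hE.integrable_sq' hE.integrable_gradSq hz.1 72 18 14
  rw [← Real.norm_eq_abs]
  refine (norm_integral_le_of_norm_le hi ?_).trans ?_
  · filter_upwards [ae_ne_zero] with x hx
    rw [Real.norm_eq_abs, abs_mul]
    refine (mul_le_of_le_one_left (abs_nonneg _) ?_).trans (hY.abs_mul_mult_le hx)
    rw [abs_of_nonneg (sq_nonneg _)]
    exact pow_le_one₀ (cut_nonneg x) (cut_le_one x)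
  · rw [he]
    linarith [hE.integral_sq_le, hE.integral_gradSq_le, hE.energy_nonneg]

theorem integrable_cut_mul (hk : 0 < k) {f : Eu 3 → ℝ} (hf : Continuous f) :
    Integrable fun x => cut k 0 x ^ 2 * f x := by
  have hc : Continuous (cut k 0) := contDiff_cut.continuous
  refine Continuous.integrable_of_hasCompactSupport (by fun_prop) ?_
  have h := hasCompactSupport_cut hk (le_refl (0 : ℝ))
  simp only [sq, mul_assoc]
  exact h.mul_right

/-- A localized weighted Hardy inequality. -/
theorem FiniteEnergy.weighted_hardy (hE : FiniteEnergy m E α β) (hσ : σ ∈ Ioo (0 : ℝ) 1)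
    (hk : 1 ≤ k) :
    Integrable (fun x => cut k 0 x ^ 2 * (pw 1 (-(1 + σ) / 2) x * (α x ^ 2 / ‖x‖ ^ 2))) ∧
    ∫ x, cut k 0 x ^ 2 * (pw 1 (-(1 + σ) / 2) x * (α x ^ 2 / ‖x‖ ^ 2))
      ≤ 12 * (∫ x, cut k 0 x ^ 2 * (pw 1 (-(1 + σ) / 2) x * gradSq α x))
        + 12 * (∫ x, cut k 0 x ^ 2 * (pw 1 (-(3 + σ) / 2) x * α x ^ 2))
        + 96 * transBd ^ 2 / k * E := by
  obtain ⟨hσ0, hσ1⟩ := hσ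
  have hk0 : 0 < k := by linarith
  set f : Eu 3 → ℝ := fun x => cut k 0 x * (pw 1 (-(1 + σ) / 4) x * α x) with hf
  have sχ : ContDiff ℝ ∞ (cut k 0) := contDiff_cut
  have sv : ContDiff ℝ ∞ (pw 1 (-(1 + σ) / 4)) := contDiff_pw one_pos _
  have sf : ContDiff ℝ ∞ f := sχ.mul (sv.mul hE.smooth)
  have cf : HasCompactSupport f := (hasCompactSupport_cut hk0 le_rfl).mul_right
  have hf2 : ∀ x, f x ^ 2 = cut k 0 x ^ 2 * (pw 1 (-(1 + σ) / 2) x * α x ^ 2) := fun x => by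
    have := pw_sq one_pos (-(1 + σ) / 4) x
    rw [show 2 * (-(1 + σ) / 4) = -(1 + σ) / 2 by ring] at this
    rw [hf, ← this]; ring
  have hz := hE.hardy
  have sα := hE.smooth
  have cw : ∀ b, Continuous (pw 1 b) := fun b => (contDiff_pw one_pos b).continuous
  have cP : Continuous (gradSq α) := (contDiff_gradSq hE.smooth).continuous
  have cα := hE.smooth.continuous
  have i1 : Integrable fun x => cut k 0 x ^ 2 * (pw 1 (-(1 + σ) / 2) x * gradSq α x) :=
    integrable_cut_mul hk0 ((cw _).mul cP)
  have i2 : Integrable fun x => cut k 0 x ^ 2 * (pw 1 (-(3 + σ) / 2) x * α x ^ 2) :=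
    integrable_cut_mul hk0 ((cw _).mul (cα.pow 2))
  have i3 : Integrable fun x => 2 * transBd ^ 2 / k * (α x ^ 2 / ‖x‖ ^ 2) := hz.1.const_mul _
  have j1 : Integrable fun x => f x ^ 2 := by
    simp only [hf2]
    exact integrable_cut_mul hk0 ((cw _).mul (cα.pow 2))
  have j2 : Integrable (gradSq f) := by
    refine (continuous_gradSq (sf.of_le (by simp))).integrable_of_hasCompactSupport ?_
    refine HasCompactSupport.intro cf.isCompact fun x hx => ?_
    refine Finset.sum_eq_zero fun j _ => ?_
    simp [pd, fderiv_of_notMem_tsupport ℝ hx]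
  have H := _root_.hardy (sf.of_le (by simp)) j1 j2
  have key : ∀ᵐ x : Eu 3, gradSq f x ≤ 3 * (cut k 0 x ^ 2 * (pw 1 (-(1 + σ) / 2) x * gradSq α x))
      + 3 * (cut k 0 x ^ 2 * (pw 1 (-(3 + σ) / 2) x * α x ^ 2))
      + 3 * (2 * transBd ^ 2 / k * (α x ^ 2 / ‖x‖ ^ 2)) := by
    filter_upwards [ae_ne_zero] with x hx
    have hn : 0 < ‖x‖ := norm_pos_iff.2 hx
    set χ := cut k 0 x
    set v := pw 1 (-(1 + σ) / 4) x with hv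
    set A := α x
    have e : ∀ j, pd j f x = χ * v * pd j α x + χ * A * pd j (pw 1 (-(1 + σ) / 4)) x
        + v * A * pd j (cut k 0) x := fun j => by
      rw [hf, pd_mul (sχ.diffAt x) ((sv.mul sα).diffAt x), pd_mul (sv.diffAt x) (sα.diffAt x)]
      ring
    have hv2 : v ^ 2 = pw 1 (-(1 + σ) / 2) x := by rw [hv, pw_sq one_pos]; congr 1; ring
    have g1 : gradSq f x ≤ 3 * (χ ^ 2 * v ^ 2 * gradSq α x)
        + 3 * (χ ^ 2 * A ^ 2 * gradSq (pw 1 (-(1 + σ) / 4)) x)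
        + 3 * (v ^ 2 * A ^ 2 * gradSq (cut k 0) x) := by
      simp only [gradSq, e, Finset.mul_sum, ← Finset.sum_add_distrib]
      refine Finset.sum_le_sum fun j _ => ?_
      nlinarith [sq_nonneg (χ * v * pd j α x - χ * A * pd j (pw 1 (-(1 + σ) / 4)) x),
        sq_nonneg (χ * v * pd j α x - v * A * pd j (cut k 0) x),
        sq_nonneg (χ * A * pd j (pw 1 (-(1 + σ) / 4)) x - v * A * pd j (cut k 0) x)]
    have g2 : gradSq (pw 1 (-(1 + σ) / 4)) x ≤ pw 1 (-(3 + σ) / 2) x := by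
      have h1 : gradSq (pw 1 (-(1 + σ) / 4)) x
          = (2 * (-(1 + σ) / 4)) ^ 2 * (‖x‖ ^ 2 * pw 1 (-(1 + σ) / 4 - 1) x ^ 2) := by
        simp only [gradSq, pd_pw one_pos, Eu.norm_sq_eq, Fin.sum_univ_three]; ring
      rw [h1, pw_sq one_pos]
      have h2 := norm_sq_mul_pw_le one_pos (2 * (-(1 + σ) / 4 - 1)) x
      rw [show 2 * (-(1 + σ) / 4 - 1) + 1 = -(3 + σ) / 2 by ring] at h2
      refine (mul_le_of_le_one_left ?_ ?_).trans h2
      · exact mul_nonneg (sq_nonneg _) (pw_pos one_pos _ _).le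
      · nlinarith
    have g3 : v ^ 2 * A ^ 2 * gradSq (cut k 0) x
        ≤ 2 * transBd ^ 2 / k * (A ^ 2 / ‖x‖ ^ 2) := by
      have hs0 : 0 ≤ cutSlope k 0 x := cutSlope_nonneg hk0 x
      have h0 : gradSq (cut k 0) x ≤ cutSlope k 0 x ^ 2 := gradSq_cut_le x
      by_cases hb : 2 * k < pw 1 (1 / 2) x + 0
      · have : cutSlope k 0 x = 0 := cutSlope_eq_zero hk0 hb
        rw [this] at h0
        have h0' : gradSq (cut k 0) x = 0 :=
          le_antisymm (h0.trans_eq (by ring)) (gradSq_nonneg _ _)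
        rw [h0', mul_zero]
        positivity
      · have h1 : cutSlope k 0 x ^ 2 ≤ (transBd / k) ^ 2 :=
          pow_le_pow_left₀ hs0 (cutSlope_le hk0 x) 2
        have h2 := norm_sq_mul_pw_le one_pos (-(1 + σ) / 2) x
        have h3 : pw 1 (-(1 + σ) / 2 + 1) x ≤ pw 1 (1 / 2) x := pw_mono le_rfl (by linarith) x
        have h4 : ‖x‖ ^ 2 * v ^ 2 ≤ 2 * k := by rw [hv2]; linarith
        have h5 : v ^ 2 * A ^ 2 * gradSq (cut k 0) x
            = ‖x‖ ^ 2 * v ^ 2 * gradSq (cut k 0) x * (A ^ 2 / ‖x‖ ^ 2) := by field_simp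
        rw [h5]
        refine mul_le_mul_of_nonneg_right ?_ (by positivity)
        calc ‖x‖ ^ 2 * v ^ 2 * gradSq (cut k 0) x ≤ 2 * k * (transBd / k) ^ 2 :=
              mul_le_mul h4 (h0.trans h1) (gradSq_nonneg _ _) (by positivity)
          _ = _ := by field_simp
    have g2' := mul_le_mul_of_nonneg_left g2 (by positivity : 0 ≤ χ ^ 2 * A ^ 2)
    rw [hv2] at g1 g3
    linarith
  obtain ⟨hi, he⟩ := integral_combination₃ i1 i2 i3 3 3 3
  have hint := integral_mono_ae j2 hi key
  rw [he, integral_const_mul] at hint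
  have hfe : ∀ x, cut k 0 x ^ 2 * (pw 1 (-(1 + σ) / 2) x * (α x ^ 2 / ‖x‖ ^ 2))
      = f x ^ 2 / ‖x‖ ^ 2 := fun x => by rw [hf2]; ring
  simp only [hfe]
  refine ⟨H.1, H.2.trans ?_⟩
  have h6 : 2 * transBd ^ 2 / k * ∫ x, α x ^ 2 / ‖x‖ ^ 2 ≤ 2 * transBd ^ 2 / k * (4 * E) :=
    mul_le_mul_of_nonneg_left hz.2 (by positivity)
  have h7 : 96 * transBd ^ 2 / k * E = 12 * (2 * transBd ^ 2 / k * (4 * E)) := by ring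
  rw [h7]
  linarith

/-- The localized Morawetz bulk is bounded below by its coercive part. -/
theorem FiniteEnergy.le_integral_morBulk (hE : FiniteEnergy m E α β) (hN : NearFlat σ ε a s R)
    (hσ : σ ∈ Ioo (0 : ℝ) 1) (hε0 : 0 ≤ ε) (hε : 104000 * ε ≤ σ) (hY : IsMultiplier σ S Y)
    (hS : 1 ≤ S) (hk : 1 ≤ k) (hB : Continuous (morBulk a s R Y α)) :
    (∫ x, cut k 0 x ^ 2 * (S ^ 2 * pw S (-3 / 2) x * gradSq α x
        + S ^ 4 * pw S (-7 / 2) x * α x ^ 2)) - 4 * transBd ^ 2 / k * E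
      ≤ ∫ x, cut k 0 x ^ 2 * morBulk a s R Y α x := by
  have hσ0 := hσ.1
  have hσ1 := hσ.2
  have hk0 : 0 < k := by linarith
  have hS0 : 0 < S := by linarith
  have cw : ∀ b, Continuous (pw 1 b) := fun b => (contDiff_pw one_pos b).continuous
  have cS : ∀ b, Continuous (pw S b) := fun b => (contDiff_pw hS0 b).continuous
  have cP : Continuous (gradSq α) := (contDiff_gradSq hE.smooth).continuous
  have cα := hE.smooth.continuous
  have i1 : Integrable fun x => cut k 0 x ^ 2 * (pw 1 (-(1 + σ) / 2) x * gradSq α x) :=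
    integrable_cut_mul hk0 ((cw _).mul cP)
  have i2 : Integrable fun x => cut k 0 x ^ 2 * (pw 1 (-(3 + σ) / 2) x * α x ^ 2) :=
    integrable_cut_mul hk0 ((cw _).mul (cα.pow 2))
  have i3 : Integrable fun x => cut k 0 x ^ 2 * (S ^ 2 * pw S (-3 / 2) x * gradSq α x
      + S ^ 4 * pw S (-7 / 2) x * α x ^ 2) := by
    have := cS (-3 / 2)
    have := cS (-7 / 2)
    exact integrable_cut_mul hk0 (by fun_prop)
  obtain ⟨i4, h4⟩ := hE.weighted_hardy hσ hk
  obtain ⟨i5, e5⟩ := integral_combination₄ i3 i1 i2 i4 1 (2 * σ - 4000 * ε) (σ / 2) (-(4000 * ε))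
  have key := integral_mono_ae i5 (integrable_cut_mul hk0 hB) (by
    filter_upwards [ae_ne_zero] with x hx
    have h := mul_le_mul_of_nonneg_left (hN.le_morBulk hσ0.le hε0 (by linarith) hY (α := α) hx)
      (sq_nonneg (cut k 0 x))
    refine le_trans ?_ h
    have h1 : 0 ≤ cut k 0 x ^ 2 * (S ^ 2 * pw S (-3 / 2) x * gradSq α x) := by
      have := pw_pos hS0 (-3 / 2) x
      have := gradSq_nonneg α x
      positivity
    have h2 : 0 ≤ cut k 0 x ^ 2 * (S ^ 4 * pw S (-7 / 2) x * α x ^ 2) := by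
      have := pw_pos hS0 (-7 / 2) x
      positivity
    linarith)
  rw [e5] at key
  have p1 : 0 ≤ ∫ x, cut k 0 x ^ 2 * (pw 1 (-(1 + σ) / 2) x * gradSq α x) :=
    integral_nonneg fun x => mul_nonneg (sq_nonneg _)
      (mul_nonneg (pw_pos one_pos _ _).le (gradSq_nonneg α x))
  have p2 : 0 ≤ ∫ x, cut k 0 x ^ 2 * (pw 1 (-(3 + σ) / 2) x * α x ^ 2) :=
    integral_nonneg fun x => mul_nonneg (sq_nonneg _)
      (mul_nonneg (pw_pos one_pos _ _).le (sq_nonneg _))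
  have p3 : 0 ≤ transBd ^ 2 / k * E := mul_nonneg (by positivity) hE.energy_nonneg
  have q4 := mul_le_mul_of_nonneg_left h4 (by linarith : 0 ≤ 4000 * ε)
  have q1 := mul_nonneg (by linarith : 0 ≤ 2 * σ - 52000 * ε) p1
  have q2 := mul_nonneg (by linarith : 0 ≤ σ / 2 - 48000 * ε) p2
  have q3 := mul_nonneg (by linarith : 0 ≤ 4 - 4000 * 96 * ε) p3
  simp only [mul_div_assoc, mul_assoc] at *
  linarith

end Static

section Static

variable {a : Fin 3 → Fin 3 → Eu 3 → ℝ} {s R : Eu 3 → ℝ} {Y : Fin 3 → Eu 3 → ℝ} {m σ ε S : ℝ}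
  {α β : Eu 3 → ℝ} {k E : ℝ}

theorem NearFlat.density_pos (hN : NearFlat σ ε a s R) (x : Eu 3) : 0 < s x := by
  linarith [hN.half_le_density x]

theorem NearFlat.continuous_lapS (hN : NearFlat σ ε a s R) (hα : ContDiff ℝ ∞ α) :
    Continuous (lapS a s α) := by
  refine (hN.smooth_density.continuous.inv₀ fun x => (hN.density_pos x).ne').mul ?_
  exact continuous_finsetSum _ fun j _ =>
    ((hN.smooth_density.mul (contDiff_flow hN.smooth_inv hα j)).pd j).continuous

theorem NearFlat.continuous_kgForce (hN : NearFlat σ ε a s R) (hα : ContDiff ℝ ∞ α) :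
    Continuous (kgForce a s R m α) := by
  have := hN.continuous_lapS hα
  have := hN.continuous_curv
  have := hα.continuous
  unfold kgForce
  fun_prop

/-- The localized momentum production is coercive up to a boundary error. -/
theorem FiniteEnergy.momentum_production_le (hE : FiniteEnergy m E α β) (hN : NearFlat σ ε a s R)
    (hσ : σ ∈ Ioo (0 : ℝ) 1) (hε0 : 0 ≤ ε) (hε : 104000 * ε ≤ σ) (hY : IsMultiplier σ S Y)
    (hS : 1 ≤ S) (hk : 1 ≤ k) :
    ∫ x, cut k 0 x ^ 2 * (kgForce a s R m α x * mult Y α x + β x * mult Y β x)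
      ≤ -(∫ x, cut k 0 x ^ 2 * (S ^ 2 * pw S (-3 / 2) x * gradSq α x
        + S ^ 4 * pw S (-7 / 2) x * α x ^ 2))
        + (8000 * transBd + 4 * transBd ^ 2) / k * E := by
  have hσ0 := hσ.1
  have hk0 : 0 < k := by linarith
  have sα := hE.smooth
  have sβ := hE.smooth'
  have ha := hN.smooth_inv
  have sF := fun j => contDiff_morFlux (m := m) ha hY.smooth sα sβ j
  have sχ : ContDiff ℝ ∞ (cut k 0) := contDiff_cut
  have cχ := sχ.continuous
  have hid := fun x => morawetz_identity (R := R) (m := m) ha hN.symm hN.smooth_density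
    (fun x => (hN.density_pos x).ne') hY.smooth sα sβ x
  have cL : Continuous fun x => kgForce a s R m α x * mult Y α x + β x * mult Y β x := by
    have h1 := hN.continuous_kgForce sα (m := m)
    have h2 := (contDiff_mult hY.smooth sα).continuous
    have h3 := (contDiff_mult hY.smooth sβ).continuous
    have h4 := sβ.continuous
    fun_prop
  have cD : Continuous fun x => ∑ j, pd j (morFlux a Y m α β j) x :=
    continuous_finsetSum _ fun j _ => ((sF j).pd j).continuous
  have cB : Continuous (morBulk a s R Y α) := by
    have : morBulk a s R Y α = fun x => (∑ j, pd j (morFlux a Y m α β j) x)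
        - (kgForce a s R m α x * mult Y α x + β x * mult Y β x) := by
      funext x; rw [hid x]; ring
    rw [this]
    exact cD.sub cL
  have hbulk := hE.le_integral_morBulk hN hσ hε0 hε hY hS hk cB
  have hcχ := hasCompactSupport_cut hk0 (le_refl (0 : ℝ))
  have sχ2 : ContDiff ℝ ∞ fun x => cut k 0 x ^ 2 := sχ.pow 2
  have sG := fun j => sχ2.mul (sF j)
  have hG : ∀ j, HasCompactSupport fun x => cut k 0 x ^ 2 * morFlux a Y m α β j x := fun j => by
    simp only [sq, mul_assoc]
    exact hcχ.mul_right
  have hdG : ∀ j, ∫ x, pd j (fun x => cut k 0 x ^ 2 * morFlux a Y m α β j x) x = 0 := fun j =>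
    integral_pd_of_compact ((sG j).of_le (by simp)) j (hG j)
  have iG : ∀ j, Integrable (pd j fun x => cut k 0 x ^ 2 * morFlux a Y m α β j x) := fun j =>
    ((sG j).pd j).continuous.integrable_of_hasCompactSupport ((hG j).pd j)
  have eG : ∀ j x, pd j (fun x => cut k 0 x ^ 2 * morFlux a Y m α β j x) x
      = 2 * cut k 0 x * pd j (cut k 0) x * morFlux a Y m α β j x
        + cut k 0 x ^ 2 * pd j (morFlux a Y m α β j) x := fun j x => by
    rw [pd_mul (sχ2.diffAt x) ((sF j).diffAt x), pd_sq (sχ.diffAt x)]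
  set Φ : Eu 3 → ℝ := fun x => ∑ j, 2 * cut k 0 x * pd j (cut k 0) x * morFlux a Y m α β j x
    with hΦ
  have iB := integrable_cut_mul hk0 cB
  have iS : Integrable fun x => ∑ j, pd j (fun x => cut k 0 x ^ 2 * morFlux a Y m α β j x) x :=
    integrable_finsetSum _ fun j _ => iG j
  have hz := hE.hardy
  obtain ⟨i4, e4⟩ := integral_combination₄ hE.integrable_sq' (hE.integrable_sq.const_mul (m ^ 2))
    hE.integrable_gradSq hz.1 (36 * (transBd / k)) (36 * (transBd / k)) (1944 * (transBd / k))
    (864 * (transBd / k))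
  have hK0 : 0 ≤ transBd / k := div_nonneg transBd_pos.le hk0.le
  have bΦ : ∀ᵐ x : Eu 3, ‖Φ x‖ ≤ 36 * (transBd / k) * β x ^ 2
      + 36 * (transBd / k) * (m ^ 2 * α x ^ 2) + 1944 * (transBd / k) * gradSq α x
      + 864 * (transBd / k) * (α x ^ 2 / ‖x‖ ^ 2) := by
    filter_upwards [ae_ne_zero] with x hx
    rw [Real.norm_eq_abs]
    refine (abs_sum_fin3_le (C := 2 * (transBd / k) * (6 * β x ^ 2 + 6 * (m ^ 2 * α x ^ 2)
      + 324 * gradSq α x + 144 * (α x ^ 2 / ‖x‖ ^ 2))) fun j => ?_).trans (le_of_eq (by ring))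
    rw [abs_mul]
    refine mul_le_mul ?_ (hN.abs_morFlux_le hσ0.le (by linarith [hσ.2]) hY j hx) (abs_nonneg _)
      (by positivity)
    rw [abs_mul, abs_mul, abs_two, abs_of_nonneg (cut_nonneg x), mul_assoc]
    refine mul_le_mul_of_nonneg_left ?_ (by norm_num)
    exact (mul_le_of_le_one_left (abs_nonneg _) (cut_le_one x)).trans
      (abs_pd_cut_le hk0 j x)
  have cΦ : Continuous Φ := by
    refine continuous_finsetSum _ fun j _ => ?_
    have := (sχ.pd j).continuous
    have := (sF j).continuous
    fun_prop
  have iΦ : Integrable Φ := i4.mono' cΦ.aestronglyMeasurable bΦ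
  have hΦle : |∫ x, Φ x| ≤ 8000 * transBd / k * E := by
    rw [← Real.norm_eq_abs]
    refine (norm_integral_le_of_norm_le i4 bΦ).trans ?_
    rw [e4, integral_const_mul]
    have h1 := mul_le_mul_of_nonneg_left hE.integral_sq_le hK0
    have h2 := mul_le_mul_of_nonneg_left hE.mass_le hK0
    have h3 := mul_le_mul_of_nonneg_left hE.integral_gradSq_le hK0
    have h4 := mul_le_mul_of_nonneg_left hz.2 hK0
    have h5 := mul_nonneg hK0 hE.energy_nonneg
    have : 8000 * transBd / k * E = 8000 * (transBd / k * E) := by ring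
    rw [this]
    linarith
  have e : ∀ x, cut k 0 x ^ 2 * (kgForce a s R m α x * mult Y α x + β x * mult Y β x)
      = (∑ j, pd j (fun x => cut k 0 x ^ 2 * morFlux a Y m α β j x) x) - Φ x
        - cut k 0 x ^ 2 * morBulk a s R Y α x := fun x => by
    rw [hid x, hΦ]
    simp only [eG, Finset.sum_add_distrib, mul_sub, Finset.mul_sum]
    ring
  have e' : ∫ x, cut k 0 x ^ 2 * (kgForce a s R m α x * mult Y α x + β x * mult Y β x)
      = -(∫ x, Φ x) - ∫ x, cut k 0 x ^ 2 * morBulk a s R Y α x := by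
    simp only [e]
    have := integral_sub' (iS.sub iΦ) iB
    rw [integral_sub' iS iΦ, integral_finsetSum _ fun j _ => iG j] at this
    simp only [hdG, Finset.sum_const_zero, zero_sub] at this
    exact this
  rw [e']
  have := (abs_le.1 hΦle).1
  have e3 : (8000 * transBd + 4 * transBd ^ 2) / k * E
      = 8000 * transBd / k * E + 4 * transBd ^ 2 / k * E := by ring
  rw [e3]
  linarith

end Static

section TimeRegularity

variable {F : Type*} [NormedAddCommGroup F] [NormedSpace ℝ F]

/-- Closed half space-time. -/
def halfST : Set (ℝ × Eu 3) := Ici (0 : ℝ) ×ˢ (univ : Set (Eu 3))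

theorem uniqueDiffOn_halfST : UniqueDiffOn ℝ halfST := (uniqueDiffOn_Ici 0).prod uniqueDiffOn_univ

theorem halfST_mem_nhds {p : ℝ × Eu 3} (hp : 0 < p.1) : halfST ∈ 𝓝 p := by
  rw [halfST, ← Prod.mk.eta (p := p)]
  exact prod_mem_nhds (Ici_mem_nhds hp) univ_mem

/-- Smoothness in space-time up to the initial time. -/
def SmoothST (U : ℝ → Eu 3 → F) : Prop := ContDiffOn ℝ ∞ (fun p : ℝ × Eu 3 => U p.1 p.2) halfST

variable {U V : ℝ → Eu 3 → F} {t : ℝ}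

theorem SmoothST.contDiff (hU : SmoothST U) (ht : 0 ≤ t) : ContDiff ℝ ∞ (U t) := by
  have h : ContDiff ℝ ∞ fun x : Eu 3 => (t, x) := by fun_prop
  exact contDiffOn_univ.1 (ContDiffOn.comp (g := fun p : ℝ × Eu 3 => U p.1 p.2) hU h.contDiffOn
    fun x _ => ⟨ht, mem_univ _⟩)

theorem SmoothST.continuousOn (hU : SmoothST U) :
    ContinuousOn (fun p : ℝ × Eu 3 => U p.1 p.2) halfST := ContDiffOn.continuousOn hU

theorem SmoothST.continuousOn_time (hU : SmoothST U) (x : Eu 3) :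
    ContinuousOn (fun t => U t x) (Ici 0) :=
  hU.continuousOn.comp (f := fun t : ℝ => (t, x)) (by fun_prop) fun t ht => ⟨ht, mem_univ _⟩

theorem SmoothST.pd (hU : SmoothST U) (j : Fin 3) : SmoothST fun t => pd j (U t) := by
  have h := (hU.fderivWithin uniqueDiffOn_halfST (m := ∞) le_rfl).clm_apply
    (contDiffOn_const (c := ((0 : ℝ), (EuclideanSpace.single j 1 : Eu 3))))
  refine ContDiffOn.congr h fun p hp => ?_
  have h1 := (hU.differentiableOn (by simp) p hp).hasFDerivWithinAt
  have h2 : HasFDerivAt (fun x : Eu 3 => (p.1, x)) (ContinuousLinearMap.inr ℝ ℝ (Eu 3)) p.2 :=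
    hasFDerivAt_prodMk_right p.1 p.2
  have hm : MapsTo (fun x : Eu 3 => (p.1, x)) univ halfST := fun x _ => ⟨hp.1, mem_univ _⟩
  have h3 := HasFDerivWithinAt.comp (f := fun x : Eu 3 => (p.1, x)) p.2 h1 h2.hasFDerivWithinAt hm
  rw [hasFDerivWithinAt_univ] at h3
  exact h3.pd_eq j

theorem SmoothST.clm {G : Type*} [NormedAddCommGroup G] [NormedSpace ℝ G] (hU : SmoothST U)
    (L : F →L[ℝ] G) : SmoothST fun t x => L (U t x) :=
  L.contDiff.comp_contDiffOn hU

theorem SmoothST.add (hU : SmoothST U) (hV : SmoothST V) : SmoothST fun t x => U t x + V t x :=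
  ContDiffOn.add hU hV

theorem SmoothST.sum {ι : Type*} {s : Finset ι} {U : ι → ℝ → Eu 3 → F}
    (hU : ∀ i ∈ s, SmoothST (U i)) : SmoothST fun t x => ∑ i ∈ s, U i t x :=
  ContDiffOn.sum hU

theorem SmoothST.mul {A : Type*} [NormedRing A] [NormedAlgebra ℝ A] {U V : ℝ → Eu 3 → A}
    (hU : SmoothST U) (hV : SmoothST V) : SmoothST fun t x => U t x * V t x :=
  ContDiffOn.mul hU hV

theorem smoothST_of_space {f : Eu 3 → F} (hf : ContDiff ℝ ∞ f) : SmoothST fun _ => f :=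
  (hf.comp contDiff_snd).contDiffOn

theorem SmoothST.apply {n : ℕ} {U : ℝ → Eu 3 → Fin n → F} (hU : SmoothST U) (i : Fin n) :
    SmoothST fun t x => U t x i :=
  contDiffOn_pi.1 hU i

theorem HasFDerivAt.time_slice {W : ℝ × Eu 3 → F} {W' : ℝ × Eu 3 →L[ℝ] F} {x : Eu 3}
    (h : HasFDerivAt W W' (t, x)) : HasDerivAt (fun s => W (s, x)) (W' (1, 0)) t := by
  have h2 : HasFDerivAt (fun r : ℝ => (r, x)) (ContinuousLinearMap.inl ℝ ℝ (Eu 3)) t :=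
    hasFDerivAt_prodMk_left t x
  have h3 := (HasFDerivAt.comp (f := fun r : ℝ => (r, x)) t h h2).hasDerivAt
  exact h3.congr_deriv (by simp)

theorem HasFDerivAt.pd_space_slice {W : ℝ × Eu 3 → F} {W' : ℝ × Eu 3 →L[ℝ] F} {x : Eu 3}
    (h : HasFDerivAt W W' (t, x)) (j : Fin 3) :
    _root_.pd j (fun y => W (t, y)) x = W' (0, EuclideanSpace.single j 1) := by
  have h2 : HasFDerivAt (fun y : Eu 3 => (t, y)) (ContinuousLinearMap.inr ℝ ℝ (Eu 3)) x :=
    hasFDerivAt_prodMk_right t x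
  exact (HasFDerivAt.comp (f := fun y : Eu 3 => (t, y)) x h h2).pd_eq j

/-- Time and space derivatives commute. -/
theorem SmoothST.hasDerivAt_pd (hU : SmoothST U)
    (hV : ∀ t, 0 < t → ∀ x, HasDerivAt (fun s => U s x) (V t x) t) (j : Fin 3) (ht : 0 < t)
    (x : Eu 3) : HasDerivAt (fun s => _root_.pd j (U s) x) (_root_.pd j (V t) x) t := by
  set W : ℝ × Eu 3 → F := fun p => U p.1 p.2 with hW
  have hc : ∀ p : ℝ × Eu 3, 0 < p.1 → ContDiffAt ℝ ∞ W p := fun p hp =>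
    ContDiffOn.contDiffAt hU (halfST_mem_nhds hp)
  have hd : ∀ s, 0 < s → ∀ y, HasFDerivAt W (fderiv ℝ W (s, y)) (s, y) := fun s hs y =>
    ((hc (s, y) hs).differentiableAt (by simp)).hasFDerivAt
  have e1 : ∀ s, 0 < s → ∀ y, _root_.pd j (U s) y
      = fderiv ℝ W (s, y) (0, EuclideanSpace.single j 1) := fun s hs y =>
    (hd s hs y).pd_space_slice j
  have e2 : V t = fun y => fderiv ℝ W (t, y) (1, 0) := funext fun y =>
    (hV t ht y).unique (hd t ht y).time_slice
  have hD : HasFDerivAt (fderiv ℝ W) (fderiv ℝ (fderiv ℝ W) (t, x)) (t, x) :=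
    (((hc (t, x) ht).fderiv_right (m := 1) (by norm_cast)).differentiableAt (by simp)).hasFDerivAt
  have hsymm := (hc (t, x) ht).isSymmSndFDerivAt (by simp; norm_cast)
  have hv := fun v : ℝ × Eu 3 =>
    (ContinuousLinearMap.apply ℝ F v).hasFDerivAt.comp (t, x) hD
  have d1 := (hv (0, EuclideanSpace.single j 1)).time_slice
  have d2 := (hv (1, 0)).pd_space_slice j
  have d3 : _root_.pd j (V t) x
      = fderiv ℝ (fderiv ℝ W) (t, x) (1, 0) (0, EuclideanSpace.single j 1) := by
    rw [e2, hsymm.eq]; exact d2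
  rw [d3]
  refine HasDerivAt.congr_of_eventuallyEq d1 ?_
  filter_upwards [Ioi_mem_nhds ht] with s hs
  exact e1 s hs x

end TimeRegularity

section Evolution

/-- A solution `(α, β)` of `φ ∂ₜ α = β`, `φ ∂ₜ β = γ`, with `γ` the Klein–Gordon force of `α`. -/
structure KGSolution (a : Fin 3 → Fin 3 → Eu 3 → ℝ) (s R : Eu 3 → ℝ) (m : ℝ) (φ : ℝ → ℝ)
    (α β γ : ℝ → Eu 3 → ℝ) : Prop where
  smooth : SmoothST α
  smooth' : SmoothST β
  smooth'' : SmoothST γ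
  continuousOn_weight : ContinuousOn φ (Ici 0)
  weight_pos : ∀ t, 0 ≤ t → 0 < φ t
  hasDerivAt : ∀ t, 0 < t → ∀ x, HasDerivAt (fun r => α r x) ((φ t)⁻¹ * β t x) t
  hasDerivAt' : ∀ t, 0 < t → ∀ x, HasDerivAt (fun r => β r x) ((φ t)⁻¹ * γ t x) t
  force_eq : ∀ t, 0 ≤ t → γ t = kgForce a s R m (α t)

variable {a : Fin 3 → Fin 3 → Eu 3 → ℝ} {s R : Eu 3 → ℝ} {Y : Fin 3 → Eu 3 → ℝ} {m σ ε S : ℝ}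
  {α β γ : ℝ → Eu 3 → ℝ} {φ : ℝ → ℝ} {k E T : ℝ}

theorem SmoothST.mult (hα : SmoothST α) (hY : ∀ l, ContDiff ℝ ∞ (Y l)) :
    SmoothST fun t => mult Y (α t) :=
  ((smoothST_of_space contDiff_const).mul (SmoothST.sum fun l _ =>
    (smoothST_of_space (hY l)).mul (hα.pd l))).add
    ((smoothST_of_space (contDiff_vdiv hY)).mul hα)

theorem continuousOn_inv_weight (hφ : ContinuousOn φ (Ici 0)) (hφ0 : ∀ t, 0 ≤ t → 0 < φ t) :
    ContinuousOn (fun t => (φ t)⁻¹) (Ici 0) :=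
  hφ.inv₀ fun t ht => (hφ0 t ht).ne'

theorem integrable_box (hφ : ContinuousOn φ (Ici 0)) (hφ0 : ∀ t, 0 ≤ t → 0 < φ t)
    {Q : ℝ → Eu 3 → ℝ} (hQ : ContinuousOn (fun p : ℝ × Eu 3 => Q p.1 p.2) halfST) (hk : 0 < k)
    (T : ℝ) :
    Integrable (Function.uncurry fun t x => (φ t)⁻¹ * (cut k 0 x ^ 2 * Q t x))
      ((volume.restrict (Ioc 0 T)).prod (volume : Measure (Eu 3))) := by
  have h0 : (volume.restrict (Ioc 0 T)).prod (volume : Measure (Eu 3))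
      = volume.restrict (Ioc 0 T ×ˢ univ) := by
    rw [Measure.volume_eq_prod, ← Measure.prod_restrict, Measure.restrict_univ]
  rw [h0]
  have hc : Continuous (cut k 0) := contDiff_cut.continuous
  have h1 : ContinuousOn (Function.uncurry fun t x => (φ t)⁻¹ * (cut k 0 x ^ 2 * Q t x))
      halfST := by
    have h2 : ContinuousOn (fun p : ℝ × Eu 3 => (φ p.1)⁻¹) halfST :=
      (continuousOn_inv_weight hφ hφ0).comp continuousOn_fst fun p hp => hp.1
    have h3 : ContinuousOn (fun p : ℝ × Eu 3 => cut k 0 p.2 ^ 2) halfST := by fun_prop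
    exact h2.mul (h3.mul hQ)
  have hK : IsCompact (Icc 0 T ×ˢ Metric.closedBall (0 : Eu 3) (2 * k)) :=
    isCompact_Icc.prod (isCompact_closedBall _ _)
  have h4 : IntegrableOn (Function.uncurry fun t x => (φ t)⁻¹ * (cut k 0 x ^ 2 * Q t x))
      (Icc 0 T ×ˢ Metric.closedBall (0 : Eu 3) (2 * k)) :=
    (h1.mono fun p hp => ⟨hp.1.1, mem_univ _⟩).integrableOn_compact hK
  refine h4.of_forall_sdiff_eq_zero (measurableSet_Ioc.prod MeasurableSet.univ) fun p hp => ?_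
  have h5 : 2 * k ≤ ‖p.2‖ := by
    by_contra hlt
    exact hp.2 ⟨Ioc_subset_Icc_self hp.1.1, by
      rw [mem_closedBall_zero_iff]; exact (not_le.1 hlt).le⟩
  have h6 : cut k 0 p.2 = 0 := cut_eq_zero_of_norm hk le_rfl h5
  simp [Function.uncurry, h6]

/-- The coercive density of the Morawetz estimate. -/
def smoothingDensity (S : ℝ) (α : Eu 3 → ℝ) (x : Eu 3) : ℝ :=
  S ^ 2 * pw S (-3 / 2) x * gradSq α x + S ^ 4 * pw S (-7 / 2) x * α x ^ 2

theorem smoothingDensity_nonneg (hS : 0 < S) (α : Eu 3 → ℝ) (x : Eu 3) :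
    0 ≤ smoothingDensity S α x := by
  have := pw_pos hS (-3 / 2) x
  have := pw_pos hS (-7 / 2) x
  have := gradSq_nonneg α x
  unfold smoothingDensity
  positivity

theorem SmoothST.smoothingDensity (hα : SmoothST α) (hS : 0 < S) :
    SmoothST fun t => smoothingDensity S (α t) := by
  have h : SmoothST fun t => gradSq (α t) := SmoothST.sum fun j _ => ContDiffOn.pow (hα.pd j) 2
  have h1 := smoothST_of_space ((contDiff_const (c := S ^ 2)).mul (contDiff_pw hS (-3 / 2)))
  have h2 := smoothST_of_space ((contDiff_const (c := S ^ 4)).mul (contDiff_pw hS (-7 / 2)))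
  exact (h1.mul h).add (h2.mul (ContDiffOn.pow hα 2))

theorem KGSolution.smoothing_box (h : KGSolution a s R m φ α β γ)
    (hE : ∀ t, 0 ≤ t → FiniteEnergy m E (α t) (β t)) (hN : NearFlat σ ε a s R)
    (hσ : σ ∈ Ioo (0 : ℝ) 1) (hε0 : 0 ≤ ε) (hε : 104000 * ε ≤ σ) (hY : IsMultiplier σ S Y)
    (hS : 1 ≤ S) (hk : 1 ≤ k) (hT : 0 ≤ T) :
    ∫ t in Ioc 0 T, ∫ x, (φ t)⁻¹ * (cut k 0 x ^ 2 * smoothingDensity S (α t) x)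
      ≤ 400 * E + (8000 * transBd + 4 * transBd ^ 2) * E * (∫ t in Ioc 0 T, (φ t)⁻¹) / k := by
  have hk0 : 0 < k := by linarith
  have hS0 : 0 < S := by linarith
  have sM := h.smooth.mult hY.smooth
  have sM' := h.smooth'.mult hY.smooth
  have sW : SmoothST fun t x => β t x * mult Y (α t) x := h.smooth'.mul sM
  set Q : ℝ → Eu 3 → ℝ := fun t x => γ t x * mult Y (α t) x + β t x * mult Y (β t) x with hQ
  have sQ : SmoothST Q := (h.smooth''.mul sM).add (h.smooth'.mul sM')
  have hder : ∀ t, 0 < t → ∀ x, HasDerivAt (fun r => β r x * mult Y (α r) x)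
      ((φ t)⁻¹ * Q t x) t := fun t ht x => by
    have d1 : HasDerivAt (fun r => mult Y (α r) x) ((φ t)⁻¹ * mult Y (β t) x) t := by
      have e := fun l => h.smooth.hasDerivAt_pd h.hasDerivAt l ht x
      have e' : ∀ l, pd l (fun x => (φ t)⁻¹ * β t x) x = (φ t)⁻¹ * pd l (β t) x := fun l =>
        pd_const_mul ((h.smooth'.contDiff ht.le).diffAt x) _ l
      have e2 := HasDerivAt.fun_sum (u := Finset.univ) fun l _ => (e l).const_mul (Y l x)
      have e3 := (e2.const_mul 2).fun_add ((h.hasDerivAt t ht x).const_mul (vdiv Y x))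
      refine e3.congr_deriv ?_
      simp only [e', mult, mul_add, Finset.mul_sum]
      congr 1
      · exact Finset.sum_congr rfl fun l _ => by ring
      · ring
    refine ((h.hasDerivAt' t ht x).fun_mul d1).congr_deriv ?_
    simp only [hQ]; ring
  have iQ := integrable_box h.continuousOn_weight h.weight_pos sQ.continuousOn hk0 T
  have iD := integrable_box h.continuousOn_weight h.weight_pos
    (Q := fun t => smoothingDensity S (α t)) (h.smooth.smoothingDensity hS0).continuousOn hk0 T
  have cφ := continuousOn_inv_weight h.continuousOn_weight h.weight_pos
  have iφ : IntegrableOn (fun t => (φ t)⁻¹) (Ioc 0 T) :=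
    ((cφ.mono fun t ht => ht.1).integrableOn_compact isCompact_Icc).mono_set Ioc_subset_Icc_self
  have ftc : ∀ x, ∫ t in Ioc 0 T, (φ t)⁻¹ * (cut k 0 x ^ 2 * Q t x)
      = cut k 0 x ^ 2 * (β T x * mult Y (α T) x) - cut k 0 x ^ 2 * (β 0 x * mult Y (α 0) x) :=
    fun x => by
    have c1 : ContinuousOn (fun t => (φ t)⁻¹ * Q t x) (Icc 0 T) :=
      (cφ.mul (sQ.continuousOn_time x)).mono fun t ht => ht.1
    have := intervalIntegral.integral_eq_sub_of_hasDerivAt_of_le hT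
      ((sW.continuousOn_time x).mono fun t ht => ht.1) (fun t ht => hder t ht.1 x)
      (c1.intervalIntegrable_of_Icc hT)
    rw [intervalIntegral.integral_of_le hT] at this
    rw [← mul_sub, ← this, ← integral_const_mul]
    congr 1; funext t; ring
  have swap := integral_integral_swap iQ
  simp only [ftc] at swap
  have c0 : ∀ t, 0 ≤ t → Continuous fun x => β t x * mult Y (α t) x := fun t ht =>
    (sW.contDiff ht).continuous
  rw [integral_sub (integrable_cut_mul hk0 (c0 T hT)) (integrable_cut_mul hk0 (c0 0 le_rfl))] at swap
  have m1 := (abs_le.1 ((hE T hT).abs_momentum_le hY (k := k))).1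
  have m2 := (abs_le.1 ((hE 0 le_rfl).abs_momentum_le hY (k := k))).2
  have iQ' := iQ.integral_prod_left
  have iD' := iD.integral_prod_left
  simp only [Function.uncurry] at iQ' iD'
  set C := (8000 * transBd + 4 * transBd ^ 2) / k * E with hC
  have key : ∫ t in Ioc 0 T, ∫ x, (φ t)⁻¹ * (cut k 0 x ^ 2 * Q t x)
      ≤ ∫ t in Ioc 0 T, (C * (φ t)⁻¹
        - ∫ x, (φ t)⁻¹ * (cut k 0 x ^ 2 * smoothingDensity S (α t) x)) := by
    refine setIntegral_mono_on iQ' ((iφ.const_mul C).sub iD') measurableSet_Ioc fun t ht => ?_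
    have h1 := (hE t ht.1.le).momentum_production_le hN hσ hε0 hε hY hS hk
    rw [integral_const_mul, integral_const_mul, hQ]
    simp only [h.force_eq t ht.1.le]
    have h2 := mul_le_mul_of_nonneg_left h1 (inv_pos.2 (h.weight_pos t ht.1.le)).le
    refine h2.trans (le_of_eq ?_)
    simp only [smoothingDensity]
    ring
  rw [integral_sub (iφ.const_mul C) iD', integral_const_mul] at key
  have : (8000 * transBd + 4 * transBd ^ 2) * E * (∫ t in Ioc 0 T, (φ t)⁻¹) / k
      = C * ∫ t in Ioc 0 T, (φ t)⁻¹ := by rw [hC]; ring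
  rw [this]
  linarith

end Evolution

section SpaceTime

variable {a : Fin 3 → Fin 3 → Eu 3 → ℝ} {s R : Eu 3 → ℝ} {Y : Fin 3 → Eu 3 → ℝ} {m σ ε S : ℝ}
  {α β γ : ℝ → Eu 3 → ℝ} {φ : ℝ → ℝ} {k E T : ℝ}

/-- Lebesgue measure on positive times and all of space. -/
def volST : Measure (ℝ × Eu 3) := (volume.restrict (Ioi 0)).prod volume

instance : SFinite volST := by unfold volST; infer_instance

theorem volST_eq : volST = volume.restrict (Ioi (0 : ℝ) ×ˢ (univ : Set (Eu 3))) := by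
  rw [volST, Measure.volume_eq_prod, ← Measure.prod_restrict, Measure.restrict_univ]

theorem aemeasurable_volST {F : Type*} [TopologicalSpace F] [MeasurableSpace F] [BorelSpace F]
    [TopologicalSpace.PseudoMetrizableSpace F]
    {f : ℝ × Eu 3 → F} (hf : ContinuousOn f halfST) : AEMeasurable f volST := by
  rw [volST_eq]
  exact (hf.mono fun p hp => ⟨le_of_lt (mem_Ioi.1 hp.1), hp.2⟩).aemeasurable
    (measurableSet_Ioi.prod MeasurableSet.univ)

theorem KGSolution.smoothing_slab (h : KGSolution a s R m φ α β γ)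
    (hE : ∀ t, 0 ≤ t → FiniteEnergy m E (α t) (β t)) (hN : NearFlat σ ε a s R)
    (hσ : σ ∈ Ioo (0 : ℝ) 1) (hε0 : 0 ≤ ε) (hε : 104000 * ε ≤ σ) (hY : IsMultiplier σ S Y)
    (hS : 1 ≤ S) (hT : 0 ≤ T) :
    ∫⁻ p in Ioc 0 T ×ˢ (univ : Set (Eu 3)),
      ENNReal.ofReal ((φ p.1)⁻¹ * smoothingDensity S (α p.1) p.2) ≤ ENNReal.ofReal (400 * E) := by
  have hS0 : 0 < S := by linarith
  have h0 : (volume.restrict (Ioc 0 T)).prod (volume : Measure (Eu 3))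
      = volume.restrict (Ioc 0 T ×ˢ univ) := by
    rw [Measure.volume_eq_prod, ← Measure.prod_restrict, Measure.restrict_univ]
  have hae : ∀ᵐ p ∂((volume.restrict (Ioc 0 T)).prod (volume : Measure (Eu 3))), 0 < p.1 := by
    rw [h0]
    filter_upwards [ae_restrict_mem (measurableSet_Ioc.prod MeasurableSet.univ)] with p hp
    exact hp.1.1
  have hpos : ∀ p : ℝ × Eu 3, 0 < p.1 → 0 ≤ (φ p.1)⁻¹ * smoothingDensity S (α p.1) p.2 :=
    fun p hp => mul_nonneg (inv_nonneg.2 (h.weight_pos _ hp.le).le) (smoothingDensity_nonneg hS0 _ _)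
  have hpos' : ∀ (k : ℝ) (p : ℝ × Eu 3), 0 < p.1 →
      0 ≤ (φ p.1)⁻¹ * (cut k 0 p.2 ^ 2 * smoothingDensity S (α p.1) p.2) :=
    fun k p hp => mul_nonneg (inv_nonneg.2 (h.weight_pos _ hp.le).le)
      (mul_nonneg (sq_nonneg _) (smoothingDensity_nonneg hS0 _ _))
  have iD := fun n : ℕ => integrable_box h.continuousOn_weight h.weight_pos
    (Q := fun t => smoothingDensity S (α t)) (h.smooth.smoothingDensity hS0).continuousOn
    (k := (n : ℝ) + 1) (by positivity) T
  have key := integrable_and_integral_le_of_tendsto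
    (F := fun (n : ℕ) (p : ℝ × Eu 3) =>
      |(φ p.1)⁻¹ * (cut ((n : ℝ) + 1) 0 p.2 ^ 2 * smoothingDensity S (α p.1) p.2)|)
    (g := fun p : ℝ × Eu 3 => |(φ p.1)⁻¹ * smoothingDensity S (α p.1) p.2|)
    (B := fun n : ℕ => 400 * E + (8000 * transBd + 4 * transBd ^ 2) * E *
      (∫ t in Ioc 0 T, (φ t)⁻¹) * (1 / ((n : ℝ) + 1))) (b := 400 * E)
    (fun n => (iD n).abs) (fun _ _ => abs_nonneg _)
    (ae_of_all _ fun p => ?_) (fun n => ?_) ?_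
  · rw [← h0]
    calc _ = ∫⁻ p, ENNReal.ofReal |(φ p.1)⁻¹ * smoothingDensity S (α p.1) p.2|
          ∂((volume.restrict (Ioc 0 T)).prod (volume : Measure (Eu 3))) := by
          refine lintegral_congr_ae ?_
          filter_upwards [hae] with p hp
          rw [abs_of_nonneg (hpos p hp)]
      _ ≤ _ := by
          rw [← ofReal_integral_eq_lintegral_ofReal key.1 (ae_of_all _ fun _ => abs_nonneg _)]
          exact ENNReal.ofReal_le_ofReal key.2
  · refine Tendsto.congr' (f₁ := fun _ => |(φ p.1)⁻¹ * smoothingDensity S (α p.1) p.2|) ?_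
      tendsto_const_nhds
    have := (tendsto_natCast_atTop_atTop (R := ℝ)).atTop_add (tendsto_const_nhds (x := (1 : ℝ)))
    filter_upwards [this.eventually (eventually_cut_eq_one 0 p.2)] with n hn
    rw [hn]; simp
  · refine le_trans (le_of_eq ?_) ((h.smoothing_box hE hN hσ hε0 hε hY hS (k := (n : ℝ) + 1)
      (by linarith [n.cast_nonneg (α := ℝ)]) hT).trans (le_of_eq (by ring)))
    rw [integral_integral (iD n)]
    refine integral_congr_ae ?_
    filter_upwards [hae] with p hp
    exact abs_of_nonneg (hpos' _ p hp)
  · have := (tendsto_one_div_add_atTop_nhds_zero_nat (𝕜 := ℝ)).const_mul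
      ((8000 * transBd + 4 * transBd ^ 2) * E * (∫ t in Ioc 0 T, (φ t)⁻¹))
    simpa using this.const_add (400 * E)

/-- **Smoothing estimate** for Klein–Gordon solutions of uniformly bounded energy. -/
theorem KGSolution.smoothing (h : KGSolution a s R m φ α β γ)
    (hE : ∀ t, 0 ≤ t → FiniteEnergy m E (α t) (β t)) (hN : NearFlat σ ε a s R)
    (hσ : σ ∈ Ioo (0 : ℝ) 1) (hε0 : 0 ≤ ε) (hε : 104000 * ε ≤ σ) (hS : 1 ≤ S) :
    ∫⁻ p, ENNReal.ofReal ((φ p.1)⁻¹ * smoothingDensity S (α p.1) p.2) ∂volST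
      ≤ ENNReal.ofReal (400 * E) := by
  have h1 : Ioi (0 : ℝ) ×ˢ (univ : Set (Eu 3)) = ⋃ n : ℕ, Ioc (0 : ℝ) n ×ˢ univ := by
    ext p
    simp only [mem_prod, mem_Ioi, mem_univ, and_true, mem_iUnion, mem_Ioc]
    exact ⟨fun hp => (exists_nat_ge p.1).imp fun n hn => ⟨hp, hn⟩, fun ⟨_, hp⟩ => hp.1⟩
  rw [volST_eq, h1, setLIntegral_iUnion_of_directed]
  · exact iSup_le fun n => h.smoothing_slab hE hN hσ hε0 hε (isMultiplier_morawetz hσ hS) hS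
      n.cast_nonneg
  · exact Monotone.directed_le fun i j hij => prod_mono (Ioc_subset_Ioc_right (by exact_mod_cast hij))
      subset_rfl

end SpaceTime

section Trace

/-- Integration in polar coordinates on `ℝ³`. -/
theorem lintegral_polar {F : Eu 3 → ENNReal} (hF : Measurable F) :
    ∫⁻ θ : Metric.sphere (0 : Eu 3) 1, (∫⁻ r in Ioi (0 : ℝ),
      ENNReal.ofReal (r ^ 2) * F (r • (θ : Eu 3))) ∂(volume.toSphere) = ∫⁻ x, F x := by
  have hm := (volume : Measure (Eu 3)).measurePreserving_homeomorphUnitSphereProd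
  have h1 := hm.lintegral_comp_emb (Homeomorph.measurableEmbedding _)
    fun p => F ((p.2 : ℝ) • (p.1 : Eu 3))
  have h2 : ∫⁻ x : ({0}ᶜ : Set (Eu 3)), F x ∂(Measure.comap (↑) (volume : Measure (Eu 3)))
      = ∫⁻ x, F x := by
    rw [lintegral_subtype_comap (measurableSet_singleton _).compl, restrict_compl_singleton]
  have h3 : ∀ x : ({0}ᶜ : Set (Eu 3)), (((homeomorphUnitSphereProd (Eu 3)) x).2 : ℝ) •
      (((homeomorphUnitSphereProd (Eu 3)) x).1 : Eu 3) = x := fun x => by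
    have hx : ‖(x : Eu 3)‖ ≠ 0 := norm_ne_zero_iff.2 x.2
    rw [homeomorphUnitSphereProd_apply_fst_coe, homeomorphUnitSphereProd_apply_snd_coe, smul_smul,
      mul_inv_cancel₀ hx, one_smul]
  simp only [h3] at h1
  rw [← h2, h1, lintegral_prod _ (by fun_prop)]
  refine lintegral_congr fun θ => ?_
  have h4 : Module.finrank ℝ (Eu 3) - 1 = 2 := by simp
  rw [h4, Measure.volumeIoiPow, lintegral_withDensity_eq_lintegral_mul _ (by fun_prop)
    (by fun_prop)]
  exact (lintegral_subtype_comap (measurableSet_Ioi (a := (0 : ℝ)))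
    (fun r : ℝ => ENNReal.ofReal (r ^ 2) * F (r • (θ : Eu 3)))).symm

theorem hasDerivAt_ray {v : Eu 3 → ℝ} (hv : ContDiff ℝ ∞ v) (θ : Eu 3) (r : ℝ) :
    HasDerivAt (fun r : ℝ => v (r • θ)) (∑ j, θ j * pd j v (r • θ)) r := by
  have h1 := (hv.diffAt (r • θ)).hasFDerivAt.comp_hasDerivAt r
    ((hasDerivAt_id r).smul_const θ)
  refine h1.congr_deriv ?_
  have h2 : θ = ∑ j, θ j • (EuclideanSpace.single j 1 : Eu 3) := by
    ext i; simp [Fin.sum_univ_three]; fin_cases i <;> simp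
  rw [one_smul]
  calc fderiv ℝ v (r • θ) θ
      = fderiv ℝ v (r • θ) (∑ j, θ j • (EuclideanSpace.single j 1 : Eu 3)) := congrArg _ h2
    _ = _ := by rw [map_sum]; simp [pd]

theorem smoothingDensity_lower {S : ℝ} (hS : 0 < S) {v : Eu 3 → ℝ} {x : Eu 3} (hx : ‖x‖ ≤ 2 * S) :
    2 * v x ^ 2 + 4 * S ^ 2 * gradSq v x ≤ 800 * S ^ 3 * smoothingDensity S v x := by
  have hb := pw_base_pos hS x
  have h5 : S ^ 2 + ‖x‖ ^ 2 ≤ 5 * S ^ 2 := by nlinarith [norm_nonneg x]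
  have hg := gradSq_nonneg v x
  have key : ∀ n : ℕ, S ^ (2 * n + 1) * pw S (-(2 * n + 1) / 2) x * (5 ^ n * 3) ≥ 1 := fun n => by
    have e1 : pw S (-(2 * n + 1) / 2) x ≥ (5 * S ^ 2) ^ (-(2 * n + 1) / 2 : ℝ) := by
      rw [pw]
      refine rpow_le_rpow_of_nonpos hb h5 ?_
      have : (0 : ℝ) ≤ n := n.cast_nonneg
      linarith
    have e2 : (5 * S ^ 2) ^ (-(2 * n + 1) / 2 : ℝ) = (√5 ^ (2 * n + 1) * S ^ (2 * n + 1))⁻¹ := by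
      have : (5 * S ^ 2) = (√5 * S) ^ 2 := by rw [mul_pow]; norm_num
      rw [this, ← mul_pow, ← rpow_natCast (√5 * S) 2, ← rpow_mul (by positivity),
        ← rpow_natCast, ← rpow_neg (by positivity)]
      congr 1; push_cast; ring
    have e3 : √5 ^ (2 * n + 1) ≤ 5 ^ n * 3 := by
      rw [pow_succ, pow_mul, sq_sqrt (by norm_num)]
      gcongr
      exact sqrt_le_iff.2 ⟨by norm_num, by norm_num⟩
    have h0 : 0 < √5 ^ (2 * n + 1) * S ^ (2 * n + 1) := by positivity
    calc (1 : ℝ) = √5 ^ (2 * n + 1) * S ^ (2 * n + 1) * (√5 ^ (2 * n + 1) * S ^ (2 * n + 1))⁻¹ :=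
          (mul_inv_cancel₀ h0.ne').symm
      _ ≤ (5 ^ n * 3) * S ^ (2 * n + 1) * pw S (-(2 * n + 1) / 2) x := by
          rw [← e2]; gcongr
      _ = _ := by ring
  have k1 := key 1
  have k3 := key 3
  rw [show (-(2 * ((1 : ℕ) : ℝ) + 1) / 2 : ℝ) = -3 / 2 by norm_num] at k1
  rw [show (-(2 * ((3 : ℕ) : ℝ) + 1) / 2 : ℝ) = -7 / 2 by norm_num] at k3
  unfold smoothingDensity
  have m1 := mul_le_mul_of_nonneg_left k1 (show 0 ≤ 4 * S ^ 2 * gradSq v x by positivity)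
  have m3 := mul_le_mul_of_nonneg_left k3 (show 0 ≤ v x ^ 2 by positivity)
  have n1 : 0 ≤ S ^ 5 * pw S (-3 / 2) x * gradSq v x := by
    have := pw_pos hS (-3 / 2) x
    positivity
  have n3 : 0 ≤ S ^ 7 * pw S (-7 / 2) x * v x ^ 2 := by
    have := pw_pos hS (-7 / 2) x
    positivity
  linarith

theorem trace_ray {R S : ℝ} (hR : 0 < R) (hRS : R ≤ S) {v : Eu 3 → ℝ} (hv : ContDiff ℝ ∞ v)
    {θ : Eu 3} (he : ‖θ‖ = 1) :
    ENNReal.ofReal (R ^ 2 * v (R • θ) ^ 2) ≤ ENNReal.ofReal (800 * S ^ 2) *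
      ∫⁻ r in Ioi (0 : ℝ), ENNReal.ofReal (r ^ 2) *
        ENNReal.ofReal (smoothingDensity S v (r • θ)) := by
  have hS : 0 < S := by linarith
  set f' : ℝ → ℝ := fun r => (4 * S * r - 3 * r ^ 2) * v (r • θ) ^ 2
    + (2 * S * r ^ 2 - r ^ 3) * (2 * v (r • θ) * ∑ j, θ j * pd j v (r • θ)) with hf'
  have hd : ∀ r, HasDerivAt (fun r => (2 * S * r ^ 2 - r ^ 3) * v (r • θ) ^ 2) (f' r) r :=
    fun r => by
      have h1 : HasDerivAt (fun r : ℝ => 2 * S * r ^ 2 - r ^ 3) (4 * S * r - 3 * r ^ 2) r := by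
        refine (((hasDerivAt_pow 2 r).const_mul (2 * S)).fun_sub (hasDerivAt_pow 3 r)).congr_deriv ?_
        norm_num; ring
      refine (h1.fun_mul ((hasDerivAt_ray hv θ r).fun_pow 2)).congr_deriv ?_
      rw [hf']; norm_num
  have cr : Continuous fun r : ℝ => r • θ := by fun_prop
  have cv : Continuous fun r : ℝ => v (r • θ) := hv.continuous.comp cr
  have cp : ∀ j, Continuous fun r : ℝ => pd j v (r • θ) := fun j => (hv.pd j).continuous.comp cr
  have cf' : Continuous f' := by fun_prop
  have cD : Continuous fun r : ℝ => smoothingDensity S v (r • θ) := by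
    have e1 : Continuous fun r : ℝ => pw S (-3 / 2) (r • θ) :=
      (contDiff_pw hS _).continuous.comp cr
    have e2 : Continuous fun r : ℝ => pw S (-7 / 2) (r • θ) :=
      (contDiff_pw hS _).continuous.comp cr
    unfold smoothingDensity gradSq
    fun_prop
  have h2S : R ≤ 2 * S := by linarith
  have ftc := intervalIntegral.integral_eq_sub_of_hasDerivAt (a := R) (b := 2 * S)
    (fun r _ => hd r) (cf'.intervalIntegrable _ _)
  have hpt : ∀ r ∈ Icc R (2 * S), - f' r ≤ r ^ 2 * (800 * S ^ 3 * smoothingDensity S v (r • θ)) :=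
    fun r hr => by
      have hr0 : 0 < r := hR.trans_le hr.1
      have hx : ‖r • θ‖ ≤ 2 * S := by rw [norm_smul, he, mul_one, Real.norm_of_nonneg hr0.le]; exact hr.2
      have h1 := smoothingDensity_lower hS (v := v) hx
      have h3 : (∑ j, θ j * pd j v (r • θ)) ^ 2 ≤ gradSq v (r • θ) := by
        have := Finset.sum_mul_sq_le_sq_mul_sq Finset.univ (fun j => θ j)
          fun j => pd j v (r • θ)
        have e : ∑ j, θ j ^ 2 = 1 := by rw [← Eu.norm_sq_eq, he]; norm_num
        rwa [e, one_mul] at this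
      set q := ∑ j, θ j * pd j v (r • θ)
      set w := v (r • θ)
      have h4 : - f' r = r ^ 2 * (w ^ 2 - 2 * (2 * S - r) * w * q) - 2 * r * (2 * S - r) * w ^ 2 := by
        rw [hf']; ring
      have h5 : 0 ≤ 2 * r * (2 * S - r) * w ^ 2 := by
        have : 0 ≤ 2 * S - r := by linarith [hr.2]
        positivity
      have h6 : w ^ 2 - 2 * (2 * S - r) * w * q ≤ 2 * w ^ 2 + 4 * S ^ 2 * gradSq v (r • θ) := by
        have g1 : (2 * S - r) ^ 2 ≤ 4 * S ^ 2 := by nlinarith [hr.2]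
        have g2 : (2 * S - r) ^ 2 * q ^ 2 ≤ 4 * S ^ 2 * gradSq v (r • θ) :=
          mul_le_mul g1 h3 (sq_nonneg _) (by positivity)
        nlinarith [sq_nonneg (w + (2 * S - r) * q)]
      have h7 := mul_le_mul_of_nonneg_left (h6.trans h1) (sq_nonneg r)
      linarith
  have hint : R ^ 2 * v (R • θ) ^ 2 ≤
      ∫ r in R..(2 * S), 800 * S ^ 2 * (r ^ 2 * smoothingDensity S v (r • θ)) := by
    have h1 : ∫ r in R..(2 * S), - f' r ≤
        ∫ r in R..(2 * S), r ^ 2 * (800 * S ^ 3 * smoothingDensity S v (r • θ)) :=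
      intervalIntegral.integral_mono_on h2S (cf'.neg.intervalIntegrable _ _)
        (Continuous.intervalIntegrable (by fun_prop) _ _) hpt
    rw [intervalIntegral.integral_neg, ftc] at h1
    have h2 : ∫ r in R..(2 * S), r ^ 2 * (800 * S ^ 3 * smoothingDensity S v (r • θ))
        = S * ∫ r in R..(2 * S), 800 * S ^ 2 * (r ^ 2 * smoothingDensity S v (r • θ)) := by
      rw [← intervalIntegral.integral_const_mul]
      congr 1; funext r; ring
    rw [h2] at h1
    have h3 : S * (R ^ 2 * v (R • θ) ^ 2) ≤ (2 * S * R ^ 2 - R ^ 3) * v (R • θ) ^ 2 := by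
      have : 0 ≤ (S - R) * (R ^ 2 * v (R • θ) ^ 2) :=
        mul_nonneg (by linarith) (by positivity)
      nlinarith
    have h4 : (2 * S * (2 * S) ^ 2 - (2 * S) ^ 3) * v ((2 * S) • θ) ^ 2 = 0 := by ring
    rw [h4] at h1
    refine le_of_mul_le_mul_left ?_ hS
    linarith
  rw [intervalIntegral.integral_of_le h2S, integral_const_mul] at hint
  have hnn : ∀ r : ℝ, 0 ≤ r ^ 2 * smoothingDensity S v (r • θ) := fun r =>
    mul_nonneg (sq_nonneg _) (smoothingDensity_nonneg hS _ _)
  refine (ENNReal.ofReal_le_ofReal hint).trans ?_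
  rw [ENNReal.ofReal_mul (by positivity), ofReal_integral_eq_lintegral_ofReal
    ((Continuous.integrableOn_Icc (by fun_prop)).mono_set Ioc_subset_Icc_self) (ae_of_all _ hnn)]
  refine mul_le_mul_right ?_ _
  calc _ = ∫⁻ r in Ioc R (2 * S), ENNReal.ofReal (r ^ 2) *
        ENNReal.ofReal (smoothingDensity S v (r • θ)) :=
        lintegral_congr fun r => ENNReal.ofReal_mul (sq_nonneg _)
    _ ≤ _ := lintegral_mono_set fun r hr => mem_Ioi.2 (hR.trans hr.1)

/-- Trace inequality on spheres. -/
theorem trace_sphere {R S : ℝ} (hR : 0 < R) (hRS : R ≤ S) {v : Eu 3 → ℝ} (hv : ContDiff ℝ ∞ v) :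
    ∫⁻ θ : Metric.sphere (0 : Eu 3) 1, ENNReal.ofReal (R ^ 2 * v (R • (θ : Eu 3)) ^ 2)
        ∂(volume.toSphere)
      ≤ ENNReal.ofReal (800 * S ^ 2) * ∫⁻ x, ENNReal.ofReal (smoothingDensity S v x) := by
  have hS : 0 < S := by linarith
  have cD : Continuous (smoothingDensity S v) := by
    have e1 : Continuous (pw S (-3 / 2)) := (contDiff_pw hS _).continuous
    have e2 : Continuous (pw S (-7 / 2)) := (contDiff_pw hS _).continuous
    have e3 : ∀ j, Continuous fun x => pd j v x := fun j => (hv.pd j).continuous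
    have := hv.continuous
    unfold smoothingDensity gradSq
    fun_prop
  rw [← lintegral_polar (by fun_prop), ← lintegral_const_mul' _ _ ENNReal.ofReal_ne_top]
  exact lintegral_mono fun θ : Metric.sphere (0 : Eu 3) 1 => trace_ray hR hRS hv (by simp)

end Trace

section Suprema

theorem ofReal_integral_le_lintegral {X : Type*} [MeasurableSpace X] {μ : Measure X} {f : X → ℝ}
    (hf : 0 ≤ᵐ[μ] f) : ENNReal.ofReal (∫ x, f x ∂μ) ≤ ∫⁻ x, ENNReal.ofReal (f x) ∂μ := by
  by_cases h : Integrable f μ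
  · exact (ofReal_integral_eq_lintegral_ofReal h hf).le
  · rw [integral_undef h]; simp

variable {ι : Type*} [Fintype ι] {α : ι → ℝ → Eu 3 → ℝ} {φ : ℝ → ℝ} {R S b : ℝ}

theorem aemeasurable_smoothingDensity {α : ℝ → Eu 3 → ℝ} (hα : SmoothST α)
    (hφ : ContinuousOn φ (Ici 0)) (hφ0 : ∀ t, 0 ≤ t → 0 < φ t) (hS : 0 < S) :
    AEMeasurable (fun p : ℝ × Eu 3 =>
      ENNReal.ofReal ((φ p.1)⁻¹ * smoothingDensity S (α p.1) p.2)) volST := by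
  have h2 : ContinuousOn (fun p : ℝ × Eu 3 => (φ p.1)⁻¹) halfST :=
    (continuousOn_inv_weight hφ hφ0).comp continuousOn_fst fun p hp => hp.1
  exact (aemeasurable_volST (h2.mul (hα.smoothingDensity hS).continuousOn)).ennreal_ofReal

theorem lintegral_sphere_le (hα : ∀ c, SmoothST (α c))
    (hφ : ContinuousOn φ (Ici 0)) (hφ0 : ∀ t, 0 ≤ t → 0 < φ t) (hR : 0 < R) (hRS : R ≤ S)
    (hb : ∀ c, ∫⁻ p, ENNReal.ofReal ((φ p.1)⁻¹ * smoothingDensity S (α c p.1) p.2) ∂volST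
      ≤ ENNReal.ofReal b) :
    ∫⁻ θ : Metric.sphere (0 : Eu 3) 1, (∫⁻ t in Ioi (0 : ℝ), ENNReal.ofReal
      ((φ t)⁻¹ * ∑ c, R ^ 2 * α c t (R • (θ : Eu 3)) ^ 2)) ∂(volume.toSphere)
      ≤ Fintype.card ι * (ENNReal.ofReal (800 * S ^ 2) * ENNReal.ofReal b) := by
  have hS : 0 < S := by linarith
  rw [lintegral_lintegral_swap]
  swap
  · have h0 : ((volume : Measure (Eu 3)).toSphere).prod (volume.restrict (Ioi (0 : ℝ)))
        = (((volume : Measure (Eu 3)).toSphere).prod volume).restrict (univ ×ˢ Ioi (0 : ℝ)) := by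
      rw [← Measure.prod_restrict, Measure.restrict_univ]
    rw [h0]
    refine (ContinuousOn.aemeasurable ?_ (MeasurableSet.univ.prod measurableSet_Ioi)).ennreal_ofReal
    have h2 : ContinuousOn (fun p : Metric.sphere (0 : Eu 3) 1 × ℝ => (φ p.2)⁻¹)
        (univ ×ˢ Ioi (0 : ℝ)) :=
      (continuousOn_inv_weight hφ hφ0).comp continuousOn_snd fun p hp => le_of_lt (mem_Ioi.1 hp.2)
    refine h2.mul (continuousOn_finsetSum _ fun c _ => continuousOn_const.mul (ContinuousOn.pow ?_ 2))
    exact (hα c).continuousOn.comp (f := fun p : Metric.sphere (0 : Eu 3) 1 × ℝ =>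
      (p.2, R • (p.1 : Eu 3))) (by fun_prop) fun p hp => ⟨le_of_lt (mem_Ioi.1 hp.2), mem_univ _⟩
  have step : ∀ t ∈ Ioi (0 : ℝ), ∫⁻ θ : Metric.sphere (0 : Eu 3) 1, ENNReal.ofReal
      ((φ t)⁻¹ * ∑ c, R ^ 2 * α c t (R • (θ : Eu 3)) ^ 2) ∂(volume.toSphere)
      ≤ ∑ c, ENNReal.ofReal (800 * S ^ 2) *
        ∫⁻ x, ENNReal.ofReal ((φ t)⁻¹ * smoothingDensity S (α c t) x) := fun t ht => by
    have ht0 : 0 ≤ t := le_of_lt (mem_Ioi.1 ht)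
    have hi : 0 ≤ (φ t)⁻¹ := inv_nonneg.2 (hφ0 t ht0).le
    have cα : ∀ c, Continuous (α c t) := fun c => ((hα c).contDiff ht0).continuous
    calc _ = ∫⁻ θ : Metric.sphere (0 : Eu 3) 1, ∑ c, ENNReal.ofReal (φ t)⁻¹ *
          ENNReal.ofReal (R ^ 2 * α c t (R • (θ : Eu 3)) ^ 2) ∂(volume.toSphere) := by
          refine lintegral_congr fun θ => ?_
          rw [ENNReal.ofReal_mul hi, ENNReal.ofReal_sum_of_nonneg fun c _ => by positivity,
            Finset.mul_sum]
      _ = ∑ c, ENNReal.ofReal (φ t)⁻¹ * ∫⁻ θ : Metric.sphere (0 : Eu 3) 1,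
          ENNReal.ofReal (R ^ 2 * α c t (R • (θ : Eu 3)) ^ 2) ∂(volume.toSphere) := by
          rw [lintegral_finsetSum _ fun c _ => by
            have := cα c
            fun_prop]
          exact Finset.sum_congr rfl fun c _ => lintegral_const_mul' _ _ ENNReal.ofReal_ne_top
      _ ≤ _ := by
          refine Finset.sum_le_sum fun c _ => ?_
          have e := trace_sphere hR hRS ((hα c).contDiff ht0)
          simp only [ENNReal.ofReal_mul hi]
          rw [lintegral_const_mul' _ _ ENNReal.ofReal_ne_top]
          calc _ ≤ _ := mul_le_mul_right e _
            _ = _ := by ring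
  calc _ ≤ ∫⁻ t in Ioi (0 : ℝ), ∑ c, ENNReal.ofReal (800 * S ^ 2) *
        ∫⁻ x, ENNReal.ofReal ((φ t)⁻¹ * smoothingDensity S (α c t) x) :=
        setLIntegral_mono' measurableSet_Ioi step
    _ = ∑ c, ENNReal.ofReal (800 * S ^ 2) *
        ∫⁻ p, ENNReal.ofReal ((φ p.1)⁻¹ * smoothingDensity S (α c p.1) p.2) ∂volST := by
        rw [lintegral_finsetSum' _ fun c _ => (AEMeasurable.const_mul
          (aemeasurable_smoothingDensity (hα c) hφ hφ0 hS).lintegral_prod_right' _)]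
        refine Finset.sum_congr rfl fun c _ => ?_
        rw [lintegral_const_mul' _ _ ENNReal.ofReal_ne_top, volST, lintegral_prod]
        exact aemeasurable_smoothingDensity (hα c) hφ hφ0 hS
    _ ≤ ∑ _c : ι, ENNReal.ofReal (800 * S ^ 2) * ENNReal.ofReal b :=
        Finset.sum_le_sum fun c _ => mul_le_mul_right (hb c) _
    _ = _ := by rw [Finset.sum_const, nsmul_eq_mul, Finset.card_univ]

theorem lintegral_ball_le (hα : ∀ c, SmoothST (α c))
    (hφ : ContinuousOn φ (Ici 0)) (hφ0 : ∀ t, 0 ≤ t → 0 < φ t) (hR : 0 < R) (hRS : R ≤ S)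
    (hb : ∀ c, ∫⁻ p, ENNReal.ofReal ((φ p.1)⁻¹ * smoothingDensity S (α c p.1) p.2) ∂volST
      ≤ ENNReal.ofReal b) :
    ∫⁻ x in Metric.ball (0 : Eu 3) R, (∫⁻ t in Ioi (0 : ℝ), ENNReal.ofReal
      ((φ t)⁻¹ * ∑ c, gradSq (α c t) x))
      ≤ Fintype.card ι * (ENNReal.ofReal (200 * S) * ENNReal.ofReal b) := by
  have hS : 0 < S := by linarith
  have step : ∀ x ∈ Metric.ball (0 : Eu 3) R, ∀ t ∈ Ioi (0 : ℝ),
      ENNReal.ofReal ((φ t)⁻¹ * ∑ c, gradSq (α c t) x) ≤ ∑ c, ENNReal.ofReal (200 * S) *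
        ENNReal.ofReal ((φ t)⁻¹ * smoothingDensity S (α c t) x) := fun x hx t ht => by
    have hi : 0 ≤ (φ t)⁻¹ := inv_nonneg.2 (hφ0 t (le_of_lt (mem_Ioi.1 ht))).le
    rw [Finset.mul_sum, ENNReal.ofReal_sum_of_nonneg fun c _ =>
      mul_nonneg hi (gradSq_nonneg _ _)]
    refine Finset.sum_le_sum fun c _ => ?_
    rw [← ENNReal.ofReal_mul (by positivity)]
    refine ENNReal.ofReal_le_ofReal ?_
    have h1 := smoothingDensity_lower hS (v := α c t) (x := x)
      (by linarith [mem_ball_zero_iff.1 hx])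
    have h2 : S ^ 2 * gradSq (α c t) x ≤ S ^ 2 * (200 * S * smoothingDensity S (α c t) x) := by
      nlinarith [sq_nonneg (α c t x)]
    have h3 := mul_le_mul_of_nonneg_left (le_of_mul_le_mul_left h2 (by positivity)) hi
    linarith
  calc _ ≤ ∫⁻ x in Metric.ball (0 : Eu 3) R, ∑ c, ENNReal.ofReal (200 * S) *
        ∫⁻ t in Ioi (0 : ℝ), ENNReal.ofReal ((φ t)⁻¹ * smoothingDensity S (α c t) x) := by
        refine setLIntegral_mono' measurableSet_ball fun x hx => ?_
        refine (setLIntegral_mono' measurableSet_Ioi (step x hx)).trans (le_of_eq ?_)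
        have cφ : ContinuousOn (fun t => (φ t)⁻¹) (Ioi 0) :=
          (continuousOn_inv_weight hφ hφ0).mono Ioi_subset_Ici_self
        have hm : ∀ c, AEMeasurable (fun t => ENNReal.ofReal (200 * S) *
            ENNReal.ofReal ((φ t)⁻¹ * smoothingDensity S (α c t) x)) (volume.restrict (Ioi 0)) :=
          fun c => (AEMeasurable.ennreal_ofReal
            ((cφ.mul ((((hα c).smoothingDensity hS).continuousOn_time x).mono
              Ioi_subset_Ici_self)).aemeasurable measurableSet_Ioi)).const_mul _
        rw [lintegral_finsetSum' _ fun c _ => hm c]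
        exact Finset.sum_congr rfl fun c _ => lintegral_const_mul' _ _ ENNReal.ofReal_ne_top
    _ ≤ ∫⁻ x, ∑ c, ENNReal.ofReal (200 * S) *
        ∫⁻ t in Ioi (0 : ℝ), ENNReal.ofReal ((φ t)⁻¹ * smoothingDensity S (α c t) x) :=
        setLIntegral_le_lintegral _ _
    _ = ∑ c, ENNReal.ofReal (200 * S) *
        ∫⁻ p, ENNReal.ofReal ((φ p.1)⁻¹ * smoothingDensity S (α c p.1) p.2) ∂volST := by
        have hm : ∀ c, AEMeasurable (fun x => ENNReal.ofReal (200 * S) * ∫⁻ t in Ioi (0 : ℝ),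
            ENNReal.ofReal ((φ t)⁻¹ * smoothingDensity S (α c t) x)) volume := fun c =>
          (aemeasurable_smoothingDensity (hα c) hφ hφ0 hS).prod_swap.lintegral_prod_right'.const_mul _
        rw [lintegral_finsetSum' _ fun c _ => hm c]
        refine Finset.sum_congr rfl fun c _ => ?_
        rw [lintegral_const_mul' _ _ ENNReal.ofReal_ne_top, volST, lintegral_prod_symm]
        exact aemeasurable_smoothingDensity (hα c) hφ hφ0 hS
    _ ≤ ∑ _c : ι, ENNReal.ofReal (200 * S) * ENNReal.ofReal b :=
        Finset.sum_le_sum fun c _ => mul_le_mul_right (hb c) _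
    _ = _ := by rw [Finset.sum_const, nsmul_eq_mul, Finset.card_univ]

end Suprema

section Components

/-- The eight real coordinates on `ℂ⁴`. -/
def rcomp (c : Fin 4 × Bool) : (Fin 4 → ℂ) →L[ℝ] ℝ :=
  (if c.2 then Complex.reCLM else Complex.imCLM).comp (ContinuousLinearMap.proj c.1)

theorem sum_norm_sq_eq (v : Fin 4 → ℂ) : ∑ i, ‖v i‖ ^ 2 = ∑ c, rcomp c v ^ 2 := by
  rw [Fintype.sum_prod_type]
  refine Finset.sum_congr rfl fun i _ => ?_
  rw [Fintype.sum_bool, ← Complex.normSq_eq_norm_sq, Complex.normSq_apply]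
  simp [rcomp, sq]

theorem rcomp_ext {v w : Fin 4 → ℂ} (h : ∀ c, rcomp c v = rcomp c w) : v = w := by
  funext i
  exact Complex.ext (by simpa [rcomp] using h (i, true)) (by simpa [rcomp] using h (i, false))

theorem sum_norm_sq_pd_eq {f : Eu 3 → Fin 4 → ℂ} (hf : ContDiff ℝ ∞ f) (x : Eu 3) :
    ∑ j, ∑ i, ‖pd j (fun y => f y i) x‖ ^ 2 = ∑ c, gradSq (fun y => rcomp c (f y)) x := by
  unfold gradSq
  rw [Finset.sum_comm (γ := Fin 4 × Bool)]
  refine Finset.sum_congr rfl fun j _ => ?_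
  simp only [← pd_apply (hf.diffAt x) j, pd_clm _ (hf.diffAt x)]
  exact sum_norm_sq_eq _

variable {u : ℝ → Eu 3 → Fin 4 → ℂ} {s : Eu 3 → ℝ} {φ : ℝ → ℝ} {b R : ℝ}

theorem sphInt_le (hu : SmoothST u) (hs0 : ∀ x, 0 ≤ s x) (hs : ∀ x, s x ≤ 2)
    (hφ : ContinuousOn φ (Ici 0)) (hφ0 : ∀ t, 0 ≤ t → 0 < φ t) (hR : 0 < R) (hb0 : 0 ≤ b)
    (hb : ∀ S : ℝ, 1 ≤ S → ∀ c, ∫⁻ p, ENNReal.ofReal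
      ((φ p.1)⁻¹ * smoothingDensity S (fun x => rcomp c (u p.1 x)) p.2) ∂volST ≤ ENNReal.ofReal b) :
    (1 + R ^ 2)⁻¹ * sphInt (fun x =>
      (∫ t in Ioi (0 : ℝ), (φ t)⁻¹ * ∑ i, ‖u t x i‖ ^ 2) * s x) R ≤ 12800 * b := by
  set S := √(1 + R ^ 2) with hSdef
  have hS2 : S ^ 2 = 1 + R ^ 2 := sq_sqrt (by positivity)
  have hRS : R ≤ S := le_sqrt_of_sq_le (by linarith)
  have hS1 : 1 ≤ S := le_sqrt_of_sq_le (by nlinarith)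
  have key := lintegral_sphere_le (fun c => hu.clm (rcomp c)) hφ hφ0 hR hRS (hb S hS1)
  have hi : ∀ x, 0 ≤ᵐ[volume.restrict (Ioi (0 : ℝ))] fun t => (φ t)⁻¹ * ∑ i, ‖u t x i‖ ^ 2 :=
    fun x => by
      filter_upwards [ae_restrict_mem measurableSet_Ioi] with t ht
      have := hφ0 t (le_of_lt (mem_Ioi.1 ht))
      positivity
  have h1 : sphInt (fun x => (∫ t in Ioi (0 : ℝ), (φ t)⁻¹ * ∑ i, ‖u t x i‖ ^ 2) * s x) R
      ≤ 12800 * S ^ 2 * b := by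
    rw [sphInt, ← integral_const_mul]
    refine (ENNReal.ofReal_le_ofReal_iff (by positivity)).1 ?_
    refine (ofReal_integral_le_lintegral (ae_of_all _ fun θ => ?_)).trans ?_
    · exact mul_nonneg (sq_nonneg _) (mul_nonneg (integral_nonneg_of_ae (hi _)) (hs0 _))
    calc _ ≤ ∫⁻ θ : Metric.sphere (0 : Eu 3) 1, ENNReal.ofReal 2 * (∫⁻ t in Ioi (0 : ℝ),
          ENNReal.ofReal ((φ t)⁻¹ * ∑ c, R ^ 2 * rcomp c (u t (R • (θ : Eu 3))) ^ 2))
          ∂(volume.toSphere) := by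
          refine lintegral_mono fun θ => ?_
          set I := ∫ t in Ioi (0 : ℝ), (φ t)⁻¹ * ∑ i, ‖u t (R • (θ : Eu 3)) i‖ ^ 2 with hI
          have hI0 : 0 ≤ I := integral_nonneg_of_ae (hi _)
          have e1 : R ^ 2 * I = ∫ t in Ioi (0 : ℝ),
              (φ t)⁻¹ * ∑ c, R ^ 2 * rcomp c (u t (R • (θ : Eu 3))) ^ 2 := by
            rw [hI, ← integral_const_mul]
            congr 1; funext t
            rw [sum_norm_sq_eq, ← Finset.mul_sum]; ring
          calc ENNReal.ofReal (R ^ 2 * (I * s (R • (θ : Eu 3)))) ≤ ENNReal.ofReal (2 * (R ^ 2 * I)) := by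
                refine ENNReal.ofReal_le_ofReal ?_
                have := mul_le_mul_of_nonneg_left (hs (R • (θ : Eu 3)))
                  (mul_nonneg (sq_nonneg R) hI0)
                linarith
            _ ≤ _ := by
                rw [ENNReal.ofReal_mul (by norm_num), e1]
                refine mul_le_mul_right (ofReal_integral_le_lintegral ?_) _
                filter_upwards [ae_restrict_mem measurableSet_Ioi] with t ht
                have := hφ0 t (le_of_lt (mem_Ioi.1 ht))
                have : 0 ≤ ∑ c, R ^ 2 * rcomp c (u t (R • (θ : Eu 3))) ^ 2 :=
                  Finset.sum_nonneg fun c _ => by positivity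
                simp only [Pi.zero_apply]
                positivity
      _ ≤ ENNReal.ofReal 2 * (Fintype.card (Fin 4 × Bool) *
          (ENNReal.ofReal (800 * S ^ 2) * ENNReal.ofReal b)) := by
          rw [lintegral_const_mul' _ _ ENNReal.ofReal_ne_top]
          exact mul_le_mul_right key _
      _ = ENNReal.ofReal (12800 * S ^ 2 * b) := by
          have : ((Fintype.card (Fin 4 × Bool) : ℕ) : ENNReal) = ENNReal.ofReal 8 := by
            norm_num
          rw [this, ← ENNReal.ofReal_mul (by positivity), ← ENNReal.ofReal_mul (by positivity),
            ← ENNReal.ofReal_mul (by positivity)]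
          congr 1; ring
  rw [← hS2, inv_mul_le_iff₀ (by positivity)]
  linarith

theorem ballInt_le (hu : SmoothST u) (hs0 : ∀ x, 0 ≤ s x) (hs : ∀ x, s x ≤ 2)
    (hφ : ContinuousOn φ (Ici 0)) (hφ0 : ∀ t, 0 ≤ t → 0 < φ t) (hR : 0 < R) (hb0 : 0 ≤ b)
    (hb : ∀ S : ℝ, 1 ≤ S → ∀ c, ∫⁻ p, ENNReal.ofReal
      ((φ p.1)⁻¹ * smoothingDensity S (fun x => rcomp c (u p.1 x)) p.2) ∂volST ≤ ENNReal.ofReal b) :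
    (√(1 + R ^ 2))⁻¹ * (∫ x in Metric.ball (0 : Eu 3) R,
      (∫ t in Ioi (0 : ℝ), (φ t)⁻¹ * ∑ j, ∑ i, ‖pd j (fun y => u t y i) x‖ ^ 2) * s x)
      ≤ 3200 * b := by
  set S := √(1 + R ^ 2) with hSdef
  have hRS : R ≤ S := le_sqrt_of_sq_le (by linarith)
  have hS1 : 1 ≤ S := le_sqrt_of_sq_le (by nlinarith)
  have key := lintegral_ball_le (fun c => hu.clm (rcomp c)) hφ hφ0 hR hRS (hb S hS1)
  have hi : ∀ x, 0 ≤ᵐ[volume.restrict (Ioi (0 : ℝ))]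
      fun t => (φ t)⁻¹ * ∑ j, ∑ i, ‖pd j (fun y => u t y i) x‖ ^ 2 :=
    fun x => by
      filter_upwards [ae_restrict_mem measurableSet_Ioi] with t ht
      have := hφ0 t (le_of_lt (mem_Ioi.1 ht))
      positivity
  rw [inv_mul_le_iff₀ (by positivity)]
  refine (ENNReal.ofReal_le_ofReal_iff (by positivity)).1 ?_
  refine (ofReal_integral_le_lintegral (ae_of_all _ fun x => ?_)).trans ?_
  · exact mul_nonneg (integral_nonneg_of_ae (hi _)) (hs0 _)
  calc _ ≤ ∫⁻ x in Metric.ball (0 : Eu 3) R, ENNReal.ofReal 2 * (∫⁻ t in Ioi (0 : ℝ),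
        ENNReal.ofReal ((φ t)⁻¹ * ∑ c, gradSq (fun y => rcomp c (u t y)) x)) := by
        refine lintegral_mono fun x => ?_
        set I := ∫ t in Ioi (0 : ℝ), (φ t)⁻¹ * ∑ j, ∑ i, ‖pd j (fun y => u t y i) x‖ ^ 2 with hI
        have hI0 : 0 ≤ I := integral_nonneg_of_ae (hi _)
        calc ENNReal.ofReal (I * s x) ≤ ENNReal.ofReal (2 * I) := by
              refine ENNReal.ofReal_le_ofReal ?_
              have := mul_le_mul_of_nonneg_left (hs x) hI0
              linarith
          _ ≤ _ := by
              rw [ENNReal.ofReal_mul (by norm_num)]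
              refine mul_le_mul_right ((ofReal_integral_le_lintegral (hi x)).trans (le_of_eq ?_)) _
              refine setLIntegral_congr_fun measurableSet_Ioi fun t ht => ?_
              rw [sum_norm_sq_pd_eq (hu.contDiff (le_of_lt (mem_Ioi.1 ht)))]
    _ ≤ ENNReal.ofReal 2 * (Fintype.card (Fin 4 × Bool) *
        (ENNReal.ofReal (200 * S) * ENNReal.ofReal b)) := by
        rw [lintegral_const_mul' _ _ ENNReal.ofReal_ne_top]
        exact mul_le_mul_right key _
    _ = ENNReal.ofReal (S * (3200 * b)) := by
        have : ((Fintype.card (Fin 4 × Bool) : ℕ) : ENNReal) = ENNReal.ofReal 8 := by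
          norm_num
        rw [this, ← ENNReal.ofReal_mul (by positivity), ← ENNReal.ofReal_mul (by positivity),
          ← ENNReal.ofReal_mul (by positivity)]
        congr 1; ring

end Components

section Spinors

/-- The real inner product on `ℂ⁴`. -/
def cdot (v w : Fin 4 → ℂ) : ℝ := ∑ c, rcomp c v * rcomp c w

variable (v w z : Fin 4 → ℂ)

theorem cdot_eq_re : cdot v w = (∑ i, (starRingEnd ℂ) (v i) * w i).re := by
  rw [cdot, Fintype.sum_prod_type, Complex.re_sum]
  refine Finset.sum_congr rfl fun i _ => ?_
  simp [rcomp]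

theorem cdot_comm : cdot v w = cdot w v := by simp [cdot, mul_comm]

theorem cdot_add_left : cdot (v + w) z = cdot v z + cdot w z := by
  simp [cdot, add_mul, Finset.sum_add_distrib]

theorem cdot_add_right : cdot z (v + w) = cdot z v + cdot z w := by
  simp [cdot, mul_add, Finset.sum_add_distrib]

theorem cdot_smul_left (r : ℝ) : cdot (r • v) w = r * cdot v w := by
  simp [cdot, Finset.mul_sum, mul_assoc]

theorem cdot_smul_right (r : ℝ) : cdot v (r • w) = r * cdot v w := by
  simp [cdot, Finset.mul_sum, mul_left_comm]

theorem cdot_neg_right : cdot v (-w) = -cdot v w := by simp [cdot]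

theorem cdot_neg_left : cdot (-v) w = -cdot v w := by simp [cdot]

theorem cdot_zero_right : cdot v 0 = 0 := by simp [cdot]

theorem cdot_I_smul_left : cdot (Complex.I • v) w = -cdot v (Complex.I • w) := by
  simp only [cdot_eq_re, ← Complex.neg_re, ← Finset.sum_neg_distrib]
  congr 1
  refine Finset.sum_congr rfl fun i _ => ?_
  simp only [Pi.smul_apply, smul_eq_mul, map_mul, Complex.conj_I]
  ring

theorem cdot_self : cdot v v = ∑ c, rcomp c v ^ 2 := by simp [cdot, sq]

theorem cdot_self_nonneg : 0 ≤ cdot v v := by rw [cdot_self]; positivity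

theorem cdot_I_smul_self : cdot (Complex.I • v) (Complex.I • v) = cdot v v := by
  rw [cdot_I_smul_left, smul_smul, Complex.I_mul_I, neg_one_smul, cdot_neg_right, neg_neg]

theorem abs_cdot_le : |cdot v w| ≤ √(cdot v v) * √(cdot w w) := by
  rw [cdot_self, cdot_self]
  refine abs_le.2 ⟨?_, Real.sum_mul_le_sqrt_mul_sqrt Finset.univ _ _⟩
  have := Real.sum_mul_le_sqrt_mul_sqrt Finset.univ (fun c => -rcomp c v) fun c => rcomp c w
  simp only [neg_mul, Finset.sum_neg_distrib, neg_sq] at this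
  unfold cdot; linarith

theorem cdot_add_self_le : cdot (v + w) (v + w) ≤ 2 * cdot v v + 2 * cdot w w := by
  have h := cdot_self_nonneg (v + -w)
  simp only [cdot_add_left, cdot_add_right, cdot_neg_left, cdot_neg_right] at h ⊢
  linarith

theorem continuous_cdot {X : Type*} [TopologicalSpace X] {f g : X → Fin 4 → ℂ} (hf : Continuous f)
    (hg : Continuous g) : Continuous fun x => cdot (f x) (g x) :=
  continuous_finsetSum _ fun c _ => ((rcomp c).continuous.comp hf).mul ((rcomp c).continuous.comp hg)

theorem rcomp_const_smul (c : Fin 4 × Bool) (r : ℝ) : rcomp c (r • v) = r * rcomp c v := by simp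

end Spinors

section Symbol

variable {A : Fin 3 → Eu 3 → Fin 4 → Fin 4 → ℂ} {B : Eu 3 → Fin 4 → Fin 4 → ℂ}

/-- The principal symbol of `Hop A B` at the covector `dα`. -/
def symb (A : Fin 3 → Eu 3 → Fin 4 → Fin 4 → ℂ) (α : Eu 3 → ℝ) (x : Eu 3) (v : Fin 4 → ℂ) :
    Fin 4 → ℂ := ∑ j, pd j α x • Matrix.mulVec (Matrix.of (A j x)) v

theorem symb_apply (α : Eu 3 → ℝ) (x : Eu 3) (v : Fin 4 → ℂ) (i : Fin 4) :
    symb A α x v i = ∑ j, ∑ k, A j x i k * (pd j α x • v k) := by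
  simp only [symb, Finset.sum_apply, Pi.smul_apply, Matrix.mulVec, dotProduct, Matrix.of_apply,
    Finset.smul_sum, mul_smul_comm]

theorem Hop_eq (f : Eu 3 → Fin 4 → ℂ) (x : Eu 3) : Hop A B f x
    = (∑ j, Matrix.mulVec (Matrix.of (A j x)) (pd j f x)) + Matrix.mulVec (Matrix.of (B x)) (f x) := by
  funext i
  simp [Hop, Matrix.mulVec, dotProduct]

theorem symb_smul (α : Eu 3 → ℝ) (x : Eu 3) (r : ℝ) (v : Fin 4 → ℂ) :
    symb A α x (r • v) = r • symb A α x v := by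
  simp only [symb, Matrix.mulVec_smul, Finset.smul_sum]
  exact Finset.sum_congr rfl fun j _ => smul_comm _ _ _

theorem Hop_smul {ψ : Eu 3 → ℝ} {f : Eu 3 → Fin 4 → ℂ} {x : Eu 3} (hψ : DifferentiableAt ℝ ψ x)
    (hf : DifferentiableAt ℝ f x) :
    Hop A B (fun y => ψ y • f y) x = ψ x • Hop A B f x + symb A ψ x (f x) := by
  simp only [Hop_eq, symb, pd_smul hψ hf, Matrix.mulVec_add, Matrix.mulVec_smul, smul_add,
    Finset.sum_add_distrib, Finset.smul_sum]
  abel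

theorem Hop_const_smul {f : Eu 3 → Fin 4 → ℂ} {x : Eu 3} (c : ℂ) (hf : DifferentiableAt ℝ f x) :
    Hop A B (fun y => c • f y) x = c • Hop A B f x := by
  have h : ∀ j, pd j (fun y => c • f y) x = c • pd j f x := fun j => by
    simp [pd, fderiv_fun_const_smul hf]
  simp only [Hop_eq, h, Matrix.mulVec_smul, smul_add, Finset.smul_sum]

theorem Hop_congr {f g : Eu 3 → Fin 4 → ℂ} {x : Eu 3} (h : f =ᶠ[𝓝 x] g) :
    Hop A B f x = Hop A B g x := by
  simp only [Hop_eq, pd_congr h, h.eq_of_nhds]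

theorem contDiff_Hop (hA : ∀ j i k, ContDiff ℝ ∞ fun x => A j x i k)
    (hB : ∀ i k, ContDiff ℝ ∞ fun x => B x i k) {f : Eu 3 → Fin 4 → ℂ} (hf : ContDiff ℝ ∞ f) :
    ContDiff ℝ ∞ (Hop A B f) := by
  refine contDiff_pi.2 fun i => ?_
  have h1 := fun j => contDiff_pi.1 (hf.pd j)
  have h2 := contDiff_pi.1 hf
  exact (ContDiff.sum fun j _ => ContDiff.sum fun k _ => (hA j i k).mul (h1 j k)).add
    (ContDiff.sum fun k _ => (hB i k).mul (h2 k))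

theorem SmoothST.hop (hA : ∀ j i k, ContDiff ℝ ∞ fun x => A j x i k)
    (hB : ∀ i k, ContDiff ℝ ∞ fun x => B x i k) {u : ℝ → Eu 3 → Fin 4 → ℂ} (hu : SmoothST u) :
    SmoothST fun t => Hop A B (u t) := by
  refine contDiffOn_pi.2 fun i => ?_
  have h1 := fun j k => (hu.pd j).apply k
  exact (SmoothST.sum fun j _ => SmoothST.sum fun k _ => (smoothST_of_space (hA j i k)).mul (h1 j k)).add
    (SmoothST.sum fun k _ => (smoothST_of_space (hB i k)).mul (hu.apply k))

theorem continuous_symb (hA : ∀ j i k, ContDiff ℝ ∞ fun x => A j x i k) {α : Eu 3 → ℝ}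
    (hα : ContDiff ℝ ∞ α) {f : Eu 3 → Fin 4 → ℂ} (hf : Continuous f) :
    Continuous fun x => symb A α x (f x) := by
  refine continuous_pi fun i => ?_
  simp only [symb_apply]
  have h1 := fun j i k => (hA j i k).continuous
  have h2 := fun j => (hα.pd j).continuous
  have h3 := fun k => (continuous_apply k).comp hf
  exact continuous_finsetSum _ fun j _ => continuous_finsetSum _ fun k _ =>
    (h1 j i k).mul ((h2 j).smul (h3 k))

/-- Time derivatives commute with `Hop A B`. -/
theorem SmoothST.hasDerivAt_hop {U V : ℝ → Eu 3 → Fin 4 → ℂ} (hU : SmoothST U)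
    (hV : ∀ t, 0 < t → ∀ x, HasDerivAt (fun s => U s x) (V t x) t) {t : ℝ} (ht : 0 < t) (x : Eu 3) :
    HasDerivAt (fun s => Hop A B (U s) x) (Hop A B (V t) x) t := by
  refine hasDerivAt_pi.2 fun i => ?_
  have h1 := fun j => hasDerivAt_pi.1 (hU.hasDerivAt_pd hV j ht x)
  have h2 := hasDerivAt_pi.1 (hV t ht x)
  exact (HasDerivAt.fun_sum fun j _ => HasDerivAt.fun_sum fun k _ => (h1 j k).const_mul (A j x i k)).add
    (HasDerivAt.fun_sum fun k _ => (h2 k).const_mul (B x i k))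

end Symbol

/-- A symmetric first-order system whose square is the Klein–Gordon operator
`m² - s⁻¹ ∂_j (s a^{jk} ∂_k) + R / 4`. -/
structure DiracOp (a : Fin 3 → Fin 3 → Eu 3 → ℝ) (s R : Eu 3 → ℝ) (m : ℝ)
    (A : Fin 3 → Eu 3 → Fin 4 → Fin 4 → ℂ) (B : Eu 3 → Fin 4 → Fin 4 → ℂ) : Prop where
  smooth : ∀ j i k, ContDiff ℝ ∞ fun x => A j x i k
  smooth' : ∀ i k, ContDiff ℝ ∞ fun x => B x i k
  symm : ∀ f g : Eu 3 → Fin 4 → ℂ, ContDiff ℝ ∞ f → ContDiff ℝ ∞ g →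
    HasCompactSupport f → HasCompactSupport g →
    ∫ x, cdot (Hop A B f x) (g x) * s x = ∫ x, cdot (f x) (Hop A B g x) * s x
  comp_sq : ∀ f : Eu 3 → Fin 4 → ℂ, ContDiff ℝ ∞ f → ∀ x c,
    rcomp c (Hop A B (Hop A B f) x) = -kgForce a s R m (fun y => rcomp c (f y)) x

section DiracSymbol

variable {a : Fin 3 → Fin 3 → Eu 3 → ℝ} {s R : Eu 3 → ℝ} {m σ ε : ℝ}
  {A : Fin 3 → Eu 3 → Fin 4 → Fin 4 → ℂ} {B : Eu 3 → Fin 4 → Fin 4 → ℂ}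
  {f g : Eu 3 → Fin 4 → ℂ} {α ψ : Eu 3 → ℝ}

theorem Hop_eq_zero_of_notMem_tsupport {x : Eu 3} (hx : x ∉ tsupport g) : Hop A B g x = 0 := by
  have h : g =ᶠ[𝓝 x] fun _ => 0 := notMem_tsupport_iff_eventuallyEq.1 hx
  rw [Hop_congr h, Hop_eq]
  simp

theorem HasCompactSupport.hop (hg : HasCompactSupport g) : HasCompactSupport (Hop A B g) :=
  HasCompactSupport.intro hg.isCompact fun _ hx => Hop_eq_zero_of_notMem_tsupport hx

namespace DiracOp

variable (D : DiracOp a s R m A B)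
include D

theorem symm_of_compact_right (hf : ContDiff ℝ ∞ f) (hg : ContDiff ℝ ∞ g)
    (hc : HasCompactSupport g) :
    ∫ x, cdot (Hop A B f x) (g x) * s x = ∫ x, cdot (f x) (Hop A B g x) * s x := by
  obtain ⟨k, hk, h1⟩ := exists_cut_eventually_eq_one hc
  have h := D.symm (fun x => cut k 0 x • f x) g (contDiff_cut.smul hf) hg
    (hasCompactSupport_cut hk le_rfl).smul_right hc
  convert h using 1
  · refine integral_congr_ae (ae_of_all _ fun x => ?_)
    by_cases hx : x ∈ tsupport g
    · have : (fun y => cut k 0 y • f y) =ᶠ[𝓝 x] f := by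
        filter_upwards [h1 x hx] with y hy
        rw [hy, one_smul]
      simp only [Hop_congr this]
    · simp only [image_eq_zero_of_notMem_tsupport hx, cdot_zero_right]
  · refine integral_congr_ae (ae_of_all _ fun x => ?_)
    by_cases hx : x ∈ tsupport g
    · simp only [(h1 x hx).self_of_nhds, one_smul]
    · simp only [Hop_eq_zero_of_notMem_tsupport hx, cdot_zero_right]

omit D in
theorem integrable_cdot_mul (hs : Continuous s) (hf : Continuous f) (hg : Continuous g)
    (hc : HasCompactSupport g) : Integrable fun x => cdot (f x) (g x) * s x := by
  have h : HasCompactSupport fun x => cdot (f x) (g x) * s x := by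
    refine HasCompactSupport.intro hc.isCompact fun x hx => ?_
    rw [image_eq_zero_of_notMem_tsupport hx, cdot_zero_right, zero_mul]
  exact ((continuous_cdot hf hg).mul hs).integrable_of_hasCompactSupport h

theorem integral_symb_skew (hs : Continuous s) (hψ : ContDiff ℝ ∞ ψ) (hf : ContDiff ℝ ∞ f)
    (hg : ContDiff ℝ ∞ g) (hc : HasCompactSupport g) :
    ∫ x, (cdot (symb A ψ x (f x)) (g x) + cdot (f x) (symb A ψ x (g x))) * s x = 0 := by
  have hψg : HasCompactSupport fun x => ψ x • g x := hc.smul_left (f := ψ)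
  have e1 := D.symm_of_compact_right (f := fun x => ψ x • f x) (hψ.smul hf) hg hc
  have e2 := D.symm_of_compact_right (g := fun x => ψ x • g x) hf (hψ.smul hg) hψg
  simp only [Hop_smul (hψ.diffAt _) (hf.diffAt _), Hop_smul (hψ.diffAt _) (hg.diffAt _),
    cdot_add_left, cdot_add_right, cdot_smul_left, cdot_smul_right, add_mul] at e1 e2
  have cf := contDiff_Hop D.smooth D.smooth' hf
  have cg := contDiff_Hop D.smooth D.smooth' hg
  have cs : HasCompactSupport fun x => symb A ψ x (g x) :=
    HasCompactSupport.intro hc.isCompact fun x hx => by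
      simp [image_eq_zero_of_notMem_tsupport hx, symb]
  have hψg' : HasCompactSupport fun x => ψ x • Hop A B g x := hc.hop.smul_left (f := ψ)
  have i1 := integrable_cdot_mul (g := fun x => ψ x • g x) hs cf.continuous
    (hψ.continuous.smul hg.continuous) hψg
  have i2 := integrable_cdot_mul hs (continuous_symb D.smooth hψ hf.continuous) hg.continuous hc
  have i3 := integrable_cdot_mul hs hf.continuous (continuous_symb D.smooth hψ hg.continuous) cs
  have i4 := integrable_cdot_mul (g := fun x => ψ x • Hop A B g x) hs hf.continuous
    (hψ.continuous.smul cg.continuous) hψg'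
  simp only [cdot_smul_right] at i1 i4
  rw [integral_add i1 i2] at e1
  rw [integral_add i4 i3] at e2
  simp only [add_mul]
  rw [integral_add i2 i3]
  linarith

theorem cdot_symb_left (hs : Continuous s) (hs0 : ∀ x, 0 < s x) (hα : ContDiff ℝ ∞ α) (x : Eu 3)
    (v w : Fin 4 → ℂ) : cdot (symb A α x v) w = -cdot v (symb A α x w) := by
  set F : Eu 3 → ℝ := fun y => (cdot (symb A α y v) w + cdot v (symb A α y w)) * s y with hF
  have c1 := continuous_symb D.smooth hα (continuous_const (y := v))
  have c2 := continuous_symb D.smooth hα (continuous_const (y := w))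
  have cF : Continuous F :=
    ((continuous_cdot c1 continuous_const).add (continuous_cdot continuous_const c2)).mul hs
  have h : ∀ᵐ y, F y = 0 := by
    refine ae_eq_zero_of_integral_contDiff_smul_eq_zero cF.locallyIntegrable fun ρ hρ hρc => ?_
    have := D.integral_symb_skew (f := fun _ => v) (g := fun y => ρ y • w) hs hα contDiff_const
      (hρ.smul contDiff_const) hρc.smul_right
    simp only [symb_smul, cdot_smul_right] at this
    rw [← this]
    refine integral_congr_ae (ae_of_all _ fun y => ?_)
    simp only [hF, smul_eq_mul]; ring
  have h0 : F = 0 := (Continuous.ae_eq_iff_eq volume cF continuous_const).1 h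
  have hx : F x = 0 := congrFun h0 x
  have := (mul_eq_zero.1 hx).resolve_right (hs0 x).ne'
  linarith

omit D in
theorem lapS_sq_mul_of_eq_zero (ha : ∀ j k, ContDiff ℝ ∞ (a j k)) (hs : ContDiff ℝ ∞ s)
    (hs0 : ∀ x, 0 < s x) (hψ : ContDiff ℝ ∞ ψ) {x : Eu 3} (hx : ψ x = 0) (c : ℝ) :
    lapS a s (fun y => ψ y * (ψ y * c)) x = 2 * quad a ψ x * c := by
  have h1 : ∀ j y, s y * flow a (fun y => ψ y * (ψ y * c)) j y
      = ψ y * (2 * c * (s y * flow a ψ j y)) := fun j y => by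
    have : ∀ k, pd k (fun y => ψ y * (ψ y * c)) y = 2 * c * ψ y * pd k ψ y := fun k => by
      have d := hψ.diffAt y
      rw [pd_mul d (by fun_prop), pd_mul d (by fun_prop), pd_const]
      ring
    simp only [flow, this, Finset.mul_sum]
    exact Finset.sum_congr rfl fun k _ => by ring
  have h2 : ∀ j, pd j (fun y => ψ y * (2 * c * (s y * flow a ψ j y))) x
      = pd j ψ x * (2 * c * (s x * flow a ψ j x)) := fun j => by
    have d1 := hs.diffAt x
    have d2 := (contDiff_flow ha hψ j).diffAt x
    rw [pd_mul (hψ.diffAt x) (by fun_prop), hx, zero_mul, add_zero]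
  simp only [lapS, h1, h2, quad, Finset.mul_sum, Finset.sum_mul]
  refine Finset.sum_congr rfl fun j _ => ?_
  have := (hs0 x).ne'
  field_simp

theorem symb_symb (hN : NearFlat σ ε a s R) (hα : ContDiff ℝ ∞ α) (x : Eu 3) (v : Fin 4 → ℂ) :
    symb A α x (symb A α x v) = -(quad a α x • v) := by
  set ψ : Eu 3 → ℝ := fun y => α y - α x with hψd
  have hψ : ContDiff ℝ ∞ ψ := hα.sub contDiff_const
  have hp : ∀ j y, pd j ψ y = pd j α y := fun j y => by
    rw [hψd, pd_sub (hα.diffAt y) (by fun_prop), pd_const, sub_zero]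
  have hsy : ∀ y w, symb A ψ y w = symb A α y w := fun y w => by simp only [symb, hp]
  have hq : quad a ψ x = quad a α x := by simp only [quad, flow, hp]
  have hx : ψ x = 0 := sub_self _
  set f1 : Eu 3 → Fin 4 → ℂ := fun y => ψ y • v
  have hf1 : ContDiff ℝ ∞ f1 := hψ.smul contDiff_const
  have e1 : ∀ y, Hop A B f1 y = ψ y • Hop A B (fun _ => v) y + symb A α y v := fun y => by
    rw [← hsy]; exact Hop_smul (hψ.diffAt y) (by fun_prop)
  have hG0 : ContDiff ℝ ∞ (Hop A B f1) := contDiff_Hop D.smooth D.smooth' hf1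
  have hS : ContDiff ℝ ∞ fun y => symb A α y v := by
    have : (fun y => symb A α y v) = fun y => Hop A B f1 y - ψ y • Hop A B (fun _ => v) y :=
      funext fun y => by rw [e1]; simp
    rw [this]
    exact hG0.sub (hψ.smul (contDiff_Hop D.smooth D.smooth' contDiff_const))
  have e2 : Hop A B (fun y => ψ y • f1 y) = fun y => ψ y • (Hop A B f1 y + symb A α y v) :=
    funext fun y => by
      rw [Hop_smul (hψ.diffAt y) (hf1.diffAt y), hsy, symb_smul, smul_add]
  have e3 : Hop A B (Hop A B (fun y => ψ y • f1 y)) x = (2 : ℝ) • symb A α x (symb A α x v) := by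
    rw [e2, Hop_smul (hψ.diffAt x) ((hG0.add hS).diffAt x), hx, hsy, e1, hx, ← symb_smul, two_smul]
    simp
  refine rcomp_ext fun c => ?_
  have h := D.comp_sq (fun y => ψ y • f1 y) (hψ.smul hf1) x c
  simp only [e3, kgForce] at h
  have e4 : (fun y => rcomp c (ψ y • f1 y)) = fun y => ψ y * (ψ y * rcomp c v) :=
    funext fun y => by simp [f1]
  rw [e4, lapS_sq_mul_of_eq_zero hN.smooth_inv hN.smooth_density hN.density_pos hψ hx, hq, hx] at h
  simp only [rcomp_const_smul] at h
  simp only [map_neg, rcomp_const_smul]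
  linarith

theorem cdot_symb_self (hN : NearFlat σ ε a s R) (hα : ContDiff ℝ ∞ α) (x : Eu 3)
    (v : Fin 4 → ℂ) : cdot (symb A α x v) (symb A α x v) = quad a α x * cdot v v := by
  rw [D.cdot_symb_left hN.smooth_density.continuous hN.density_pos hα, D.symb_symb hN hα,
    cdot_neg_right, cdot_smul_right, neg_neg]

end DiracOp

end DiracSymbol

section StaticEnergy

variable {a : Fin 3 → Fin 3 → Eu 3 → ℝ} {s R : Eu 3 → ℝ} {m σ ε k : ℝ} {α β : Eu 3 → ℝ}

/-- The energy density of the Klein–Gordon operator. -/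
def kgEnergy (a : Fin 3 → Fin 3 → Eu 3 → ℝ) (s R : Eu 3 → ℝ) (m : ℝ) (α : Eu 3 → ℝ) (x : Eu 3) : ℝ :=
  s x * (m ^ 2 * α x ^ 2 + quad a α x + R x / 4 * α x ^ 2)

theorem NearFlat.integrable_kgEnergy (hN : NearFlat σ ε a s R) (hα : ContDiff ℝ ∞ α)
    (hc : HasCompactSupport α) : Integrable (kgEnergy a s R m α) := by
  have cE : Continuous (kgEnergy a s R m α) := by
    have := hN.continuous_curv
    have := hN.smooth_density.continuous
    have := (contDiff_quad hN.smooth_inv hα).continuous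
    have := hα.continuous
    unfold kgEnergy; fun_prop
  refine cE.integrable_of_hasCompactSupport (HasCompactSupport.intro hc.isCompact fun x hx => ?_)
  have h0 := image_eq_zero_of_notMem_tsupport hx
  have h1 : ∀ j, pd j α x = 0 := fun j => image_eq_zero_of_notMem_tsupport
    fun h => hx (tsupport_fderiv_apply_subset ℝ _ h)
  simp [kgEnergy, quad, h0, h1]

theorem NearFlat.integral_mul_kgForce (hN : NearFlat σ ε a s R) (hα : ContDiff ℝ ∞ α)
    (hc : HasCompactSupport α) :
    ∫ x, α x * -kgForce a s R m α x * s x = ∫ x, kgEnergy a s R m α x := by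
  have cf := fun j => contDiff_flow hN.smooth_inv hα j
  have cF : ∀ j, ContDiff ℝ ∞ fun x => α x * (s x * flow a α j x) := fun j =>
    hα.mul (hN.smooth_density.mul (cf j))
  have hF : ∀ j, HasCompactSupport fun x => α x * (s x * flow a α j x) := fun j => hc.mul_right
  have e : ∀ x, α x * -kgForce a s R m α x * s x
      = kgEnergy a s R m α x - ∑ j, pd j (fun x => α x * (s x * flow a α j x)) x := fun x => by
    have : ∀ j, pd j (fun x => α x * (s x * flow a α j x)) x
        = s x * (flow a α j x * pd j α x) + α x * pd j (fun y => s y * flow a α j y) x := fun j => by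
      rw [pd_mul (hα.diffAt x) ((hN.smooth_density.mul (cf j)).diffAt x)]; ring
    simp only [this, Finset.sum_add_distrib, ← Finset.mul_sum]
    have hs := (hN.density_pos x).ne'
    unfold kgForce kgEnergy lapS quad
    field_simp
    ring
  have iF : ∀ j, Integrable (pd j fun x => α x * (s x * flow a α j x)) := fun j =>
    ((cF j).pd j).continuous.integrable_of_hasCompactSupport ((hF j).pd j)
  have iE := hN.integrable_kgEnergy (m := m) hα hc
  simp only [e]
  rw [integral_sub iE (integrable_finsetSum _ fun j _ => iF j),
    integral_finsetSum _ fun j _ => iF j]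
  simp only [integral_pd_of_compact ((cF _).of_le (by simp)) _ (hF _), Finset.sum_const_zero, sub_zero]

theorem NearFlat.kgEnergy_bounds (hN : NearFlat σ ε a s R) (hσ : 0 ≤ σ) (hε0 : 0 ≤ ε)
    (hε : ε ≤ 1 / 100) (α : Eu 3 → ℝ) {x : Eu 3} (hx : x ≠ 0) :
    1 / 2 * (m ^ 2 * α x ^ 2) + 9 / 20 * gradSq α x - 1 / 200 * (α x ^ 2 / ‖x‖ ^ 2)
      ≤ kgEnergy a s R m α x ∧
    kgEnergy a s R m α x
      ≤ 2 * (m ^ 2 * α x ^ 2) + 24 * gradSq α x + 1 / 200 * (α x ^ 2 / ‖x‖ ^ 2) := by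
  have hn : 0 < ‖x‖ := norm_pos_iff.2 hx
  have hs1 := hN.half_le_density x
  have hs2 := hN.density_le x
  have hg := gradSq_nonneg α x
  have hqq := Real.mul_self_sqrt hg
  have hq1 : |quad a α x - gradSq α x| ≤ 3 * (3 * (ε * gradSq α x)) := by
    have e : quad a α x - gradSq α x = ∑ j, (flow a α j x - pd j α x) * pd j α x := by
      simp only [quad, gradSq, sub_mul, Finset.sum_sub_distrib, sq]
    rw [e]
    refine abs_sum_fin3_le fun j => ?_
    rw [abs_mul]
    have h1 := hN.abs_flow_sub_le (α := α) j x
    have h3 := pw_one_le_one (b := -σ / 2) (by linarith) x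
    have h4 : 3 * (ε * pw 1 (-σ / 2) x * √(gradSq α x)) ≤ 3 * (ε * √(gradSq α x)) := by
      have : ε * pw 1 (-σ / 2) x ≤ ε := mul_le_of_le_one_right hε0 h3
      gcongr
    calc _ ≤ 3 * (ε * √(gradSq α x)) * √(gradSq α x) :=
          mul_le_mul (h1.trans h4) (abs_pd_le_sqrt_gradSq α j x) (abs_nonneg _) (by positivity)
      _ = 3 * (ε * (√(gradSq α x) * √(gradSq α x))) := by ring
      _ = _ := by rw [hqq]
  obtain ⟨hq2, hq3⟩ := abs_le.1 hq1
  have hεg : ε * gradSq α x ≤ 1 / 100 * gradSq α x := mul_le_mul_of_nonneg_right hε hg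
  have hR : |R x| ≤ 1 / 100 / ‖x‖ ^ 2 := by
    rw [le_div_iff₀ (by positivity)]
    have h1 := hN.abs_curv_le x
    have h2 : ‖x‖ * pw 1 (-(1 + σ) / 2) x ≤ 1 :=
      (norm_mul_pw_le one_pos _ x).trans (pw_one_le_one (by linarith) x)
    calc |R x| * ‖x‖ ^ 2 = ‖x‖ * (‖x‖ * |R x|) := by ring
      _ ≤ ‖x‖ * (ε * pw 1 (-(1 + σ) / 2) x) := by gcongr
      _ = ε * (‖x‖ * pw 1 (-(1 + σ) / 2) x) := by ring
      _ ≤ ε * 1 := by gcongr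
      _ ≤ 1 / 100 := by linarith
  have hRa : |R x / 4 * α x ^ 2| ≤ 1 / 400 * (α x ^ 2 / ‖x‖ ^ 2) := by
    rw [abs_mul, abs_div, abs_of_nonneg (sq_nonneg (α x)), abs_of_pos (by norm_num : (0 : ℝ) < 4)]
    calc |R x| / 4 * α x ^ 2 ≤ (1 / 100 / ‖x‖ ^ 2) / 4 * α x ^ 2 := by gcongr
      _ = _ := by ring
  obtain ⟨hR1, hR2⟩ := abs_le.1 hRa
  have hm : 0 ≤ m ^ 2 * α x ^ 2 := by positivity
  have hz : 0 ≤ α x ^ 2 / ‖x‖ ^ 2 := by positivity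
  unfold kgEnergy
  constructor
  · have h1 : 1 / 2 * (m ^ 2 * α x ^ 2 + 91 / 100 * gradSq α x)
        ≤ s x * (m ^ 2 * α x ^ 2 + quad a α x) :=
      mul_le_mul hs1 (by linarith) (by positivity) (by linarith)
    have h2 : -(2 * (1 / 400 * (α x ^ 2 / ‖x‖ ^ 2))) ≤ s x * (R x / 4 * α x ^ 2) := by
      have : s x * |R x / 4 * α x ^ 2| ≤ 2 * (1 / 400 * (α x ^ 2 / ‖x‖ ^ 2)) :=
        mul_le_mul hs2 hRa (abs_nonneg _) (by norm_num)
      have h' := neg_abs_le (R x / 4 * α x ^ 2)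
      nlinarith
    linarith
  · have h0 : 0 ≤ m ^ 2 * α x ^ 2 + 109 / 100 * gradSq α x + 1 / 400 * (α x ^ 2 / ‖x‖ ^ 2) := by
      positivity
    have h1 : s x * (m ^ 2 * α x ^ 2 + quad a α x + R x / 4 * α x ^ 2)
        ≤ s x * (m ^ 2 * α x ^ 2 + 109 / 100 * gradSq α x + 1 / 400 * (α x ^ 2 / ‖x‖ ^ 2)) :=
      mul_le_mul_of_nonneg_left (by linarith) (by linarith)
    have h2 := mul_le_mul_of_nonneg_right hs2 h0
    linarith

theorem NearFlat.integral_kgEnergy_bounds (hN : NearFlat σ ε a s R) (hσ : 0 ≤ σ) (hε0 : 0 ≤ ε)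
    (hε : ε ≤ 1 / 100) (hα : ContDiff ℝ ∞ α) (hc : HasCompactSupport α) :
    m ^ 2 * (∫ x, α x ^ 2) + ∫ x, gradSq α x ≤ 4 * ∫ x, kgEnergy a s R m α x ∧
    ∫ x, kgEnergy a s R m α x ≤ 30 * (m ^ 2 * (∫ x, α x ^ 2) + ∫ x, gradSq α x) := by
  have i1 : Integrable fun x => α x ^ 2 := by
    have := hα.continuous
    have h : HasCompactSupport fun x => α x ^ 2 :=
      hc.comp_left (g := fun r : ℝ => r ^ 2) (by norm_num)
    exact Continuous.integrable_of_hasCompactSupport (by fun_prop) h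
  have i2 : Integrable (gradSq α) := by
    refine (continuous_gradSq (hα.of_le (by simp))).integrable_of_hasCompactSupport
      (HasCompactSupport.intro hc.isCompact fun x hx => ?_)
    have h1 : ∀ j, pd j α x = 0 := fun j => image_eq_zero_of_notMem_tsupport
      fun h => hx (tsupport_fderiv_apply_subset ℝ _ h)
    simp [gradSq, h1]
  obtain ⟨i3, h3⟩ := hardy (hα.of_le (by simp)) i1 i2
  have iE := hN.integrable_kgEnergy (m := m) hα hc
  obtain ⟨j1, e1⟩ := integral_combination₃ (i1.const_mul (m ^ 2)) i2 i3 (1 / 2) (9 / 20) (-(1 / 200))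
  obtain ⟨j2, e2⟩ := integral_combination₃ (i1.const_mul (m ^ 2)) i2 i3 2 24 (1 / 200)
  have l1 := integral_mono_ae j1 iE (by
    filter_upwards [ae_ne_zero] with x hx
    have := (hN.kgEnergy_bounds (m := m) hσ hε0 hε α hx).1
    linarith)
  have l2 := integral_mono_ae iE j2 (by
    filter_upwards [ae_ne_zero] with x hx
    exact (hN.kgEnergy_bounds hσ hε0 hε α hx).2)
  rw [e1, integral_const_mul] at l1
  rw [e2, integral_const_mul] at l2
  have n1 : 0 ≤ m ^ 2 * ∫ x, α x ^ 2 :=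
    mul_nonneg (sq_nonneg m) (integral_nonneg fun x => sq_nonneg _)
  have n2 : 0 ≤ ∫ x, gradSq α x := integral_nonneg fun x => gradSq_nonneg α x
  constructor <;> linarith

end StaticEnergy

section StaticDirac

variable {a : Fin 3 → Fin 3 → Eu 3 → ℝ} {s R : Eu 3 → ℝ} {m σ ε k : ℝ}
  {A : Fin 3 → Eu 3 → Fin 4 → Fin 4 → ℂ} {B : Eu 3 → Fin 4 → Fin 4 → ℂ}
  {f v : Eu 3 → Fin 4 → ℂ}

theorem eventually_cut_nhds_eq_one (x : Eu 3) :
    ∀ᶠ n : ℕ in atTop, ∀ᶠ y in 𝓝 x, cut ((n : ℝ) + 1) 0 y = 1 := by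
  have hp := (contDiff_pw one_pos (1 / 2)).continuous
  filter_upwards [eventually_ge_atTop ⌈pw 1 (1 / 2) x⌉₊] with n hn
  have h1 : pw 1 (1 / 2) x < (n : ℝ) + 1 := by
    have := Nat.ceil_le.1 hn; linarith
  filter_upwards [hp.continuousAt.eventually_lt continuousAt_const h1] with y hy
  exact cut_eq_one (by positivity) (by linarith)

theorem gradSq_cut_mul_le {α : Eu 3 → ℝ} (hα : ContDiff ℝ ∞ α) (hk : 0 < k) (x : Eu 3) :
    gradSq (fun y => cut k 0 y * α y) x ≤ 2 * gradSq α x + 2 * (transBd / k) ^ 2 * α x ^ 2 := by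
  have h := gradSq_cut_le (k := k) (c := 0) x
  have h2 : cutSlope k 0 x ^ 2 ≤ (transBd / k) ^ 2 :=
    pow_le_pow_left₀ (cutSlope_nonneg hk x) (cutSlope_le hk x) 2
  have hc1 : cut k 0 x ^ 2 ≤ 1 := pow_le_one₀ (cut_nonneg x) (cut_le_one x)
  have h3 : gradSq (fun y => cut k 0 y * α y) x
      ≤ 2 * (cut k 0 x ^ 2 * gradSq α x) + 2 * (gradSq (cut k 0) x * α x ^ 2) := by
    simp only [gradSq, pd_mul (contDiff_cut.diffAt x) (hα.diffAt x), Finset.mul_sum, Finset.sum_mul,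
      ← Finset.sum_add_distrib]
    refine Finset.sum_le_sum fun j _ => ?_
    nlinarith [sq_nonneg (pd j (cut k 0) x * α x - cut k 0 x * pd j α x)]
  have h4 : cut k 0 x ^ 2 * gradSq α x ≤ 1 * gradSq α x :=
    mul_le_mul_of_nonneg_right hc1 (gradSq_nonneg α x)
  have h5 : gradSq (cut k 0) x * α x ^ 2 ≤ (transBd / k) ^ 2 * α x ^ 2 :=
    mul_le_mul_of_nonneg_right (h.trans h2) (sq_nonneg _)
  linarith

namespace DiracOp

variable (D : DiracOp a s R m A B) (hN : NearFlat σ ε a s R)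
include D hN

theorem integral_sq_eq (hf : ContDiff ℝ ∞ f) (hc : HasCompactSupport f) :
    ∫ x, cdot (Hop A B f x) (Hop A B f x) * s x
      = ∑ c, ∫ x, kgEnergy a s R m (fun y => rcomp c (f y)) x := by
  have hs := hN.smooth_density.continuous
  have cf := contDiff_Hop D.smooth D.smooth' hf
  have hd : ∀ c, ContDiff ℝ ∞ fun y => rcomp c (f y) := fun c => (rcomp c).contDiff.comp hf
  have hcc : ∀ c, HasCompactSupport fun y => rcomp c (f y) := fun c => hc.comp_left (map_zero _)
  rw [D.symm f _ hf cf hc hc.hop]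
  simp only [cdot, D.comp_sq f hf, Finset.sum_mul]
  rw [integral_finsetSum]
  · exact Finset.sum_congr rfl fun c _ => hN.integral_mul_kgForce (hd c) (hcc c)
  · intro c _
    have h1 := (hd c).continuous
    have h2 := hN.continuous_kgForce (m := m) (hd c)
    have h3 : HasCompactSupport fun x =>
      rcomp c (f x) * -kgForce a s R m (fun y => rcomp c (f y)) x * s x := ((hcc c).mul_right).mul_right
    exact Continuous.integrable_of_hasCompactSupport (by fun_prop) h3

theorem cdot_symb_cut_le (hσ : 0 ≤ σ) (hε : ε ≤ 1) (c : ℝ) (x : Eu 3) (w : Fin 4 → ℂ) :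
    cdot (symb A (cut k c) x w) (symb A (cut k c) x w) ≤ 12 * cutSlope k c x ^ 2 * cdot w w := by
  rw [D.cdot_symb_self hN contDiff_cut]
  have h1 := (abs_le.1 (hN.abs_quad_le (α := cut k c) hσ hε x)).2
  have h2 := gradSq_cut_le (k := k) (c := c) x
  exact mul_le_mul_of_nonneg_right (by linarith) (cdot_self_nonneg w)

variable (hσ : 0 ≤ σ) (hε0 : 0 ≤ ε) (hε : ε ≤ 1 / 100) (hv : ContDiff ℝ ∞ v)
  (h1 : ∀ c, Integrable fun x => rcomp c (v x) ^ 2)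
  (h2 : ∀ c, Integrable (gradSq fun x => rcomp c (v x)))
include hσ hε0 hε hv h1 h2

theorem integrable_hop_sq : Integrable fun x => cdot (Hop A B v x) (Hop A B v x) * s x := by
  have hd : ∀ c, ContDiff ℝ ∞ fun y => rcomp c (v y) := fun c => (rcomp c).contDiff.comp hv
  have hs := hN.smooth_density.continuous
  set f : ℕ → Eu 3 → Fin 4 → ℂ := fun n x => cut ((n : ℝ) + 1) 0 x • v x with hfd
  have hk : ∀ n : ℕ, (0 : ℝ) < (n : ℝ) + 1 := fun n => by positivity
  have hf : ∀ n, ContDiff ℝ ∞ (f n) := fun n => contDiff_cut.smul hv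
  have hc : ∀ n, HasCompactSupport (f n) := fun n => (hasCompactSupport_cut (hk n) le_rfl).smul_right
  have hcc : ∀ n c, HasCompactSupport fun y => rcomp c (f n y) := fun n c =>
    (hc n).comp_left (map_zero _)
  have hfc : ∀ n c, ContDiff ℝ ∞ fun y => rcomp c (f n y) := fun n c => (rcomp c).contDiff.comp (hf n)
  have efc : ∀ n c x, rcomp c (f n x) = cut ((n : ℝ) + 1) 0 x * rcomp c (v x) := fun n c x => by
    simp [hfd]
  have bd : ∀ n c, ∫ x, kgEnergy a s R m (fun y => rcomp c (f n y)) x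
      ≤ 30 * (m ^ 2 * (∫ x, rcomp c (v x) ^ 2)
        + ∫ x, (2 * gradSq (fun x => rcomp c (v x)) x + 2 * transBd ^ 2 * rcomp c (v x) ^ 2)) := by
    intro n c
    refine (hN.integral_kgEnergy_bounds hσ hε0 hε (hfc n c) (hcc n c)).2.trans ?_
    have l1 : ∫ x, rcomp c (f n x) ^ 2 ≤ ∫ x, rcomp c (v x) ^ 2 := by
      refine integral_mono_of_nonneg (ae_of_all _ fun x => sq_nonneg _) (h1 c)
        (ae_of_all _ fun x => ?_)
      simp only [efc, mul_pow]
      exact mul_le_of_le_one_left (sq_nonneg _) (pow_le_one₀ (cut_nonneg x) (cut_le_one x))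
    have l2 : ∫ x, gradSq (fun y => rcomp c (f n y)) x
        ≤ ∫ x, (2 * gradSq (fun x => rcomp c (v x)) x + 2 * transBd ^ 2 * rcomp c (v x) ^ 2) := by
      refine integral_mono_of_nonneg (ae_of_all _ fun x => gradSq_nonneg _ x)
        (((h2 c).const_mul 2).add ((h1 c).const_mul (2 * transBd ^ 2))) (ae_of_all _ fun x => ?_)
      simp only [efc]
      refine (gradSq_cut_mul_le (hd c) (hk n) x).trans ?_
      have : (transBd / ((n : ℝ) + 1)) ^ 2 ≤ transBd ^ 2 :=
        pow_le_pow_left₀ (div_nonneg transBd_pos.le (hk n).le)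
          (div_le_self transBd_pos.le (by linarith [n.cast_nonneg (α := ℝ)])) 2
      gcongr
    gcongr
  refine (integrable_and_integral_le_of_tendsto
    (F := fun n x => cdot (Hop A B (f n) x) (Hop A B (f n) x) * s x)
    (B := fun _ => ∑ c, 30 * (m ^ 2 * (∫ x, rcomp c (v x) ^ 2)
      + ∫ x, (2 * gradSq (fun x => rcomp c (v x)) x + 2 * transBd ^ 2 * rcomp c (v x) ^ 2)))
    (fun n => ?_) (fun n x => ?_) (ae_of_all _ fun x => ?_) (fun n => ?_) tendsto_const_nhds).1
  · have := (contDiff_Hop D.smooth D.smooth' (hf n)).continuous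
    exact integrable_cdot_mul hs this this (hc n).hop
  · exact mul_nonneg (cdot_self_nonneg _) (hN.density_pos x).le
  · refine tendsto_const_nhds.congr' ?_
    filter_upwards [eventually_cut_nhds_eq_one x] with n hn
    have : f n =ᶠ[𝓝 x] v := by
      filter_upwards [hn] with y hy
      simp only [hfd, hy, one_smul]
    rw [Hop_congr this]
  · rw [D.integral_sq_eq hN (hf n) (hc n)]
    exact Finset.sum_le_sum fun c _ => bd n c

theorem component_le (c : Fin 4 × Bool) :
    m ^ 2 * (∫ x, rcomp c (v x) ^ 2) + ∫ x, gradSq (fun y => rcomp c (v y)) x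
      ≤ 8 * ∫ x, cdot (Hop A B v x) (Hop A B v x) * s x := by
  have iH := D.integrable_hop_sq hN hσ hε0 hε hv h1 h2
  have hd : ∀ c, ContDiff ℝ ∞ fun y => rcomp c (v y) := fun c => (rcomp c).contDiff.comp hv
  have hs := hN.smooth_density.continuous
  set f : ℕ → Eu 3 → Fin 4 → ℂ := fun n x => cut ((n : ℝ) + 1) 0 x • v x with hfd
  have hk : ∀ n : ℕ, (0 : ℝ) < (n : ℝ) + 1 := fun n => by positivity
  have hf : ∀ n, ContDiff ℝ ∞ (f n) := fun n => contDiff_cut.smul hv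
  have hc : ∀ n, HasCompactSupport (f n) := fun n => (hasCompactSupport_cut (hk n) le_rfl).smul_right
  have hcc : ∀ n c, HasCompactSupport fun y => rcomp c (f n y) := fun n c =>
    (hc n).comp_left (map_zero _)
  have hfc : ∀ n c, ContDiff ℝ ∞ fun y => rcomp c (f n y) := fun n c => (rcomp c).contDiff.comp (hf n)
  have efc : ∀ n c x, rcomp c (f n x) = cut ((n : ℝ) + 1) 0 x * rcomp c (v x) := fun n c x => by
    simp [hfd]
  have iv : Integrable fun x => cdot (v x) (v x) := by
    simp only [cdot_self]
    exact integrable_finsetSum _ fun c _ => h1 c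
  have up : ∀ n, ∫ x, cdot (Hop A B (f n) x) (Hop A B (f n) x) * s x
      ≤ 2 * (∫ x, cdot (Hop A B v x) (Hop A B v x) * s x)
        + 48 * (transBd / ((n : ℝ) + 1)) ^ 2 * ∫ x, cdot (v x) (v x) := by
    intro n
    rw [← integral_const_mul, ← integral_const_mul, ← integral_add (iH.const_mul _) (iv.const_mul _)]
    refine integral_mono_of_nonneg
      (ae_of_all _ fun x => mul_nonneg (cdot_self_nonneg _) (hN.density_pos x).le)
      ((iH.const_mul _).add (iv.const_mul _)) (ae_of_all _ fun x => ?_)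
    simp only [hfd]
    rw [Hop_smul (contDiff_cut.diffAt x) (hv.diffAt x)]
    have p1 := cdot_add_self_le (cut ((n : ℝ) + 1) 0 x • Hop A B v x)
      (symb A (cut ((n : ℝ) + 1) 0) x (v x))
    have p2 := D.cdot_symb_cut_le hN (k := (n : ℝ) + 1) hσ (by linarith) 0 x (v x)
    rw [cdot_smul_left, cdot_smul_right, ← mul_assoc] at p1
    have p3 : cutSlope ((n : ℝ) + 1) 0 x ^ 2 ≤ (transBd / ((n : ℝ) + 1)) ^ 2 :=
      pow_le_pow_left₀ (cutSlope_nonneg (hk n) x) (cutSlope_le (hk n) x) 2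
    have p4 : cut ((n : ℝ) + 1) 0 x * cut ((n : ℝ) + 1) 0 x * cdot (Hop A B v x) (Hop A B v x)
        ≤ cdot (Hop A B v x) (Hop A B v x) :=
      mul_le_of_le_one_left (cdot_self_nonneg _)
        (mul_le_one₀ (cut_le_one x) (cut_nonneg x) (cut_le_one x))
    have p5 : 12 * cutSlope ((n : ℝ) + 1) 0 x ^ 2 * cdot (v x) (v x)
        ≤ 12 * (transBd / ((n : ℝ) + 1)) ^ 2 * cdot (v x) (v x) := by
      have := cdot_self_nonneg (v x)
      gcongr
    have hs0 := (hN.density_pos x).le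
    have hs2 := hN.density_le x
    have p6 : 0 ≤ 24 * (transBd / ((n : ℝ) + 1)) ^ 2 * cdot (v x) (v x) :=
      mul_nonneg (by positivity) (cdot_self_nonneg _)
    calc _ ≤ (2 * cdot (Hop A B v x) (Hop A B v x)
          + 24 * (transBd / ((n : ℝ) + 1)) ^ 2 * cdot (v x) (v x)) * s x :=
          mul_le_mul_of_nonneg_right (by linarith) hs0
      _ ≤ _ := by
          have := mul_le_mul_of_nonneg_left hs2 p6
          linarith
  have lim : Tendsto (fun n : ℕ => 4 * (2 * (∫ x, cdot (Hop A B v x) (Hop A B v x) * s x)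
        + 48 * (transBd / ((n : ℝ) + 1)) ^ 2 * ∫ x, cdot (v x) (v x))) atTop
      (𝓝 (4 * (2 * (∫ x, cdot (Hop A B v x) (Hop A B v x) * s x)
        + 48 * 0 ^ 2 * ∫ x, cdot (v x) (v x)))) := by
    have h0 : Tendsto (fun n : ℕ => transBd / ((n : ℝ) + 1)) atTop (𝓝 0) :=
      tendsto_const_nhds.div_atTop
        (tendsto_atTop_add_const_right _ _ tendsto_natCast_atTop_atTop)
    exact ((((h0.pow 2).const_mul 48).mul_const _).const_add _).const_mul 4
  have jv : Integrable fun x => m ^ 2 * rcomp c (v x) ^ 2 + gradSq (fun y => rcomp c (v y)) x :=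
    ((h1 c).const_mul _).add (h2 c)
  have res := (integrable_and_integral_le_of_tendsto (μ := volume)
    (F := fun n x => m ^ 2 * rcomp c (f n x) ^ 2 + gradSq (fun y => rcomp c (f n y)) x)
    (g := fun x => m ^ 2 * rcomp c (v x) ^ 2 + gradSq (fun y => rcomp c (v y)) x)
    (fun n => ?_) (fun n x => ?_) (ae_of_all _ fun x => ?_) (fun n => ?_) lim).2
  · rw [integral_add ((h1 c).const_mul _) (h2 c), integral_const_mul] at res
    linarith
  · have e1 := (hfc n c).continuous
    have e2 := continuous_gradSq ((hfc n c).of_le (by simp))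
    have e3 : HasCompactSupport fun x =>
        m ^ 2 * rcomp c (f n x) ^ 2 + gradSq (fun y => rcomp c (f n y)) x := by
      refine HasCompactSupport.intro (hcc n c).isCompact fun x hx => ?_
      have t0 : rcomp c (f n x) = 0 :=
        image_eq_zero_of_notMem_tsupport (f := fun y => rcomp c (f n y)) hx
      have t1 : ∀ j, pd j (fun y => rcomp c (f n y)) x = 0 := fun j =>
        image_eq_zero_of_notMem_tsupport fun h => hx (tsupport_fderiv_apply_subset ℝ _ h)
      simp [gradSq, t0, t1]
    exact Continuous.integrable_of_hasCompactSupport (by fun_prop) e3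
  · have := gradSq_nonneg (fun y => rcomp c (f n y)) x
    positivity
  · refine tendsto_const_nhds.congr' ?_
    filter_upwards [eventually_cut_nhds_eq_one x] with n hn
    have : (fun y => rcomp c (f n y)) =ᶠ[𝓝 x] fun y => rcomp c (v y) := by
      filter_upwards [hn] with y hy
      simp only [hfd, hy, one_smul]
    have t0 := this.eq_of_nhds
    simp only [gradSq, pd_congr this, t0]
  · have e1 : Integrable fun x => rcomp c (f n x) ^ 2 := by
      have := (hfc n c).continuous
      have h : HasCompactSupport fun x => rcomp c (f n x) ^ 2 :=
        (hcc n c).comp_left (g := fun r : ℝ => r ^ 2) (by norm_num)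
      exact Continuous.integrable_of_hasCompactSupport (by fun_prop) h
    have e2 : Integrable (gradSq fun y => rcomp c (f n y)) := by
      refine (continuous_gradSq ((hfc n c).of_le (by simp))).integrable_of_hasCompactSupport
        (HasCompactSupport.intro (hcc n c).isCompact fun x hx => ?_)
      have t1 : ∀ j, pd j (fun y => rcomp c (f n y)) x = 0 := fun j =>
        image_eq_zero_of_notMem_tsupport fun h => hx (tsupport_fderiv_apply_subset ℝ _ h)
      simp [gradSq, t1]
    rw [integral_add (e1.const_mul _) e2, integral_const_mul]
    have b := fun c => (hN.integral_kgEnergy_bounds (m := m) hσ hε0 hε (hfc n c) (hcc n c)).1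
    have b0 : ∀ c, 0 ≤ ∫ x, kgEnergy a s R m (fun y => rcomp c (f n y)) x := fun c => by
      have t1 : 0 ≤ m ^ 2 * ∫ x, rcomp c (f n x) ^ 2 :=
        mul_nonneg (sq_nonneg m) (integral_nonneg fun x => sq_nonneg _)
      have t2 : 0 ≤ ∫ x, gradSq (fun y => rcomp c (f n y)) x :=
        integral_nonneg fun x => gradSq_nonneg _ x
      linarith [b c]
    have e3 : ∫ x, kgEnergy a s R m (fun y => rcomp c (f n y)) x
        ≤ ∫ x, cdot (Hop A B (f n) x) (Hop A B (f n) x) * s x := by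
      rw [D.integral_sq_eq hN (hf n) (hc n)]
      exact Finset.single_le_sum (f := fun c => ∫ x, kgEnergy a s R m (fun y => rcomp c (f n y)) x)
        (fun c _ => b0 c) (Finset.mem_univ c)
    linarith [b c, up n]

end DiracOp

end StaticDirac

section Conservation

variable {a : Fin 3 → Fin 3 → Eu 3 → ℝ} {s R : Eu 3 → ℝ} {m σ ε k T : ℝ}
  {A : Fin 3 → Eu 3 → Fin 4 → Fin 4 → ℂ} {B : Eu 3 → Fin 4 → Fin 4 → ℂ} {φ : ℝ → ℝ}
  {v : Eu 3 → Fin 4 → ℂ} {w : ℝ → Eu 3 → Fin 4 → ℂ}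

/-- The rate of change of `∫ cut |w|²` along `φ ∂ₜ w = -i H w` when the parameter of the
cutoff moves with speed `4 / φ`. -/
def cutFlux (A : Fin 3 → Eu 3 → Fin 4 → Fin 4 → ℂ) (B : Eu 3 → Fin 4 → Fin 4 → ℂ) (k c : ℝ)
    (v : Eu 3 → Fin 4 → ℂ) (x : Eu 3) : ℝ :=
  -4 * cutSlope k c x * cdot (v x) (v x) - 2 * cut k c x * cdot (v x) (Complex.I • Hop A B v x)

theorem cutFlux_eq_zero (hk : 0 < k) {c : ℝ} {x : Eu 3} (hx : 2 * k < pw 1 (1 / 2) x + c) :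
    cutFlux A B k c v x = 0 := by
  simp [cutFlux, cutSlope_eq_zero hk hx, cut_eq_zero hk hx.le]

theorem cut_sq_mul_cutFlux (hk : 0 < k) {c : ℝ} (hc : 0 ≤ c) (x : Eu 3) :
    cut (2 * k) 0 x ^ 2 * cutFlux A B k c v x = cutFlux A B k c v x := by
  rcases lt_or_ge (2 * k) (pw 1 (1 / 2) x + c) with h | h
  · rw [cutFlux_eq_zero hk h, mul_zero]
  · rw [cut_eq_one (by positivity) (by linarith), one_pow, one_mul]

theorem DiracOp.integral_cutFlux_nonpos (D : DiracOp a s R m A B) (hN : NearFlat σ ε a s R)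
    (hσ : 0 ≤ σ) (hε : ε ≤ 1) (hk : 0 < k) {c : ℝ} (hc : 0 ≤ c) (hv : ContDiff ℝ ∞ v) :
    ∫ x, cutFlux A B k c v x * s x ≤ 0 := by
  have hs := hN.smooth_density.continuous
  have cH := (contDiff_Hop D.smooth D.smooth' hv).continuous
  have ccut : Continuous (cut k c) := contDiff_cut.continuous
  have hcc : HasCompactSupport (cut k c) := hasCompactSupport_cut hk hc
  have cχ : ContDiff ℝ ∞ fun x => cut k c x • v x := contDiff_cut.smul hv
  have hg : ContDiff ℝ ∞ fun x => Complex.I • (cut k c x • v x) := cχ.const_smul Complex.I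
  have hgc : HasCompactSupport fun x => Complex.I • (cut k c x • v x) :=
    HasCompactSupport.smul_left (f := fun _ => Complex.I) (f' := fun x => cut k c x • v x)
      hcc.smul_right
  have e := D.symm_of_compact_right hv hg hgc
  have hop : ∀ x, Hop A B (fun x => Complex.I • (cut k c x • v x)) x
      = cut k c x • (Complex.I • Hop A B v x) + Complex.I • symb A (cut k c) x (v x) := fun x => by
    rw [Hop_const_smul _ (cχ.diffAt x), Hop_smul (contDiff_cut.diffAt x) (hv.diffAt x), smul_add,
      smul_comm]
  have l1 : ∀ x, cdot (Hop A B v x) (Complex.I • (cut k c x • v x))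
      = -(cut k c x * cdot (v x) (Complex.I • Hop A B v x)) := fun x => by
    rw [cdot_comm, cdot_I_smul_left, cdot_smul_left]
  simp only [hop, l1, cdot_add_right, cdot_smul_right] at e
  have csy := continuous_symb D.smooth (contDiff_cut (k := k) (c := c)) hv.continuous
  have cI : Continuous fun x => Complex.I • Hop A B v x := cH.fun_const_smul _
  have cIs : Continuous fun x => Complex.I • symb A (cut k c) x (v x) := csy.fun_const_smul _
  have k1 := continuous_cdot hv.continuous cI
  have k2 := continuous_cdot hv.continuous cIs
  have i1 : Integrable fun x => cut k c x * cdot (v x) (Complex.I • Hop A B v x) * s x := by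
    have h : HasCompactSupport fun x => cut k c x * cdot (v x) (Complex.I • Hop A B v x) * s x :=
      hcc.mul_right.mul_right
    exact Continuous.integrable_of_hasCompactSupport (by fun_prop) h
  have hsl : ∀ x, x ∉ Metric.closedBall (0 : Eu 3) (2 * k) → 2 * k < pw 1 (1 / 2) x + c :=
    fun x hx => by
      rw [mem_closedBall_zero_iff, not_le] at hx
      linarith [norm_le_pw_half (S := 1) x]
  have symb0 : ∀ x, 2 * k < pw 1 (1 / 2) x + c → symb A (cut k c) x (v x) = 0 := fun x hx => by
    simp [symb, pd_cut, cutSlope_eq_zero hk hx]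
  have i2 : Integrable fun x => cdot (v x) (Complex.I • symb A (cut k c) x (v x)) * s x := by
    have h : HasCompactSupport fun x =>
        cdot (v x) (Complex.I • symb A (cut k c) x (v x)) * s x :=
      HasCompactSupport.intro (isCompact_closedBall (0 : Eu 3) (2 * k)) fun x hx => by
        rw [symb0 x (hsl x hx), smul_zero, cdot_zero_right, zero_mul]
    exact Continuous.integrable_of_hasCompactSupport (by fun_prop) h
  have i3 : Integrable fun x => cutSlope k c x * cdot (v x) (v x) * s x := by
    have h : HasCompactSupport fun x => cutSlope k c x * cdot (v x) (v x) * s x :=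
      HasCompactSupport.intro (isCompact_closedBall (0 : Eu 3) (2 * k)) fun x hx => by
        rw [cutSlope_eq_zero hk (hsl x hx), zero_mul, zero_mul]
    have c1 := continuous_cutSlope (k := k) (c := c)
    have c2 := continuous_cdot hv.continuous hv.continuous
    exact Continuous.integrable_of_hasCompactSupport (by fun_prop) h
  simp only [add_mul] at e
  rw [integral_add i1 i2] at e
  simp only [neg_mul] at e
  rw [integral_neg] at e
  have e2 : ∫ x, cutFlux A B k c v x * s x
      = -4 * (∫ x, cutSlope k c x * cdot (v x) (v x) * s x)
        - 2 * ∫ x, cut k c x * cdot (v x) (Complex.I • Hop A B v x) * s x := by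
    rw [← integral_const_mul, ← integral_const_mul,
      ← integral_sub (i3.const_mul _) (i1.const_mul _)]
    refine integral_congr_ae (ae_of_all _ fun x => ?_)
    simp only [cutFlux]; ring
  have e3 : ∫ x, cdot (v x) (Complex.I • symb A (cut k c) x (v x)) * s x
      ≤ ∫ x, 4 * (cutSlope k c x * cdot (v x) (v x) * s x) := by
    refine integral_mono i2 (i3.const_mul 4) fun x => ?_
    have q := cdot_self_nonneg (v x)
    have sl := cutSlope_nonneg (c := c) hk x
    have h1 := D.cdot_symb_cut_le hN hσ hε (k := k) c x (v x)
    have h2 := (le_abs_self _).trans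
      (abs_cdot_le (v x) (Complex.I • symb A (cut k c) x (v x)))
    rw [cdot_I_smul_self] at h2
    have h3 : √(cdot (symb A (cut k c) x (v x)) (symb A (cut k c) x (v x)))
        ≤ 4 * cutSlope k c x * √(cdot (v x) (v x)) := by
      refine Real.sqrt_le_iff.2 ⟨by positivity, h1.trans ?_⟩
      rw [mul_pow, Real.sq_sqrt q]
      nlinarith [mul_nonneg (sq_nonneg (cutSlope k c x)) q]
    have h4 : cdot (v x) (Complex.I • symb A (cut k c) x (v x))
        ≤ 4 * (cutSlope k c x * cdot (v x) (v x)) := by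
      refine h2.trans ((mul_le_mul_of_nonneg_left h3 (Real.sqrt_nonneg _)).trans (le_of_eq ?_))
      have := Real.mul_self_sqrt q
      linear_combination (4 * cutSlope k c x) * this
    have := mul_le_mul_of_nonneg_right h4 (hN.density_pos x).le
    linarith
  rw [integral_const_mul] at e3
  linarith

theorem hasDerivAt_cdot_self {w : ℝ → Fin 4 → ℂ} {w' : Fin 4 → ℂ} {t : ℝ}
    (h : HasDerivAt w w' t) : HasDerivAt (fun r => cdot (w r) (w r)) (2 * cdot (w t) w') t := by
  have h1 : ∀ c, HasDerivAt (fun r => rcomp c (w r)) (rcomp c w') t := fun c =>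
    (rcomp c).hasFDerivAt.comp_hasDerivAt t h
  refine (HasDerivAt.fun_sum (u := Finset.univ)
    fun c _ => (h1 c).fun_mul (h1 c)).congr_deriv ?_
  simp only [cdot, Finset.mul_sum]
  exact Finset.sum_congr rfl fun c _ => by ring

theorem DiracOp.integrable_and_integral_sq_le (D : DiracOp a s R m A B)
    (hN : NearFlat σ ε a s R) (hσ : 0 ≤ σ) (hε : ε ≤ 1) (hw : SmoothST w)
    (hφ : ContinuousOn φ (Ici 0)) (hφ0 : ∀ t, 0 ≤ t → 0 < φ t)
    (hd : ∀ t, 0 < t → ∀ x,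
      HasDerivAt (fun r => w r x) (-((φ t)⁻¹ • (Complex.I • Hop A B (w t) x))) t)
    (hi : Integrable fun x => cdot (w 0 x) (w 0 x) * s x) (hT : 0 ≤ T) :
    Integrable (fun x => cdot (w T x) (w T x) * s x) ∧
      ∫ x, cdot (w T x) (w T x) * s x ≤ ∫ x, cdot (w 0 x) (w 0 x) * s x := by
  have hs := hN.smooth_density.continuous
  have cφ := continuousOn_inv_weight hφ hφ0
  have iφ : IntegrableOn (fun t => (φ t)⁻¹) (Icc 0 T) :=
    (cφ.mono fun t ht => ht.1).integrableOn_compact isCompact_Icc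
  set τ : ℝ → ℝ := fun t => 4 * ∫ r in (0 : ℝ)..t, (φ r)⁻¹ with hτ
  have iφ' : ∀ t, 0 ≤ t → IntervalIntegrable (fun r => (φ r)⁻¹) volume 0 t := fun t ht =>
    (cφ.mono fun r hr => hr.1).intervalIntegrable_of_Icc ht
  have hτ0 : ∀ t, 0 ≤ t → 0 ≤ τ t := fun t ht =>
    mul_nonneg (by norm_num) (intervalIntegral.integral_nonneg ht fun r hr =>
      (inv_pos.2 (hφ0 r hr.1)).le)
  have dτ : ∀ t, 0 < t → HasDerivAt τ (4 * (φ t)⁻¹) t := fun t ht => by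
    have hc : ContinuousAt (fun r => (φ r)⁻¹) t := cφ.continuousAt (Ici_mem_nhds ht)
    refine (intervalIntegral.integral_hasDerivAt_right (iφ' t ht.le) ?_ hc).const_mul 4
    exact (cφ.mono Ioi_subset_Ici_self).stronglyMeasurableAtFilter isOpen_Ioi t ht
  have cτ : ContinuousOn τ (Ici 0) := fun t ht => by
    have h1 : ContinuousOn (fun x => ∫ r in (0 : ℝ)..x, (φ r)⁻¹) (uIcc 0 (t + 1)) :=
      intervalIntegral.continuousOn_primitive_interval (by
        rw [uIcc_of_le (by linarith [mem_Ici.1 ht])]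
        exact (cφ.mono fun t ht => ht.1).integrableOn_compact isCompact_Icc)
    rw [uIcc_of_le (by linarith [mem_Ici.1 ht])] at h1
    have h2 := h1 t ⟨ht, by linarith⟩
    refine (h2.mono_of_mem_nhdsWithin ?_).const_mul 4
    rw [← Ici_inter_Iic]
    exact inter_mem_nhdsWithin _ (Iic_mem_nhds (by linarith))
  have step : ∀ k : ℝ, 0 < k → ∫ x, cut k (τ T) x * cdot (w T x) (w T x) * s x
      ≤ ∫ x, cdot (w 0 x) (w 0 x) * s x := by
    intro k hk
    set Q : ℝ → Eu 3 → ℝ := fun t x => cutFlux A B k (τ t) (w t) x * s x with hQ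
    have sW := (hw.hop D.smooth D.smooth' (u := w)).continuousOn
    have sw := hw.continuousOn
    have hτc : ContinuousOn (fun p : ℝ × Eu 3 => τ p.1) halfST :=
      cτ.comp continuousOn_fst fun p hp => hp.1
    have hp := (contDiff_pw one_pos (1 / 2)).continuous
    have jc : ContinuousOn (fun p : ℝ × Eu 3 => 2 - (pw 1 (1 / 2) p.2 + τ p.1) / k) halfST :=
      continuousOn_const.sub (((hp.comp continuous_snd).continuousOn.add hτc).div_const k)
    have j1 : ContinuousOn (fun p : ℝ × Eu 3 => cut k (τ p.1) p.2) halfST :=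
      Real.smoothTransition.continuous.comp_continuousOn jc
    have j2 : ContinuousOn (fun p : ℝ × Eu 3 => cutSlope k (τ p.1) p.2) halfST :=
      (((Real.smoothTransition.contDiff (n := 1)).continuous_deriv
        (by simp)).comp_continuousOn jc).div_const k
    have cd : ∀ {f g : ℝ × Eu 3 → Fin 4 → ℂ}, ContinuousOn f halfST → ContinuousOn g halfST →
        ContinuousOn (fun p => cdot (f p) (g p)) halfST := fun hf hg =>
      (continuous_cdot continuous_fst continuous_snd).comp_continuousOn (hf.prodMk hg)
    have j3 := cd sw sw
    have j4 := cd sw (sW.const_smul Complex.I)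
    have cQ : ContinuousOn (fun p : ℝ × Eu 3 => Q p.1 p.2) halfST := by
      have j5 : ContinuousOn (fun p : ℝ × Eu 3 => s p.2) halfST := by fun_prop
      exact (((continuousOn_const.mul j2).mul j3).sub
        ((continuousOn_const.mul j1).mul j4)).mul j5
    have iQ := integrable_box hφ hφ0 cQ (k := 2 * k) (by positivity) T
    have hcut : ∀ t, 0 ≤ t → ∀ x, cut (2 * k) 0 x ^ 2 * Q t x = Q t x := fun t ht x => by
      rw [hQ, ← mul_assoc, cut_sq_mul_cutFlux hk (hτ0 t ht)]
    have hder : ∀ t, 0 < t → ∀ x, HasDerivAt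
        (fun r => cut k (τ r) x * cdot (w r x) (w r x) * s x) ((φ t)⁻¹ * Q t x) t :=
      fun t ht x => by
        have d1 := (hasDerivAt_cut (k := k) (c := τ t) x).comp t (dτ t ht)
        have d2 := hasDerivAt_cdot_self (hd t ht x)
        refine ((d1.fun_mul d2).mul_const (s x)).congr_deriv ?_
        simp only [hQ, cutFlux, cdot_neg_right, cdot_smul_right, Function.comp]
        ring
    have slice : ∀ x, ContinuousOn (fun t : ℝ => ((t, x) : ℝ × Eu 3)) (Ici 0) := fun x => by
      fun_prop
    have ftc : ∀ x, ∫ t in Ioc 0 T, (φ t)⁻¹ * (cut (2 * k) 0 x ^ 2 * Q t x)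
        = cut k (τ T) x * cdot (w T x) (w T x) * s x
          - cut k (τ 0) x * cdot (w 0 x) (w 0 x) * s x := fun x => by
      have c1 : ContinuousOn (fun t => (φ t)⁻¹ * Q t x) (Icc 0 T) :=
        (cφ.mul (cQ.comp (slice x) fun t ht => ⟨ht, mem_univ _⟩)).mono fun t ht => ht.1
      have c2 : ContinuousOn (fun t => cut k (τ t) x * cdot (w t x) (w t x) * s x) (Icc 0 T) :=
        (((j1.mul j3).comp (slice x) fun t ht => ⟨ht, mem_univ _⟩).mul_const (s x)).mono
          fun t ht => ht.1
      have := intervalIntegral.integral_eq_sub_of_hasDerivAt_of_le hT c2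
        (fun t ht => hder t ht.1 x) (c1.intervalIntegrable_of_Icc hT)
      rw [intervalIntegral.integral_of_le hT] at this
      rw [← this]
      exact setIntegral_congr_fun measurableSet_Ioc fun t ht => by
        simp only [hcut t ht.1.le]
    have swap := integral_integral_swap iQ
    simp only [ftc] at swap
    have ic : ∀ t, 0 ≤ t → Integrable fun x => cut k (τ t) x * cdot (w t x) (w t x) * s x :=
      fun t ht => by
        have h : HasCompactSupport fun x => cut k (τ t) x * cdot (w t x) (w t x) * s x :=
          (hasCompactSupport_cut hk (hτ0 t ht)).mul_right.mul_right
        have c1 := (contDiff_cut (k := k) (c := τ t)).continuous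
        have c2 := continuous_cdot (hw.contDiff ht).continuous (hw.contDiff ht).continuous
        exact Continuous.integrable_of_hasCompactSupport (by fun_prop) h
    rw [integral_sub (ic T hT) (ic 0 le_rfl)] at swap
    have np : ∫ t in Ioc 0 T, ∫ x, (φ t)⁻¹ * (cut (2 * k) 0 x ^ 2 * Q t x) ≤ 0 := by
      refine setIntegral_nonpos measurableSet_Ioc fun t ht => ?_
      simp only [hcut t ht.1.le]
      rw [integral_const_mul]
      exact mul_nonpos_of_nonneg_of_nonpos (inv_pos.2 (hφ0 t ht.1.le)).le
        (D.integral_cutFlux_nonpos hN hσ hε hk (hτ0 t ht.1.le) (hw.contDiff ht.1.le))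
    have fin : ∫ x, cut k (τ 0) x * cdot (w 0 x) (w 0 x) * s x
        ≤ ∫ x, cdot (w 0 x) (w 0 x) * s x := by
      refine integral_mono (ic 0 le_rfl) hi fun x => ?_
      have := mul_nonneg (cdot_self_nonneg (w 0 x)) (hN.density_pos x).le
      simp only [mul_assoc]
      exact mul_le_of_le_one_left this (cut_le_one x)
    linarith
  refine integrable_and_integral_le_of_tendsto
    (F := fun n : ℕ => fun x => cut ((n : ℝ) + 1) (τ T) x * cdot (w T x) (w T x) * s x)
    (B := fun _ => ∫ x, cdot (w 0 x) (w 0 x) * s x)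
    (fun n => ?_) (fun n x => ?_) (ae_of_all _ fun x => ?_) (fun n => step _ (by positivity))
    tendsto_const_nhds
  · have h : HasCompactSupport fun x =>
        cut ((n : ℝ) + 1) (τ T) x * cdot (w T x) (w T x) * s x :=
      (hasCompactSupport_cut (by positivity) (hτ0 T hT)).mul_right.mul_right
    have c1 := (contDiff_cut (k := (n : ℝ) + 1) (c := τ T)).continuous
    have c2 := continuous_cdot (hw.contDiff hT).continuous (hw.contDiff hT).continuous
    exact Continuous.integrable_of_hasCompactSupport (by fun_prop) h
  · exact mul_nonneg (mul_nonneg (cut_nonneg x) (cdot_self_nonneg _)) (hN.density_pos x).le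
  · refine tendsto_const_nhds.congr' ?_
    have h := (tendsto_atTop_add_const_right atTop (1 : ℝ)
      (tendsto_natCast_atTop_atTop (R := ℝ))).eventually (eventually_cut_eq_one (τ T) x)
    filter_upwards [h] with n hn
    rw [hn, one_mul]

end Conservation

section Assembly

variable {h : Eu 3 → Matrix (Fin 3) (Fin 3) ℝ} {m σ ε : ℝ}
  {A : Fin 3 → Eu 3 → Fin 4 → Fin 4 → ℂ} {B : Eu 3 → Fin 4 → Fin 4 → ℂ} {φ : ℝ → ℝ}
  {u : ℝ → Eu 3 → Fin 4 → ℂ}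

theorem clm_lapC (L : ℂ →L[ℝ] ℝ) (ha : ∀ j k, ContDiff ℝ ∞ fun x => (h x)⁻¹ j k)
    (hs : ContDiff ℝ ∞ (sdet h)) {f : Eu 3 → ℂ} (hf : ContDiff ℝ ∞ f) (x : Eu 3) :
    L (lapC h f x) = lapS (fun j k x => (h x)⁻¹ j k) (sdet h) (fun y => L (f y)) x := by
  have hd : ∀ j, ContDiff ℝ ∞ fun y => sdet h y • ∑ k, (h y)⁻¹ j k • pd k f y := fun j =>
    hs.smul (ContDiff.sum fun k _ => (ha j k).smul (hf.pd k))
  simp only [lapC, lapS, flow, ← Complex.ofReal_inv, ← Complex.real_smul, map_smul, map_sum,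
    smul_eq_mul, ← pd_clm L ((hd _).diffAt x), pd_clm L (hf.diffAt _)]

theorem re_innC4 (hs : ContDiff ℝ ∞ (sdet h)) {f g : Eu 3 → Fin 4 → ℂ} (hf : Continuous f)
    (hg : Continuous g) (hc : HasCompactSupport g) :
    (innC4 h f g).re = ∫ x, cdot (f x) (g x) * sdet h x := by
  have hi : Integrable fun x => (∑ i, (starRingEnd ℂ) (f x i) * g x i) * ((sdet h x : ℝ) : ℂ) := by
    have h1 : HasCompactSupport fun x =>
        (∑ i, (starRingEnd ℂ) (f x i) * g x i) * ((sdet h x : ℝ) : ℂ) :=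
      HasCompactSupport.intro hc.isCompact fun x hx => by
        simp [image_eq_zero_of_notMem_tsupport hx]
    have h2 := hs.continuous
    have h3 : Continuous fun x => ∑ i, (starRingEnd ℂ) (f x i) * g x i :=
      continuous_finsetSum _ fun i _ =>
        (Complex.continuous_conj.comp ((continuous_apply i).comp hf)).mul
          ((continuous_apply i).comp hg)
    exact (h3.mul (Complex.continuous_ofReal.comp h2)).integrable_of_hasCompactSupport h1
  have h4 := Complex.reCLM.integral_comp_comm hi
  simp only [Complex.reCLM_apply, Complex.re_mul_ofReal, ← cdot_eq_re] at h4
  rw [innC4, ← h4]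

theorem diracOp_of_sq_eq (ha : ∀ j k, ContDiff ℝ ∞ fun x => (h x)⁻¹ j k)
    (hs : ContDiff ℝ ∞ (sdet h)) (hA : ∀ j i k, ContDiff ℝ ∞ fun x => A j x i k)
    (hB : ∀ i k, ContDiff ℝ ∞ fun x => B x i k)
    (hsymm : ∀ f g : Eu 3 → Fin 4 → ℂ, ContDiff ℝ ∞ f → ContDiff ℝ ∞ g →
      HasCompactSupport f → HasCompactSupport g → innC4 h (Hop A B f) g = innC4 h f (Hop A B g))
    (hsq : ∀ f : Eu 3 → Fin 4 → ℂ, ContDiff ℝ ∞ f → ∀ (x : Eu 3) (i : Fin 4),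
      Hop A B (Hop A B f) x i = ((m : ℂ) ^ 2) * f x i - lapC h (fun y => f y i) x
        + ((Rscal h x / 4 : ℝ) : ℂ) * f x i) :
    DiracOp (fun j k x => (h x)⁻¹ j k) (sdet h) (Rscal h) m A B where
  smooth := hA
  smooth' := hB
  symm f g hf hg hfc hgc := by
    rw [← re_innC4 hs (contDiff_Hop hA hB hf).continuous hg.continuous hgc,
      ← re_innC4 hs hf.continuous (contDiff_Hop hA hB hg).continuous hgc.hop,
      hsymm f g hf hg hfc hgc]
  comp_sq f hf x c := by
    set L : ℂ →L[ℝ] ℝ := if c.2 then Complex.reCLM else Complex.imCLM with hL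
    have hr : ∀ v : Fin 4 → ℂ, rcomp c v = L (v c.1) := fun v => rfl
    have hfi : ContDiff ℝ ∞ fun y => f y c.1 := contDiff_pi.1 hf c.1
    simp only [hr]
    rw [hsq f hf x c.1, ← Complex.ofReal_pow, ← Complex.real_smul, ← Complex.real_smul, map_add,
      map_sub, map_smul, map_smul, clm_lapC L ha hs hfi, kgForce, smul_eq_mul, smul_eq_mul]
    ring

theorem SchwartzMap.integrable_rcomp_sq (F : SchwartzMap (Eu 3) (Fin 4 → ℂ)) (c : Fin 4 × Bool) :
    Integrable (fun x => rcomp c (F x) ^ 2) ∧ Integrable (gradSq fun x => rcomp c (F x)) := by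
  have hF : ∀ x, DifferentiableAt ℝ F x := fun x => F.differentiableAt
  constructor
  · exact ((rcomp c).comp_memLp' (F.memLp 2 volume)).integrable_sq
  · refine integrable_finsetSum _ fun j _ => ?_
    have h1 : (fun x => pd j (fun x => rcomp c (F x)) x)
        = fun x => (rcomp c).comp (ContinuousLinearMap.apply ℝ (Fin 4 → ℂ)
          (EuclideanSpace.single j (1 : ℝ) : Eu 3)) (SchwartzMap.fderivCLM ℝ (Eu 3) _ F x) :=
      funext fun x => pd_clm _ (hF x) j
    have h2 := ((rcomp c).comp (ContinuousLinearMap.apply ℝ (Fin 4 → ℂ)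
      (EuclideanSpace.single j (1 : ℝ) : Eu 3))).comp_memLp'
        ((SchwartzMap.fderivCLM ℝ (Eu 3) _ F).memLp 2 volume)
    have h3 : MemLp (fun x => pd j (fun x => rcomp c (F x)) x) 2 := by rw [h1]; exact h2
    exact h3.integrable_sq

theorem SmoothST.hasDerivAt_of_dirac (hu : SmoothST u) {t : ℝ} (ht : 0 < t) (hφ : 0 < φ t)
    {x : Eu 3} (hd : ∀ i, Complex.I * ((φ t : ℝ) : ℂ) *
      derivWithin (fun s => u s x i) (Ici 0) t = Hop A B (u t) x i) :
    HasDerivAt (fun r => u r x) (-((φ t)⁻¹ • (Complex.I • Hop A B (u t) x))) t := by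
  have h1 : DifferentiableAt ℝ (fun p : ℝ × Eu 3 => u p.1 p.2) (t, x) :=
    (ContDiffOn.contDiffAt hu (halfST_mem_nhds ht)).differentiableAt (by simp)
  have h2 := h1.hasFDerivAt.time_slice
  refine hasDerivAt_pi.2 fun i => ?_
  have h3 := hasDerivAt_pi.1 h2 i
  have h4 := hd i
  rw [derivWithin_of_mem_nhds (Ici_mem_nhds ht), h3.deriv] at h4
  refine h3.congr_deriv ?_
  simp only [Pi.neg_apply, Pi.smul_apply, ← h4, smul_eq_mul, Complex.real_smul]
  have : ((φ t : ℝ) : ℂ) ≠ 0 := by exact_mod_cast hφ.ne'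
  push_cast
  field_simp
  rw [Complex.I_sq]
  ring

variable {a : Fin 3 → Fin 3 → Eu 3 → ℝ} {s R : Eu 3 → ℝ}

theorem DiracOp.smoothing (D : DiracOp a s R m A B) (hN : NearFlat σ ε a s R)
    (hσ : σ ∈ Ioo (0 : ℝ) 1) (hε0 : 0 ≤ ε) (hε : ε ≤ 1 / 100) (hε' : 104000 * ε ≤ σ)
    (hφ : ContinuousOn φ (Ici 0)) (hφ0 : ∀ t, 0 ≤ t → 0 < φ t) (hu : SmoothST u)
    (h1 : ∀ t, 0 ≤ t → ∀ c, Integrable fun x => rcomp c (u t x) ^ 2)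
    (h2 : ∀ t, 0 ≤ t → ∀ c, Integrable (gradSq fun x => rcomp c (u t x)))
    (hd : ∀ t, 0 < t → ∀ x,
      HasDerivAt (fun r => u r x) (-((φ t)⁻¹ • (Complex.I • Hop A B (u t) x))) t)
    {S : ℝ} (hS : 1 ≤ S) (c : Fin 4 × Bool) :
    ∫⁻ p, ENNReal.ofReal ((φ p.1)⁻¹ * smoothingDensity S (fun x => rcomp c (u p.1 x)) p.2) ∂volST
      ≤ ENNReal.ofReal (3200 * ∫ x, cdot (Hop A B (u 0) x) (Hop A B (u 0) x) * s x) := by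
  have hw : SmoothST fun t => Hop A B (u t) := hu.hop D.smooth D.smooth'
  have hww : SmoothST fun t => Hop A B (Hop A B (u t)) := hw.hop D.smooth D.smooth'
  have hdw : ∀ t, 0 < t → ∀ x, HasDerivAt (fun r => Hop A B (u r) x)
      (-((φ t)⁻¹ • (Complex.I • Hop A B (Hop A B (u t)) x))) t := fun t ht x => by
    refine (hu.hasDerivAt_hop hd ht x).congr_deriv ?_
    have e : ∀ v : Fin 4 → ℂ, -((φ t)⁻¹ • (Complex.I • v))
        = (-(((φ t)⁻¹ : ℝ) * Complex.I) : ℂ) • v := fun v => by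
      ext i
      simp [mul_assoc]
    simp only [e]
    exact Hop_const_smul _ ((hw.contDiff ht.le).diffAt x)
  have hi : ∀ t, 0 ≤ t → Integrable fun x => cdot (Hop A B (u t) x) (Hop A B (u t) x) * s x :=
    fun t ht => D.integrable_hop_sq hN hσ.1.le hε0 hε (hu.contDiff ht) (h1 t ht) (h2 t ht)
  set E := ∫ x, cdot (Hop A B (u 0) x) (Hop A B (u 0) x) * s x with hE
  have hEt : ∀ t, 0 ≤ t → ∫ x, cdot (Hop A B (u t) x) (Hop A B (u t) x) * s x ≤ E := fun t ht =>
    (D.integrable_and_integral_sq_le hN hσ.1.le (by linarith) hw hφ hφ0 hdw (hi 0 le_rfl) ht).2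
  have sol : KGSolution a s R m φ (fun t x => rcomp c (u t x))
      (fun t x => rcomp c (-(Complex.I • Hop A B (u t) x)))
      (fun t x => rcomp c (-Hop A B (Hop A B (u t)) x)) := by
    refine ⟨hu.clm _, ?_, ?_, hφ, hφ0, fun t ht x => ?_, fun t ht x => ?_, fun t ht => ?_⟩
    · exact SmoothST.clm (U := fun t x => -(Complex.I • Hop A B (u t) x))
        (ContDiffOn.neg (ContDiffOn.const_smul Complex.I hw)) _
    · exact SmoothST.clm (U := fun t x => -Hop A B (Hop A B (u t)) x) (ContDiffOn.neg hww) _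
    · refine ((rcomp c).hasFDerivAt.comp_hasDerivAt t (hd t ht x)).congr_deriv ?_
      rw [← smul_neg, map_smul, smul_eq_mul]
    · refine ((rcomp c).hasFDerivAt.comp_hasDerivAt t
        ((hdw t ht x).const_smul Complex.I).neg).congr_deriv ?_
      rw [← smul_eq_mul (φ t)⁻¹, ← map_smul]
      congr 1
      rw [smul_neg, neg_neg, smul_comm, smul_smul Complex.I, Complex.I_mul_I, neg_one_smul]
    · funext x
      rw [map_neg, D.comp_sq _ (hu.contDiff ht), neg_neg]
  have fe : ∀ t, 0 ≤ t → FiniteEnergy m (8 * E) (fun x => rcomp c (u t x))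
      (fun x => rcomp c (-(Complex.I • Hop A B (u t) x))) := fun t ht => by
    have b := D.component_le hN hσ.1.le hε0 hε (hu.contDiff ht) (h1 t ht) (h2 t ht) c
    have b1 : 0 ≤ m ^ 2 * ∫ x, rcomp c (u t x) ^ 2 :=
      mul_nonneg (sq_nonneg m) (integral_nonneg fun x => sq_nonneg _)
    have b2 : 0 ≤ ∫ x, gradSq (fun y => rcomp c (u t y)) x :=
      integral_nonneg fun x => gradSq_nonneg _ x
    have b3 := hEt t ht
    have cβ : ContDiff ℝ ∞ fun x => rcomp c (-(Complex.I • Hop A B (u t) x)) :=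
      (rcomp c).contDiff.comp ((hw.contDiff ht).const_smul Complex.I).neg
    have le : ∀ x, rcomp c (-(Complex.I • Hop A B (u t) x)) ^ 2
        ≤ 2 * (cdot (Hop A B (u t) x) (Hop A B (u t) x) * s x) := fun x => by
      rw [map_neg, neg_sq]
      have e1 : rcomp c (Complex.I • Hop A B (u t) x) ^ 2
          ≤ cdot (Hop A B (u t) x) (Hop A B (u t) x) := by
        rw [← cdot_I_smul_self, cdot_self]
        exact Finset.single_le_sum (f := fun c => rcomp c (Complex.I • Hop A B (u t) x) ^ 2)
          (fun c _ => sq_nonneg _) (Finset.mem_univ c)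
      have e2 := mul_le_mul_of_nonneg_left (hN.half_le_density x)
        (cdot_self_nonneg (Hop A B (u t) x))
      linarith
    have iβ : Integrable fun x => rcomp c (-(Complex.I • Hop A B (u t) x)) ^ 2 := by
      refine ((hi t ht).const_mul 2).mono' (cβ.continuous.pow 2).aestronglyMeasurable
        (ae_of_all _ fun x => ?_)
      rw [Real.norm_of_nonneg (sq_nonneg _)]
      exact le x
    have b4 := integral_mono iβ ((hi t ht).const_mul 2) le
    rw [integral_const_mul] at b4
    have b5 : 0 ≤ ∫ x, cdot (Hop A B (u t) x) (Hop A B (u t) x) * s x :=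
      integral_nonneg fun x => mul_nonneg (cdot_self_nonneg _) (hN.density_pos x).le
    exact ⟨(rcomp c).contDiff.comp (hu.contDiff ht), cβ, h1 t ht c, iβ, h2 t ht c,
      by linarith, by linarith, by linarith⟩
  refine (sol.smoothing fe hN hσ hε0 hε' hS).trans (le_of_eq ?_)
  congr 1
  ring

end Assembly

/-- **Local smoothing in Campanato-type norms for the Dirac equation on asymptotically flat
manifolds** (Theorem 1 of Cacciafesta–de Suzzoni, Campanato form; the suprema over `R > 0`
are expressed by quantifying over the two radii). -/
theorem stmt1 (σ ν N : ℝ) (hσ : σ ∈ Set.Ioo (0 : ℝ) 1) (hν : 0 < ν) (hνN : ν ≤ N) :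
    ∃ ε > (0 : ℝ), ∃ C > (0 : ℝ),
      ∀ h : Eu 3 → Matrix (Fin 3) (Fin 3) ℝ,
        (∀ j k : Fin 3, ContDiff ℝ (⊤ : ℕ∞) fun x => h x j k) →
        (∀ x, (h x).IsSymm) → (∀ x, (h x).PosDef) →
        Elliptic h ν N →
        ∀ CI Ch : ℝ, 0 ≤ CI → 0 ≤ Ch → CI ≤ ε → Ch ≤ ε → AFlat h σ CI Ch →
        ∀ m : ℝ, 0 ≤ m →
        ∀ φ : ℝ → ℝ, ContinuousOn φ (Set.Ici 0) → (∀ t, 0 ≤ t → 0 < φ t) →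
        ∀ (A : Fin 3 → Eu 3 → Fin 4 → Fin 4 → ℂ) (B : Eu 3 → Fin 4 → Fin 4 → ℂ),
          (∀ j i k, ContDiff ℝ (⊤ : ℕ∞) fun x => A j x i k) →
          (∀ i k, ContDiff ℝ (⊤ : ℕ∞) fun x => B x i k) →
          (∀ f g : Eu 3 → Fin 4 → ℂ, ContDiff ℝ (⊤ : ℕ∞) f → ContDiff ℝ (⊤ : ℕ∞) g →
            HasCompactSupport f → HasCompactSupport g →
            innC4 h (Hop A B f) g = innC4 h f (Hop A B g)) →
          (∀ f : Eu 3 → Fin 4 → ℂ, ContDiff ℝ (⊤ : ℕ∞) f → ∀ (x : Eu 3) (i : Fin 4),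
            Hop A B (Hop A B f) x i
              = ((m : ℂ) ^ 2) * f x i - lapC h (fun y => f y i) x
                + ((Rscal h x / 4 : ℝ) : ℂ) * f x i) →
          ∀ (u : ℝ → Eu 3 → Fin 4 → ℂ) (u₀ : Eu 3 → Fin 4 → ℂ),
            ContDiffOn ℝ (⊤ : ℕ∞) (fun p : ℝ × Eu 3 => u p.1 p.2)
              (Set.Ici (0 : ℝ) ×ˢ (Set.univ : Set (Eu 3))) →
            (∀ t, 0 ≤ t → ∃ F : SchwartzMap (Eu 3) (Fin 4 → ℂ), ⇑F = u t) →
            (∀ t, 0 ≤ t → ∀ (x : Eu 3) (i : Fin 4),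
              Complex.I * ((φ t : ℝ) : ℂ) * derivWithin (fun s => u s x i) (Set.Ici 0) t
                = Hop A B (u t) x i) →
            (∀ x, u 0 x = u₀ x) →
            ∀ R₁ R₂ : ℝ, 0 < R₁ → 0 < R₂ →
              (1 + R₁ ^ 2)⁻¹ *
                  sphInt (fun x =>
                    (∫ t in Set.Ioi (0 : ℝ), (φ t)⁻¹ * ∑ i, ‖u t x i‖ ^ 2) * sdet h x) R₁
                + (Real.sqrt (1 + R₂ ^ 2))⁻¹ *
                    (∫ x in Metric.ball (0 : Eu 3) R₂,
                      (∫ t in Set.Ioi (0 : ℝ),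
                        (φ t)⁻¹ * ∑ j, ∑ i, ‖pd j (fun y => u t y i) x‖ ^ 2) * sdet h x)
              ≤ C * ∫ x : Eu 3, (∑ i, ‖Hop A B u₀ x i‖ ^ 2) * sdet h x := by
  obtain ⟨hσ0, hσ1⟩ := hσ
  have hε0 : 0 < σ / 10400000000 := by positivity
  refine ⟨σ / 10400000000, hε0, 51200000, by norm_num, ?_⟩
  intro h hs hsymm hp _ CI Ch _ _ hCI hCh hflat m _ φ hφ hφ0 A B hA hB hself hsq u u₀ hu hF hd h0
    R₁ R₂ hR₁ hR₂
  have hN := (hflat.invBounds ⟨hσ0, hσ1⟩ hs hsymm hp hCI hCh).nearFlat (by linarith)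
  have D := diracOp_of_sq_eq hN.smooth_inv hN.smooth_density hA hB hself hsq
  obtain rfl : u 0 = u₀ := funext h0
  have hu' : SmoothST u := hu
  have hb := fun S hS => D.smoothing hN ⟨hσ0, hσ1⟩ (by positivity) (by linarith) (by linarith)
    hφ hφ0 hu'
    (fun t ht c => by obtain ⟨F, hF⟩ := hF t ht; rw [← hF]; exact (F.integrable_rcomp_sq c).1)
    (fun t ht c => by obtain ⟨F, hF⟩ := hF t ht; rw [← hF]; exact (F.integrable_rcomp_sq c).2)
    (fun t ht x => hu'.hasDerivAt_of_dirac ht (hφ0 t ht.le) (hd t ht.le x)) (S := S) hS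
  have hs0 := fun x => (hN.density_pos x).le
  have hb0 : 0 ≤ 3200 * ∫ x, cdot (Hop A B (u 0) x) (Hop A B (u 0) x) * sdet h x :=
    mul_nonneg (by norm_num)
      (integral_nonneg fun x => mul_nonneg (cdot_self_nonneg _) (hs0 x))
  have b1 := sphInt_le hu' hs0 hN.density_le hφ hφ0 hR₁ hb0 hb
  have b2 := ballInt_le hu' hs0 hN.density_le hφ hφ0 hR₂ hb0 hb
  simp only [sum_norm_sq_eq (Hop A B (u 0) _), ← cdot_self]
  linarith
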